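/- arXiv:2509.01901 — 3 statements merged into one kernel-verified Lean document; each statement's English description precedes it below -/
import Mathlib

section
/- If G is a simple graph on n vertices that is not a tree, then there exist at most n-2 subsets E_1, ..., E_k of E(G) whose union is E(G), such that each E_i is either the edge set of a cycle of G or consists of a single edge; in particular g_ce(G) ≤ n-2. -/
universe u


/-- consecutive edges of a list of vertices -/
def el {V : Type*} : List V → List (Sym2 V)
  | [] => []
  | [_] => []
  | a :: b :: t => s(a, b) :: el (b :: t)

/-- the ends of a list -/
def en {V : Type*} (l : List V) (b : Bool) : Option V := if b then l.getLast? else l.head?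

/-- `y` is next to `x` on the side `b` of `l` -/
def IsFirst {V : Type*} (x : V) (l : List V) (b : Bool) (y : V) : Prop :=
  if b then ∃ p q, l = p ++ x :: y :: q else ∃ p q, l = p ++ y :: x :: q

section lists
variable {V : Type*}

lemma el_append (s : List V) (x : V) (t : List V) :
    el (s ++ x :: t) = el (s ++ [x]) ++ el (x :: t) := by
  induction s with
  | nil => simp [el]
  | cons a s ih =>
    cases s with
    | nil => simp [el]
    | cons b s => simpa [el] using ih

lemma el_reverse (l : List V) : el l.reverse = (el l).reverse := by
  induction l with
  | nil => simp [el]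
  | cons a s ih =>
    cases s with
    | nil => simp [el]
    | cons b s =>
      have := el_append s.reverse b [a]
      simp only [List.reverse_cons, List.append_assoc, List.singleton_append, el] at *
      rw [this, ih]
      simp [el, Sym2.eq_swap]

lemma mem_el_reverse (l : List V) (e : Sym2 V) : e ∈ el l.reverse ↔ e ∈ el l := by
  simp [el_reverse]

lemma mem_el_mid (s : List V) (x : V) (t : List V) (e : Sym2 V) :
    e ∈ el (s.reverse ++ x :: t) ↔ e ∈ el (x :: s) ∨ e ∈ el (x :: t) := by
  rw [el_append, List.mem_append, show s.reverse ++ [x] = (x :: s).reverse by simp,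
    mem_el_reverse]

lemma el_length (l : List V) : (el l).length = l.length - 1 := by
  induction l with
  | nil => simp [el]
  | cons a s ih =>
    cases s with
    | nil => simp [el]
    | cons b s => simp [el, ih]

lemma mem_of_mem_el {l : List V} {e : Sym2 V} (h : e ∈ el l) {v : V} (hv : v ∈ e) : v ∈ l := by
  induction l with
  | nil => simp [el] at h
  | cons a s ih =>
    cases s with
    | nil => simp [el] at h
    | cons b s =>
      simp only [el, List.mem_cons] at h
      rcases h with rfl | h
      · simp at hv; rcases hv with rfl | rfl <;> simp
      · exact List.mem_cons_of_mem _ (ih h)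

lemma mem_el_iff (l : List V) (e : Sym2 V) :
    e ∈ el l ↔ ∃ p q a b, l = p ++ a :: b :: q ∧ e = s(a, b) := by
  constructor
  · intro h
    induction l with
    | nil => simp [el] at h
    | cons a s ih =>
      cases s with
      | nil => simp [el] at h
      | cons b s =>
        simp only [el, List.mem_cons] at h
        rcases h with rfl | h
        · exact ⟨[], s, a, b, rfl, rfl⟩
        · obtain ⟨p, q, c, d, h1, h2⟩ := ih h
          exact ⟨a :: p, q, c, d, by simp [h1], h2⟩
  · rintro ⟨p, q, a, b, rfl, rfl⟩
    rw [el_append]; simp [el]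

lemma mem_el_iff_first (l : List V) (x y : V) : s(x, y) ∈ el l ↔ ∃ b, IsFirst x l b y := by
  rw [mem_el_iff]
  simp only [IsFirst, Bool.exists_bool, if_true, Bool.false_eq_true, if_false]
  constructor
  · rintro ⟨p, q, a, b, h, h2⟩
    rw [Sym2.eq_iff] at h2
    rcases h2 with ⟨rfl, rfl⟩ | ⟨rfl, rfl⟩
    · exact Or.inr ⟨p, q, h⟩
    · exact Or.inl ⟨p, q, h⟩
  · rintro (⟨p, q, h⟩ | ⟨p, q, h⟩)
    · exact ⟨p, q, y, x, h, Sym2.eq_swap⟩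
    · exact ⟨p, q, x, y, h, rfl⟩

lemma el_nodup {l : List V} (h : l.Nodup) : (el l).Nodup := by
  induction l with
  | nil => simp [el]
  | cons a s ih =>
    cases s with
    | nil => simp [el]
    | cons b s =>
      simp only [el, List.nodup_cons]
      refine ⟨fun h1 => ?_, ih (List.nodup_cons.1 h).2⟩
      exact (List.nodup_cons.1 h).1 (mem_of_mem_el h1 (by simp))

lemma first_side {l : List V} (h : l.Nodup) {x y : V} {b c : Bool} (h1 : IsFirst x l b y)
    (h2 : IsFirst x l c y) : b = c := by
  classical
  have key : ∀ {l : List V}, l.Nodup → (∃ p q, l = p ++ x :: y :: q) →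
      (∃ p q, l = p ++ y :: x :: q) → False := by
    rintro l hl ⟨p, q, rfl⟩ ⟨p', q', h⟩
    have h3 := congrArg (List.idxOf x) h
    have h4 := congrArg (List.idxOf y) h
    have hl' := hl
    rw [h] at hl'
    simp [List.nodup_append] at hl hl'
    have a1 : x ∉ p := by grind
    have a2 : y ∉ p := by grind
    have a3 : x ∉ p' := by grind
    have a4 : y ∉ p' := by grind
    have a5 : x ≠ y := by grind
    simp [List.idxOf_append, a1, a2, a3, a4, List.idxOf_cons, a5, a5.symm] at h3 h4
    have a6 : (x == y) = false := by simp [a5]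
    have a7 : (y == x) = false := by simp [a5.symm]
    omega
  cases b <;> cases c <;> simp only [IsFirst, if_true, Bool.false_eq_true, if_false] at h1 h2
  · rfl
  · exact (key h h2 h1).elim
  · exact (key h h1 h2).elim
  · rfl

/-- The switching lemma for a list containing `x`. -/
lemma switch_mem (x : V) (l : List V) (hl : l.Nodup) (hx : x ∈ l) (R : Bool → Prop)
    (hR : ∀ b, R b → en l b ≠ some x) :
    ∃ l' : List V, l'.Nodup ∧ l'.length = l.length ∧
      (∀ b, ¬ R b → en l' b = en l b) ∧
      (∀ b, R b → ∃ y, IsFirst x l b y ∧ en l' b = some y) ∧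
      (∀ e ∈ el l, e ∈ el l' ∨ ∃ b y, R b ∧ IsFirst x l b y ∧ e = s(x, y)) ∧
      (∀ e ∈ el l', e ∈ el l ∨ ∃ b y, R b ∧ en l b = some y ∧ e = s(x, y)) ∧
      (∀ b y, R b → en l b = some y → s(x, y) ∈ el l') := by
  classical
  obtain ⟨s0, t, rfl⟩ := List.append_of_mem hx
  obtain ⟨s, rfl⟩ : ∃ s, s0 = s.reverse := ⟨s0.reverse, by simp⟩
  have side : ∀ (b : Bool) (t : List V), (R b → t ≠ []) → ∃ t' : List V, t'.Perm t ∧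
      (¬ R b → t' = t) ∧ (R b → ∃ y z p q, t = y :: p ∧ t = q ++ [z] ∧ t' = t.reverse ∧
      (∀ e, e ∈ el (x :: t) ↔ e = s(x, y) ∨ e ∈ el t) ∧
      (∀ e, e ∈ el (x :: t') ↔ e = s(x, z) ∨ e ∈ el t)) := by
    intro b t ht
    by_cases hb : R b
    · refine ⟨t.reverse, List.reverse_perm t, by simp [hb], fun _ => ?_⟩
      have h1 := ht hb
      obtain ⟨y, p, h2⟩ := List.exists_cons_of_ne_nil h1
      obtain ⟨q, z, h3⟩ : ∃ q z, t = q ++ [z] := ⟨_, _, (List.dropLast_append_getLast h1).symm⟩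
      refine ⟨y, z, p, q, h2, h3, rfl, ?_, ?_⟩
      · intro e; subst h2; simp [el]
      · intro e; rw [← mem_el_reverse t]; subst h3; simp [el]
    · exact ⟨t, List.Perm.refl _, by simp, by simp [hb]⟩
  obtain ⟨t', t1, t2, t3⟩ := side true t (by
    rintro h rfl; exact hR true h (by simp [en]))
  obtain ⟨s', s1, s2, s3⟩ := side false s (by
    rintro h rfl; exact hR false h (by simp [en]))
  refine ⟨s'.reverse ++ x :: t', ?_, ?_, ?_, ?_, ?_, ?_, ?_⟩
  · have : (s'.reverse ++ x :: t').Perm (s.reverse ++ x :: t) :=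
      ((s'.reverse_perm.trans s1).trans s.reverse_perm.symm).append (t1.cons _)
    exact this.nodup_iff.2 hl
  · simp [s1.length_eq, t1.length_eq]
  · intro b hb
    cases b
    · simp [en, s2 hb]
    · simp [en, t2 hb, List.getLast?_cons]
  · intro b hb
    cases b
    · obtain ⟨y, z, p, q, h1, h2, h3, -⟩ := s3 hb
      refine ⟨y, ?_, ?_⟩
      · simp only [IsFirst, Bool.false_eq_true, if_false]
        exact ⟨p.reverse, t, by simp [h1]⟩
      · simp [en, h3, h1, List.getLast?_cons]
    · obtain ⟨y, z, p, q, h1, h2, h3, -⟩ := t3 hb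
      refine ⟨y, ?_, ?_⟩
      · simp only [IsFirst, if_true]
        exact ⟨s.reverse, p, by simp [h1]⟩
      · simp [en, h3, h1, List.getLast?_cons]
  · intro e he
    rw [mem_el_mid] at he ⊢
    rcases he with he | he
    · by_cases hb : R false
      · obtain ⟨y, z, p, q, h1, h2, h3, h4, h5⟩ := s3 hb
        rcases (h4 e).1 he with h | h
        · refine Or.inr ⟨false, y, hb, ?_, h⟩
          simp only [IsFirst, Bool.false_eq_true, if_false]
          exact ⟨p.reverse, t, by simp [h1]⟩
        · exact Or.inl (Or.inl ((h5 e).2 (Or.inr h)))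
      · rw [s2 hb]; exact Or.inl (Or.inl he)
    · by_cases hb : R true
      · obtain ⟨y, z, p, q, h1, h2, h3, h4, h5⟩ := t3 hb
        rcases (h4 e).1 he with h | h
        · refine Or.inr ⟨true, y, hb, ?_, h⟩
          simp only [IsFirst, if_true]
          exact ⟨s.reverse, p, by simp [h1]⟩
        · exact Or.inl (Or.inr ((h5 e).2 (Or.inr h)))
      · rw [t2 hb]; exact Or.inl (Or.inr he)
  · intro e he
    rw [mem_el_mid] at he ⊢
    rcases he with he | he
    · by_cases hb : R false
      · obtain ⟨y, z, p, q, h1, h2, h3, h4, h5⟩ := s3 hb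
        rcases (h5 e).1 he with h | h
        · exact Or.inr ⟨false, z, hb, by simp [en, h2, List.getLast?_cons], h⟩
        · exact Or.inl (Or.inl ((h4 e).2 (Or.inr h)))
      · rw [s2 hb] at he; exact Or.inl (Or.inl he)
    · by_cases hb : R true
      · obtain ⟨y, z, p, q, h1, h2, h3, h4, h5⟩ := t3 hb
        rcases (h5 e).1 he with h | h
        · refine Or.inr ⟨true, z, hb, by simp [en, h2, List.getLast?_cons], h⟩
        · exact Or.inl (Or.inr ((h4 e).2 (Or.inr h)))
      · rw [t2 hb] at he; exact Or.inl (Or.inr he)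
  · intro b y hb hy
    rw [mem_el_mid]
    cases b
    · obtain ⟨y', z, p, q, h1, h2, h3, h4, h5⟩ := s3 hb
      have : z = y := by simpa [en, h2, List.getLast?_cons] using hy
      exact Or.inl ((h5 _).2 (Or.inl (by rw [this])))
    · obtain ⟨y', z, p, q, h1, h2, h3, h4, h5⟩ := t3 hb
      have : z = y := by simpa [en, h2, List.getLast?_cons] using hy
      exact Or.inr ((h5 _).2 (Or.inl (by rw [this])))

open Classical in
/-- The switching lemma for a list not containing `x`. -/
lemma switch_not_mem (x : V) (l : List V) (hl : l.Nodup)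
    (hne : l ≠ []) (hx : x ∉ l) (R : Bool → Prop) :
    ∃ l' : List V, (¬ (R true ∧ R false) → l'.Nodup) ∧
      l'.length = l.length + (if R true then 1 else 0) + (if R false then 1 else 0) ∧
      (∀ b, ¬ R b → en l' b = en l b) ∧
      (∀ b, R b → en l' b = some x) ∧
      (∀ e ∈ el l, e ∈ el l') ∧
      (∀ e ∈ el l', e ∈ el l ∨ ∃ b y, R b ∧ en l b = some y ∧ e = s(x, y)) ∧
      (∀ b y, R b → en l b = some y → s(x, y) ∈ el l') ∧
      (R true → R false → l' = x :: (l ++ [x])) := by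
  classical
  obtain ⟨y, p, h2⟩ := List.exists_cons_of_ne_nil hne
  obtain ⟨q, z, h3⟩ : ∃ q z, l = q ++ [z] := ⟨_, _, (List.dropLast_append_getLast hne).symm⟩
  have ey : en l false = some y := by simp [en, h2]
  have ez : en l true = some z := by simp [en, h3]
  have m1 : ∀ e, e ∈ el (x :: l) ↔ e = s(x, y) ∨ e ∈ el l := by
    intro e; subst h2; simp [el]
  have m2 : ∀ e, e ∈ el (l ++ [x]) ↔ e = s(x, z) ∨ e ∈ el l := by
    intro e; rw [h3, List.append_assoc, List.singleton_append, el_append]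
    simp [el, or_comm, Sym2.eq_swap (a := x)]
  have m3 : ∀ e, e ∈ el (x :: (l ++ [x])) ↔ e = s(x, y) ∨ e = s(x, z) ∨ e ∈ el l := by
    intro e; rw [← m2 e, h2]; simp [el]
  by_cases h1 : R true <;> by_cases h0 : R false
  · refine ⟨x :: (l ++ [x]), by simp [h1, h0], by simp [h1, h0], ?_, ?_, ?_, ?_, ?_, by simp⟩
    · rintro (_ | _) <;> simp [h1, h0]
    · rintro (_ | _) <;> simp [en, List.getLast?_cons]
    all_goals simp [m3, h1, h0, ey, ez]; try grind
  · refine ⟨l ++ [x], ?_, by simp [h1, h0], ?_, ?_, ?_, ?_, ?_, by simp [h0]⟩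
    · intro _; simp [List.nodup_append, hl]; grind
    · rintro (_ | _) <;> simp [h1, h0, en, h2]
    · rintro (_ | _) <;> simp [h1, h0, en]
    all_goals simp [m2, h1, h0, ey, ez]; try grind
  · refine ⟨x :: l, ?_, by simp [h1, h0], ?_, ?_, ?_, ?_, ?_, by simp [h1]⟩
    · intro _; simp [hl, hx]
    · rintro (_ | _) <;> simp [h1, h0, en, h3, List.getLast?_cons]
    · rintro (_ | _) <;> simp [h1, h0, en]
    all_goals simp [m1, h1, h0, ey, ez]; try grind
  · refine ⟨l, fun _ => hl, by simp [h1, h0], ?_, ?_, ?_, ?_, ?_, by simp [h1]⟩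
    · rintro (_ | _) <;> simp
    · rintro (_ | _) <;> simp [h1, h0]
    all_goals simp [h1, h0]; try grind

end lists


open Classical in
lemma switch_fam {V ι : Type*} (F : ι → List V) (hF : ∀ i, (F i).Nodup ∧ F i ≠ []) (x : V)
    (R : ι → Bool → Prop) (hR : ∀ i b, R i b → en (F i) b ≠ some x) :
    ∃ F' : ι → List V,
      (∀ i, F' i ≠ []) ∧
      (∀ i, (x ∈ F i ∨ ¬ (R i true ∧ R i false)) → (F' i).Nodup) ∧
      (∀ i b, ¬ R i b → en (F' i) b = en (F i) b) ∧
      (∀ i b, R i b → x ∈ F i → ∃ y, IsFirst x (F i) b y ∧ en (F' i) b = some y) ∧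
      (∀ i b, R i b → x ∉ F i → en (F' i) b = some x) ∧
      (∀ i, ∀ e ∈ el (F i), e ∈ el (F' i) ∨ ∃ b y, R i b ∧ IsFirst x (F i) b y ∧ e = s(x, y)) ∧
      (∀ i, ∀ e ∈ el (F' i), e ∈ el (F i) ∨ ∃ b y, R i b ∧ en (F i) b = some y ∧ e = s(x, y)) ∧
      (∀ i b y, R i b → en (F i) b = some y → s(x, y) ∈ el (F' i)) ∧
      (∀ i, x ∉ F i → R i true → R i false → F' i = x :: (F i ++ [x])) ∧
      (∀ i, (F' i).length = (F i).length +
        (Finset.univ.filter fun b : Bool => R i b ∧ x ∉ F i).card) := by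
  have H : ∀ i, ∃ l' : List V, l' ≠ [] ∧
      ((x ∈ F i ∨ ¬ (R i true ∧ R i false)) → l'.Nodup) ∧
      (∀ b, ¬ R i b → en l' b = en (F i) b) ∧
      (∀ b, R i b → x ∈ F i → ∃ y, IsFirst x (F i) b y ∧ en l' b = some y) ∧
      (∀ b, R i b → x ∉ F i → en l' b = some x) ∧
      (∀ e ∈ el (F i), e ∈ el l' ∨ ∃ b y, R i b ∧ IsFirst x (F i) b y ∧ e = s(x, y)) ∧
      (∀ e ∈ el l', e ∈ el (F i) ∨ ∃ b y, R i b ∧ en (F i) b = some y ∧ e = s(x, y)) ∧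
      (∀ b y, R i b → en (F i) b = some y → s(x, y) ∈ el l') ∧
      (x ∉ F i → R i true → R i false → l' = x :: (F i ++ [x])) ∧
      (l'.length = (F i).length +
        (Finset.univ.filter fun b : Bool => R i b ∧ x ∉ F i).card) := by
    intro i
    have hpos : 0 < (F i).length := List.length_pos_of_ne_nil (hF i).2
    by_cases hx : x ∈ F i
    · obtain ⟨l', h1, h2, h3, h4, h5, h6, h7⟩ := switch_mem x (F i) (hF i).1 hx (R i) (hR i)
      refine ⟨l', ?_, fun _ => h1, h3, fun b hb _ => h4 b hb, fun _ _ h => (h hx).elim, h5, h6, h7,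
        fun h => (h hx).elim, ?_⟩
      · rw [← List.length_pos_iff, h2]; exact hpos
      · simp [h2, hx]
    · obtain ⟨l', h1, h2, h3, h4, h5, h6, h7, h8⟩ :=
        switch_not_mem x (F i) (hF i).1 (hF i).2 hx (R i)
      refine ⟨l', ?_, fun h => h1 (h.resolve_left hx), h3, fun _ _ h => (hx h).elim,
        fun b hb _ => h4 b hb, fun e he => Or.inl (h5 e he), h6, h7, fun _ => h8, ?_⟩
      · rw [← List.length_pos_iff, h2]; omega
      · rw [h2, add_assoc]
        by_cases a : R i true <;> by_cases b : R i false <;>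
          simp [a, b, hx, Finset.filter_insert, Finset.filter_singleton]
  choose F' h1 h2 h3 h4 h5 h6 h7 h8 h9 h10 using H
  exact ⟨F', h1, h2, h3, h4, h5, h6, h7, h8, h9, h10⟩

/-- closure of a set of slots -/
inductive Rc {V ι : Type*} (F : ι → List V) (x : V) (d : V → ι × Bool) (S0 : ι → Bool → Prop) :
    ι → Bool → Prop
  | base {i b} : S0 i b → Rc F x d S0 i b
  | step {i b y} : Rc F x d S0 i b → IsFirst x (F i) b y → Rc F x d S0 (d y).1 (d y).2

open Classical in
lemma switch_main {V ι : Type*} (F : ι → List V) (hF : ∀ i, (F i).Nodup ∧ F i ≠ []) (x : V)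
    (d : V → ι × Bool) (S0 : ι → Bool → Prop)
    (hS0 : ∀ i b, S0 i b → ∃ c, c ≠ x ∧ en (F i) b = some c)
    (hd : ∀ i y, s(x, y) ∈ el (F i) → en (F (d y).1) (d y).2 = some y) :
    ∃ (R : ι → Bool → Prop) (F' : ι → List V),
      (∀ i b, S0 i b → R i b) ∧
      (∀ i b, R i b → S0 i b ∨ ∃ y j c, R j c ∧ IsFirst x (F j) c y ∧ (i, b) = d y ∧
        en (F i) b = some y) ∧
      (∀ i b y, R i b → IsFirst x (F i) b y → R (d y).1 (d y).2) ∧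
      (∀ i b, R i b → en (F i) b ≠ some x) ∧
      (∀ i, F' i ≠ []) ∧
      (∀ i, (x ∈ F i ∨ ¬ (R i true ∧ R i false)) → (F' i).Nodup) ∧
      (∀ i b, ¬ R i b → en (F' i) b = en (F i) b) ∧
      (∀ i b, R i b → x ∈ F i → ∃ y, IsFirst x (F i) b y ∧ en (F' i) b = some y) ∧
      (∀ i b, R i b → x ∉ F i → en (F' i) b = some x) ∧
      (∀ i, ∀ e ∈ el (F i), ∃ j, e ∈ el (F' j)) ∧
      (∀ i, ∀ e ∈ el (F' i), (∃ j, e ∈ el (F j)) ∨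
        ∃ b y, S0 i b ∧ en (F i) b = some y ∧ e = s(x, y)) ∧
      (∀ i b y, R i b → en (F i) b = some y → s(x, y) ∈ el (F' i)) ∧
      (∀ i, x ∉ F i → R i true → R i false → F' i = x :: (F i ++ [x])) ∧
      (∀ i, (F' i).length = (F i).length +
        (Finset.univ.filter fun b : Bool => R i b ∧ x ∉ F i).card) := by
  have hne : ∀ i y, s(x, y) ∈ el (F i) → y ≠ x := by
    rintro i y h rfl
    obtain ⟨b, hb⟩ := (mem_el_iff_first _ _ _).1 h
    have := (hF i).1
    cases b <;> simp only [IsFirst, if_true, Bool.false_eq_true, if_false] at hb <;>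
    · obtain ⟨p, q, h⟩ := hb
      rw [h] at this
      simp [List.nodup_append] at this
  have hR1 : ∀ i b, Rc F x d S0 i b → S0 i b ∨ ∃ y j c, Rc F x d S0 j c ∧ IsFirst x (F j) c y ∧
      (i, b) = d y ∧ en (F i) b = some y := by
    intro i b h
    cases h with
    | base h => exact Or.inl h
    | @step j c y h1 h2 =>
      exact Or.inr ⟨y, j, c, h1, h2, rfl, hd j y ((mem_el_iff_first _ _ _).2 ⟨_, h2⟩)⟩
  have hR2 : ∀ i b, Rc F x d S0 i b → en (F i) b ≠ some x := by
    intro i b h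
    rcases hR1 i b h with h | ⟨y, j, c, h1, h2, h3, h4⟩
    · obtain ⟨c, hc, h⟩ := hS0 i b h
      rw [h]; simpa using hc
    · rw [h4]
      simpa using hne j y ((mem_el_iff_first _ _ _).2 ⟨_, h2⟩)
  obtain ⟨F', h1, h2, h3, h4, h5, h6, h7, h8, h9, h10⟩ := switch_fam F hF x _ hR2
  refine ⟨Rc F x d S0, F', fun _ _ h => Rc.base h, hR1, fun _ _ _ h1 h2 => Rc.step h1 h2, hR2,
    h1, h2, h3, h4, h5, ?_, ?_, h8, h9, h10⟩
  · intro i e he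
    rcases h6 i e he with h | ⟨b, y, hb, hy, rfl⟩
    · exact ⟨i, h⟩
    · exact ⟨_, h8 _ _ _ (Rc.step hb hy) (hd i y he)⟩
  · intro i e he
    rcases h7 i e he with h | ⟨b, y, hb, hy, rfl⟩
    · exact Or.inl ⟨i, h⟩
    · rcases hR1 i b hb with h | ⟨z, j, c, g1, g2, g3, g4⟩
      · exact Or.inr ⟨b, y, h, hy, rfl⟩
      · rw [g4] at hy; cases hy
        exact Or.inl ⟨j, (mem_el_iff_first _ _ _).2 ⟨_, g2⟩⟩


section decomp
variable {V ι : Type*} [Fintype ι]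

open Classical in
/-- number of path ends at `v` -/
noncomputable def ec (F : ι → List V) (v : V) : ℕ :=
  (Finset.univ.filter fun s : ι × Bool => en (F s.1) s.2 = some v).card

/-- decomposition of an edge set into paths -/
def Decomp (F : ι → List V) (E : Finset (Sym2 V)) : Prop :=
  (∀ i, (F i).Nodup ∧ F i ≠ []) ∧ (∀ e, e ∈ E ↔ ∃ i, e ∈ el (F i)) ∧
    ∑ i, ((F i).length - 1) = E.card

lemma Decomp.unique {F : ι → List V} {E : Finset (Sym2 V)} (h : Decomp F E) {e : Sym2 V}
    {i j : ι} (hi : e ∈ el (F i)) (hj : e ∈ el (F j)) : i = j := by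
  classical
  obtain ⟨h1, h2, h3⟩ := h
  let T : Finset (Σ _ : ι, Sym2 V) := Finset.univ.sigma fun i => (el (F i)).toFinset
  have hT : T.card = E.card := by
    rw [← h3, Finset.card_sigma]
    refine Finset.sum_congr rfl fun i _ => ?_
    rw [List.toFinset_card_of_nodup (el_nodup (h1 i).1), el_length]
  have hinj := Finset.injOn_of_surjOn_of_card_le (s := T) (t := E) (fun p => p.2)
    (by
      intro p hp
      simp only [T, Finset.coe_sigma, Set.mem_sigma_iff, Finset.mem_coe, List.mem_toFinset] at hp
      exact (h2 _).2 ⟨_, hp.2⟩)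
    (by
      intro e he
      obtain ⟨i, hi⟩ := (h2 e).1 he
      exact ⟨⟨i, e⟩, by simp [T, hi], rfl⟩) hT.le
  have := hinj (x₁ := ⟨i, e⟩) (x₂ := ⟨j, e⟩) (by simp [T, hi]) (by simp [T, hj]) rfl
  simpa using this

lemma en_isSome {l : List V} (h : l ≠ []) (b : Bool) : ∃ v, en l b = some v := by
  obtain ⟨y, p, h2⟩ := List.exists_cons_of_ne_nil h
  cases b
  · exact ⟨y, by simp [en, h2]⟩
  · exact ⟨_, by simp [en, h2, List.getLast?_cons]; rfl⟩

lemma sum_ec [Fintype V] (F : ι → List V) (h : ∀ i, F i ≠ []) :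
    ∑ v, ec F v = Fintype.card (ι × Bool) := by
  classical
  choose g hg using fun s : ι × Bool => en_isSome (h s.1) s.2
  rw [← Finset.card_univ, Finset.card_eq_sum_card_fiberwise (f := g) (t := Finset.univ) (by simp)]
  refine Finset.sum_congr rfl fun v _ => ?_
  unfold ec
  congr 1
  ext s
  simp [hg]

lemma one_le_ec {F : ι → List V} {v : V} : 1 ≤ ec F v ↔ ∃ i b, en (F i) b = some v := by
  classical
  rw [ec, Nat.one_le_iff_ne_zero, Nat.ne_zero_iff_zero_lt, Finset.card_pos]
  constructor
  · rintro ⟨s, hs⟩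
    exact ⟨s.1, s.2, by simpa using hs⟩
  · rintro ⟨i, b, h⟩
    exact ⟨(i, b), by simp [h]⟩

lemma first_unique {l : List V} (h : l.Nodup) {x y z : V} {b : Bool} (h1 : IsFirst x l b y)
    (h2 : IsFirst x l b z) : y = z := by
  classical
  have key : ∀ {p q p' q' : List V}, (p ++ x :: q).Nodup → p ++ x :: q = p' ++ x :: q' →
      p = p' ∧ q = q' := by
    intro p q p' q' hn he
    have hn' := hn
    rw [he] at hn'
    have a1 : x ∉ p := by simp [List.nodup_append] at hn; grind
    have a2 : x ∉ p' := by simp [List.nodup_append] at hn'; grind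
    have h3 := congrArg (List.idxOf x) he
    simp [List.idxOf_append, a1, a2] at h3
    have := List.append_inj he h3
    simpa using this
  cases b <;> simp only [IsFirst, if_true, Bool.false_eq_true, if_false] at h1 h2
  · obtain ⟨p, q, rfl⟩ := h1
    obtain ⟨p', q', h2⟩ := h2
    have := (key (p := p ++ [y]) (q := q) (p' := p' ++ [z]) (q' := q') (by simpa using h)
      (by simpa using h2)).1
    have := congrArg List.getLast? this
    simpa using this
  · obtain ⟨p, q, rfl⟩ := h1
    obtain ⟨p', q', h2⟩ := h2
    have := (key h h2).2
    simp at this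
    exact this.1

open Classical in
lemma switch_one [Fintype V] (F : ι → List V) (E : Finset (Sym2 V)) (hD : Decomp F E) (x u : V)
    (hxu : x ≠ u) (hE : s(x, u) ∉ E) (hu : 1 ≤ ec F u) (hnb : ∀ y, s(x, y) ∈ E → 1 ≤ ec F y) :
    ∃ F' : ι → List V, Decomp F' (insert s(x, u) E) ∧ ec F' u + 1 = ec F u ∧
      ec F' x = ec F x + 1 ∧ ∀ v, v ≠ x → v ≠ u → ec F' v = ec F v := by
  obtain ⟨i0, b0, h0⟩ := one_le_ec.1 hu
  let d : V → ι × Bool := fun y =>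
    if h : ∃ s : ι × Bool, en (F s.1) s.2 = some y then h.choose else (i0, b0)
  have hd0 : ∀ y, 1 ≤ ec F y → en (F (d y).1) (d y).2 = some y := by
    intro y hy
    obtain ⟨i, b, h⟩ := one_le_ec.1 hy
    have h : ∃ s : ι × Bool, en (F s.1) s.2 = some y := ⟨(i, b), h⟩
    simp only [d, h, dif_pos]
    exact h.choose_spec
  have hd : ∀ i y, s(x, y) ∈ el (F i) → en (F (d y).1) (d y).2 = some y :=
    fun i y h => hd0 y (hnb y ((hD.2.1 _).2 ⟨i, h⟩))
  obtain ⟨R, F', r1, r2, r3, r4, f1, f2, f3, f4, f5, f6, f7, f8, f9, f10⟩ :=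
    switch_main F hD.1 x d (fun i b => i = i0 ∧ b = b0)
    (by rintro i b ⟨rfl, rfl⟩; exact ⟨u, hxu.symm, h0⟩) hd
  have hfE : ∀ {i b y}, IsFirst x (F i) b y → s(x, y) ∈ E := fun h =>
    (hD.2.1 _).2 ⟨_, (mem_el_iff_first _ _ _).2 ⟨_, h⟩⟩
  have hfx : ∀ {i b}, ¬ IsFirst x (F i) b x := by
    intro i b hb
    have := (hD.1 i).1
    cases b <;> simp only [IsFirst, if_true, Bool.false_eq_true, if_false] at hb <;>
    · obtain ⟨p, q, h⟩ := hb
      rw [h] at this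
      simp [List.nodup_append] at this
  have hfu : ∀ {i b}, ¬ IsFirst x (F i) b u := fun h => hE (hfE h)
  have split : ∀ (G : ι → List V) v, ec G v =
      (Finset.univ.filter fun s : ι × Bool => ¬ R s.1 s.2 ∧ en (G s.1) s.2 = some v).card +
      (Finset.univ.filter fun s : ι × Bool => R s.1 s.2 ∧ en (G s.1) s.2 = some v).card := by
    intro G v
    unfold ec
    rw [← Finset.card_filter_add_card_filter_not (fun s : ι × Bool => ¬ R s.1 s.2),
      Finset.filter_filter, Finset.filter_filter]
    simp only [not_not, and_comm]
  have same : ∀ v, (Finset.univ.filter fun s : ι × Bool =>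
      ¬ R s.1 s.2 ∧ en (F' s.1) s.2 = some v).card =
      (Finset.univ.filter fun s : ι × Bool => ¬ R s.1 s.2 ∧ en (F s.1) s.2 = some v).card := by
    intro v
    congr 1
    ext s
    simp only [Finset.mem_filter, Finset.mem_univ, true_and]
    refine and_congr_right fun h => ?_
    rw [f3 _ _ h]
  have hA : ∀ v, v ≠ x → ∀ s : ι × Bool, (R s.1 s.2 ∧ en (F' s.1) s.2 = some v) ↔
      (R s.1 s.2 ∧ IsFirst x (F s.1) s.2 v) := by
    intro v hv s
    refine and_congr_right fun h => ?_
    by_cases hx : x ∈ F s.1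
    · obtain ⟨y, hy, hy'⟩ := f4 _ _ h hx
      rw [hy']
      constructor
      · intro h; cases h; exact hy
      · intro h'
        rw [first_unique (hD.1 s.1).1 hy h']
    · rw [f5 _ _ h hx]
      constructor
      · intro h; cases h; exact (hv rfl).elim
      · intro h'
        exact (hx (mem_of_mem_el ((mem_el_iff_first _ _ _).2 ⟨_, h'⟩) (by simp))).elim
  have hother : ∀ v, v ≠ x → v ≠ u → ec F' v = ec F v := by
    intro v hvx hvu
    rw [split F', split F, same]
    congr 1
    have a1 : (Finset.univ.filter fun s : ι × Bool =>
        R s.1 s.2 ∧ en (F' s.1) s.2 = some v).card ≤ 1 := by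
      rw [Finset.card_le_one]
      intro s hs t ht
      simp only [Finset.mem_filter, Finset.mem_univ, true_and, hA v hvx] at hs ht
      have h1 : s.1 = t.1 := hD.unique ((mem_el_iff_first _ _ _).2 ⟨_, hs.2⟩)
        ((mem_el_iff_first _ _ _).2 ⟨_, ht.2⟩)
      refine Prod.ext h1 (first_side (hD.1 s.1).1 hs.2 ?_)
      rw [h1]; exact ht.2
    have a2' : ∀ s : ι × Bool, R s.1 s.2 ∧ en (F s.1) s.2 = some v → s = d v ∧
        ∃ j c, R j c ∧ IsFirst x (F j) c v := by
      rintro ⟨i, b⟩ ⟨h1, h2⟩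
      rcases r2 i b h1 with ⟨rfl, rfl⟩ | ⟨y, j, c, g1, g2, g3, g4⟩
      · simp only [h0] at h2; cases h2; exact (hvu rfl).elim
      · simp only [g4] at h2; cases h2
        exact ⟨g3, j, c, g1, g2⟩
    have a2 : (Finset.univ.filter fun s : ι × Bool =>
        R s.1 s.2 ∧ en (F s.1) s.2 = some v).card ≤ 1 := by
      rw [Finset.card_le_one]
      intro s hs t ht
      simp only [Finset.mem_filter, Finset.mem_univ, true_and] at hs ht
      rw [(a2' s hs).1, (a2' t ht).1]
    have a3 : 0 < (Finset.univ.filter fun s : ι × Bool =>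
        R s.1 s.2 ∧ en (F' s.1) s.2 = some v).card ↔ 0 < (Finset.univ.filter fun s : ι × Bool =>
        R s.1 s.2 ∧ en (F s.1) s.2 = some v).card := by
      rw [Finset.card_pos, Finset.card_pos]
      constructor
      · rintro ⟨s, hs⟩
        simp only [Finset.mem_filter, Finset.mem_univ, true_and, hA v hvx] at hs
        refine ⟨d v, ?_⟩
        simp only [Finset.mem_filter, Finset.mem_univ, true_and]
        exact ⟨r3 _ _ _ hs.1 hs.2, hd0 _ (hnb _ (hfE hs.2))⟩
      · rintro ⟨s, hs⟩
        simp only [Finset.mem_filter, Finset.mem_univ, true_and] at hs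
        obtain ⟨-, j, c, h⟩ := a2' s hs
        refine ⟨(j, c), ?_⟩
        simp only [Finset.mem_filter, Finset.mem_univ, true_and, hA v hvx]
        exact h
    omega
  have hu' : ec F' u + 1 = ec F u := by
    rw [split F', split F, same, add_assoc]
    congr 1
    have a1 : (Finset.univ.filter fun s : ι × Bool =>
        R s.1 s.2 ∧ en (F' s.1) s.2 = some u).card = 0 := by
      simp only [hA u hxu.symm, hfu]; simp
    have a2 : (Finset.univ.filter fun s : ι × Bool =>
        R s.1 s.2 ∧ en (F s.1) s.2 = some u).card = 1 := by
      rw [Finset.card_eq_one]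
      refine ⟨(i0, b0), ?_⟩
      ext ⟨i, b⟩
      simp only [Finset.mem_filter, Finset.mem_univ, true_and, Finset.mem_singleton]
      constructor
      · rintro ⟨h1, h2⟩
        rcases r2 i b h1 with ⟨rfl, rfl⟩ | ⟨y, j, c, g1, g2, g3, g4⟩
        · rfl
        · simp only [g4] at h2; cases h2
          exact (hfu g2).elim
      · rintro h
        cases h
        exact ⟨r1 _ _ ⟨rfl, rfl⟩, h0⟩
    omega
  have hx' : ec F' x = ec F x + 1 := by
    have h1 := sum_ec F' f1
    rw [← sum_ec F fun i => (hD.1 i).2] at h1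
    rw [← Finset.add_sum_erase _ _ (Finset.mem_univ x), ← Finset.add_sum_erase _ _
      (Finset.mem_univ x), ← Finset.add_sum_erase (Finset.univ.erase x) _ (a := u)
      (by simp [hxu.symm]), ← Finset.add_sum_erase (Finset.univ.erase x) (ec F) (a := u)
      (by simp [hxu.symm])] at h1
    have h2 : ∑ v ∈ (Finset.univ.erase x).erase u, ec F' v =
        ∑ v ∈ (Finset.univ.erase x).erase u, ec F v := by
      refine Finset.sum_congr rfl fun v hv => ?_
      simp at hv
      exact hother v hv.2 hv.1
    omega
  have hext : (Finset.univ.filter fun s : ι × Bool => R s.1 s.2 ∧ x ∉ F s.1).card = 1 := by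
    have h1 := hx'
    rw [split F', split F, same] at h1
    have a1 : (Finset.univ.filter fun s : ι × Bool =>
        R s.1 s.2 ∧ en (F s.1) s.2 = some x).card = 0 := by
      rw [Finset.card_eq_zero, Finset.filter_eq_empty_iff]
      rintro s - ⟨h1, h2⟩
      exact r4 _ _ h1 h2
    have a2 : (Finset.univ.filter fun s : ι × Bool =>
        R s.1 s.2 ∧ en (F' s.1) s.2 = some x) =
        (Finset.univ.filter fun s : ι × Bool => R s.1 s.2 ∧ x ∉ F s.1) := by
      ext s
      simp only [Finset.mem_filter, Finset.mem_univ, true_and]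
      refine and_congr_right fun h => ⟨fun h2 hx => ?_, fun hx => f5 _ _ h hx⟩
      obtain ⟨y, hy, hy'⟩ := f4 _ _ h hx
      rw [h2] at hy'; cases hy'
      exact hfx hy
    rw [a1, a2] at h1
    omega
  refine ⟨F', ⟨fun i => ⟨f2 i ?_, f1 i⟩, ?_, ?_⟩, hu', hx', hother⟩
  · by_contra! hcon
    obtain ⟨h1, h2, h3⟩ := hcon
    rw [Finset.card_eq_one] at hext
    obtain ⟨a, ha⟩ := hext
    have k1 : (i, true) ∈ ({a} : Finset (ι × Bool)) := by rw [← ha]; simp [h1, h2]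
    have k2 : (i, false) ∈ ({a} : Finset (ι × Bool)) := by rw [← ha]; simp [h1, h3]
    rw [Finset.mem_singleton] at k1 k2
    rw [← k2] at k1
    simp at k1
  · intro e
    rw [Finset.mem_insert]
    constructor
    · rintro (rfl | h)
      · exact ⟨i0, f8 _ _ _ (r1 _ _ ⟨rfl, rfl⟩) h0⟩
      · obtain ⟨i, hi⟩ := (hD.2.1 e).1 h
        exact f6 i e hi
    · rintro ⟨i, hi⟩
      rcases f7 i e hi with h | ⟨b, y, ⟨rfl, rfl⟩, h2, h3⟩
      · exact Or.inr ((hD.2.1 e).2 h)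
      · rw [h0] at h2; cases h2
        exact Or.inl h3
  · rw [Finset.card_insert_of_notMem hE, ← hD.2.2, ← hext]
    have : (Finset.univ.filter fun s : ι × Bool => R s.1 s.2 ∧ x ∉ F s.1).card =
        ∑ i, (Finset.univ.filter fun b : Bool => R i b ∧ x ∉ F i).card := by
      simp only [Finset.card_filter]
      rw [Fintype.sum_prod_type]
    rw [this, ← Finset.sum_add_distrib]
    refine Finset.sum_congr rfl fun i _ => ?_
    rw [f10]
    have := List.length_pos_of_ne_nil (hD.1 i).2
    omega

end decomp


open Classical in
/-- degree in an edge set -/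
noncomputable def dg {V : Type*} (E : Finset (Sym2 V)) (v : V) : ℕ := (E.filter (v ∈ ·)).card

open Classical in
lemma dg_insert {V : Type*} (E : Finset (Sym2 V)) (x u v : V) (h : s(x, u) ∉ E) :
    dg (insert s(x, u) E) v = dg E v + if v = x ∨ v = u then 1 else 0 := by
  unfold dg
  rw [Finset.filter_insert]
  split_ifs with h1 h2 h2
  · rw [Finset.card_insert_of_notMem (by simp [h])]
  · simp at h1; tauto
  · simp at h1; tauto
  · rfl

lemma dg_pos {V : Type*} (E : Finset (Sym2 V)) (v : V) : 0 < dg E v ↔ ∃ u, s(v, u) ∈ E := by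
  classical
  unfold dg
  rw [Finset.card_pos]
  constructor
  · rintro ⟨e, he⟩
    rw [Finset.mem_filter] at he
    obtain ⟨u, rfl⟩ := he.2
    exact ⟨u, he.1⟩
  · rintro ⟨u, h⟩
    exact ⟨s(v, u), by simp [h]⟩

open Classical in
/-- target end numbers -/
noncomputable def tg {V : Type*} (E : Finset (Sym2 V)) (W : Set V) (v : V) : ℕ :=
  if v ∈ W then 0 else if Odd (dg E v) then 1 else 2

open Classical in
lemma lovasz {V : Type u} [Fintype V] (n : ℕ) : ∀ (E : Finset (Sym2 V)) (W : Set V), E.card = n →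
    (∀ e ∈ E, ¬ e.IsDiag) → (∀ v ∈ W, Even (dg E v)) →
    (∀ v ∈ W, ∀ w ∈ W, 0 < dg E v → 0 < dg E w → v = w) →
    ∃ (ι : Type u) (_ : Fintype ι) (F : ι → List V), Decomp F E ∧ ∀ v, ec F v = tg E W v := by
  induction n with
  | zero =>
    intro E W hn _ _ _
    have hE : E = ∅ := Finset.card_eq_zero.1 hn
    subst hE
    refine ⟨{v : V // v ∉ W}, inferInstance, fun v => [v.1], ⟨?_, ?_, ?_⟩, ?_⟩
    · simp
    · simp [el]
    · simp
    · intro v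
      unfold ec tg
      have : ∀ s : {v : V // v ∉ W} × Bool, en [s.1.1] s.2 = some v ↔ s.1.1 = v := by
        rintro ⟨s, _ | _⟩ <;> simp [en]
      simp only [this]
      by_cases hv : v ∈ W
      · simp only [hv, if_true, Finset.card_eq_zero, Finset.filter_eq_empty_iff]
        rintro ⟨⟨w, hw⟩, b⟩ - rfl
        exact hw hv
      · simp only [hv, if_false]
        have h2 : (Finset.univ.filter fun s : {v : V // v ∉ W} × Bool => s.1.1 = v) =
            {(⟨v, hv⟩, true), (⟨v, hv⟩, false)} := by
          ext ⟨⟨w, hw⟩, b⟩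
          cases b <;> simp
        rw [h2]
        simp [dg]
  | succ n ih =>
    intro E W hn hd hW1 hW2
    have main : ∀ x u, s(x, u) ∈ E → ∃ E', E = insert s(x, u) E' ∧ s(x, u) ∉ E' ∧ E'.card = n ∧
        x ≠ u := by
      intro x u h
      refine ⟨E.erase s(x, u), (Finset.insert_erase h).symm, by simp, ?_, ?_⟩
      · rw [Finset.card_erase_of_mem h, hn]; rfl
      · rintro rfl; exact hd _ h (by simp)
    have step : ∀ x u E' W', E = insert s(x, u) E' → s(x, u) ∉ E' → E'.card = n → x ≠ u →
        (∀ v ∈ W', Even (dg E' v)) → (∀ v ∈ W', ∀ w ∈ W', 0 < dg E' v → 0 < dg E' w → v = w) →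
        u ∉ W' → (∀ v ∈ W', s(x, v) ∉ E') →
        ∃ (ι : Type u) (_ : Fintype ι) (F : ι → List V), Decomp F E ∧ ec F u + 1 = tg E' W' u ∧
          ec F x = tg E' W' x + 1 ∧ ∀ v, v ≠ x → v ≠ u → ec F v = tg E' W' v := by
      intro x u E' W' hE hx hc hxu h1 h2 hu h3
      obtain ⟨ι, _, F, hF, he⟩ := ih E' W' hc (fun e he => hd e (by rw [hE]; simp [he])) h1 h2
      have pos : ∀ v, v ∉ W' → 1 ≤ ec F v := by
        intro v hv
        rw [he, tg, if_neg hv]; split_ifs <;> simp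
      obtain ⟨F', hF', e1, e2, e3⟩ := switch_one F E' hF x u hxu hx (pos u hu)
        (fun y hy => pos y fun hy' => h3 y hy' hy)
      refine ⟨ι, _, F', by rw [hE]; exact hF', by rw [e1, he], by rw [e2, he], ?_⟩
      intro v hv hv'
      rw [e3 v hv hv', he]
    have fin : ∀ x u E' (ι : Type u) (_ : Fintype ι) (F : ι → List V) W',
        E = insert s(x, u) E' → s(x, u) ∉ E' →
        (∀ v, v ≠ x → v ≠ u → (v ∈ W' ↔ v ∈ W)) →
        (∀ v, v ≠ x → v ≠ u → ec F v = tg E' W' v) → ec F x = tg E W x → ec F u = tg E W u →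
        ∀ v, ec F v = tg E W v := by
      intro x u E' ι _ F W' hE hx hW hF h1 h2 v
      by_cases hvx : v = x
      · rw [hvx, h1]
      by_cases hvu : v = u
      · rw [hvu, h2]
      rw [hF v hvx hvu, tg, tg, hE, dg_insert _ _ _ _ hx]
      simp [hvx, hvu, hW v hvx hvu]
    by_cases hcase : ∃ x ∈ W, 0 < dg E x
    · obtain ⟨x, hxW, hxd⟩ := hcase
      obtain ⟨u, hxu⟩ := (dg_pos _ _).1 hxd
      obtain ⟨E', hE, hE', hc, hne⟩ := main x u hxu
      have hud : 0 < dg E u := (dg_pos _ _).2 ⟨x, by rwa [Sym2.eq_swap]⟩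
      have huW : u ∉ W := fun h => hne (hW2 x hxW u h hxd hud)
      have hiso : ∀ v ∈ W, v ≠ x → dg E v = 0 := by
        intro v hv hvx
        by_contra h
        exact hvx (hW2 v hv x hxW (Nat.pos_of_ne_zero h) hxd)
      have dx : dg E x = dg E' x + 1 := by rw [hE, dg_insert _ _ _ _ hE']; simp
      have du : dg E u = dg E' u + 1 := by rw [hE, dg_insert _ _ _ _ hE']; simp
      have dv : ∀ v, v ≠ x → v ≠ u → dg E v = dg E' v := by
        intro v h1 h2; rw [hE, dg_insert _ _ _ _ hE']; simp [h1, h2]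
      have hiso' : ∀ v ∈ W, v ≠ x → dg E' v = 0 := by
        intro v hv hvx
        rw [← dv v hvx (by rintro rfl; exact huW hv)]
        exact hiso v hv hvx
      have xe := hW1 x hxW
      by_cases huo : Odd (dg E u)
      · obtain ⟨ι, _, F, hF, e1, e2, e3⟩ := step u x E' ((W \ {x}) ∪ {u})
          (by rw [hE, Sym2.eq_swap]) (by rwa [Sym2.eq_swap]) hc hne.symm
          (by
            rintro v (⟨hv, hv'⟩ | rfl)
            · rw [hiso' v hv hv']; simp
            · grind)
          (by
            rintro v (⟨hv, hv'⟩ | rfl) w (⟨hw, hw'⟩ | rfl) h1 h2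
            · rw [hiso' v hv hv'] at h1; omega
            · rw [hiso' v hv hv'] at h1; omega
            · rw [hiso' w hw hw'] at h2; omega
            · rfl)
          (by simp [hne])
          (by
            rintro v (⟨hv, hv'⟩ | rfl) h
            · have : 0 < dg E' v := (dg_pos _ _).2 ⟨u, by rwa [Sym2.eq_swap]⟩
              rw [hiso' v hv hv'] at this; omega
            · exact hd s(v, v) (by rw [hE]; simp [h]) (by simp))
        refine ⟨ι, _, F, hF, fin x u E' ι _ F _ hE hE' ?_ (fun v h1 h2 => e3 v h2 h1) ?_ ?_⟩
        · intro v h1 h2; simp [h1, h2]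
        · have : Odd (dg E' x) := by grind
          simp [tg, hne, this] at e1
          simp [tg, hxW, e1]
        · simp [tg] at e2
          simp [tg, huW, huo, e2]
      · obtain ⟨ι, _, F, hF, e1, e2, e3⟩ := step u x E' (W \ {x})
          (by rw [hE, Sym2.eq_swap]) (by rwa [Sym2.eq_swap]) hc hne.symm
          (by
            rintro v ⟨hv, hv'⟩
            rw [hiso' v hv hv']; simp)
          (by
            rintro v ⟨hv, hv'⟩ w _ h1 h2
            rw [hiso' v hv hv'] at h1; omega)
          (by simp)
          (by
            rintro v ⟨hv, hv'⟩ h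
            have : 0 < dg E' v := (dg_pos _ _).2 ⟨u, by rwa [Sym2.eq_swap]⟩
            rw [hiso' v hv hv'] at this; omega)
        refine ⟨ι, _, F, hF, fin x u E' ι _ F _ hE hE' ?_ (fun v h1 h2 => e3 v h2 h1) ?_ ?_⟩
        · intro v h1 h2; simp [h1]
        · have : Odd (dg E' x) := by grind
          simp [tg, this] at e1
          simp [tg, hxW, e1]
        · have : Odd (dg E' u) := by grind
          simp [tg, huW, this] at e2
          simp [tg, huW, huo, e2]
    · have hiso : ∀ v ∈ W, dg E v = 0 := by
        intro v hv
        by_contra h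
        exact hcase ⟨v, hv, Nat.pos_of_ne_zero h⟩
      have hadj : ∀ v ∈ W, ∀ y, s(v, y) ∉ E := by
        intro v hv y h
        have := (dg_pos E v).2 ⟨y, h⟩
        rw [hiso v hv] at this
        omega
      have cc : ∀ x u, s(x, u) ∈ E → (¬ Odd (dg E x) ∨ Odd (dg E u)) →
          ∃ (ι : Type u) (_ : Fintype ι) (F : ι → List V), Decomp F E ∧
            ∀ v, ec F v = tg E W v := by
        intro x u hxu hpar
        obtain ⟨E', hE, hE', hc, hne⟩ := main x u hxu
        have hxW : x ∉ W := fun h => hadj x h u hxu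
        have huW : u ∉ W := fun h => hadj u h x (by rwa [Sym2.eq_swap])
        have dx : dg E x = dg E' x + 1 := by rw [hE, dg_insert _ _ _ _ hE']; simp
        have du : dg E u = dg E' u + 1 := by rw [hE, dg_insert _ _ _ _ hE']; simp
        have dv : ∀ v, v ≠ x → v ≠ u → dg E v = dg E' v := by
          intro v h1 h2; rw [hE, dg_insert _ _ _ _ hE']; simp [h1, h2]
        have hiso' : ∀ v ∈ W, dg E' v = 0 := by
          intro v hv
          rw [← dv v (by rintro rfl; exact hxW hv) (by rintro rfl; exact huW hv)]
          exact hiso v hv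
        have hEE : ∀ e ∈ E', e ∈ E := by intro e he; rw [hE]; simp [he]
        by_cases hxo : Odd (dg E x)
        · have huo : Odd (dg E u) := by tauto
          obtain ⟨ι, _, F, hF, e1, e2, e3⟩ := step x u E' (W ∪ {x}) hE hE' hc hne
            (by
              rintro v (hv | rfl)
              · rw [hiso' v hv]; simp
              · grind)
            (by
              rintro v (hv | rfl) w (hw | rfl) h1 h2
              · rw [hiso' v hv] at h1; omega
              · rw [hiso' v hv] at h1; omega
              · rw [hiso' w hw] at h2; omega
              · rfl)
            (by simp [huW, hne.symm])
            (by
              rintro v (hv | rfl) h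
              · exact hadj v hv x (hEE _ (by rwa [Sym2.eq_swap]))
              · exact hd s(v, v) (hEE _ h) (by simp))
          refine ⟨ι, _, F, hF, fin x u E' ι _ F _ hE hE' ?_ e3 ?_ ?_⟩
          · intro v h1 h2; simp [h1]
          · simp [tg] at e2
            simp [tg, hxW, hxo, e2]
          · have : ¬ Odd (dg E' u) := by grind
            simp only [tg, Set.mem_union, huW, Set.mem_singleton_iff, hne.symm, this] at e1
            simp at e1
            simp [tg, huW, huo, e1]
        · obtain ⟨ι, _, F, hF, e1, e2, e3⟩ := step x u E' W hE hE' hc hne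
            (by
              intro v hv
              rw [hiso' v hv]; simp)
            (by
              intro v hv w hw h1 h2
              rw [hiso' v hv] at h1; omega)
            huW
            (by
              intro v hv h
              exact hadj v hv x (hEE _ (by rwa [Sym2.eq_swap])))
          have hxo' : Odd (dg E' x) := by grind
          by_cases huo : Odd (dg E u)
          · have huo' : ¬ Odd (dg E' u) := by grind
            refine ⟨ι, _, F, hF, fin x u E' ι _ F W hE hE' (fun _ _ _ => Iff.rfl) e3 ?_ ?_⟩
            · simp only [tg, hxW, hxo', if_true, if_false] at e2
              simp only [tg, hxW, hxo, if_false, e2]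
            · simp only [tg, huW, huo', if_false] at e1
              simp only [tg, huW, huo, if_false, if_true]; omega
          · have huo' : Odd (dg E' u) := by grind
            have key : ∀ v, ec (fun o : Option ι => o.elim [u] F) v =
                ec F v + if v = u then 2 else 0 := by
              intro v
              unfold ec
              simp only [Finset.card_filter]
              rw [Fintype.sum_prod_type, Fintype.sum_prod_type, Fintype.sum_option]
              simp only [Fintype.sum_bool]
              by_cases h : u = v
              · subst h; simp [en, add_comm]
              · have h' : v ≠ u := fun h' => h h'.symm
                simp [en, h, h']
            refine ⟨Option ι, inferInstance, fun o => o.elim [u] F, ⟨?_, ?_, ?_⟩,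
              fin x u E' _ _ _ W hE hE' (fun _ _ _ => Iff.rfl) ?_ ?_ ?_⟩
            · rintro (_ | i)
              · simp
              · exact hF.1 i
            · intro e
              rw [hF.2.1 e]
              constructor
              · rintro ⟨i, hi⟩
                exact ⟨some i, hi⟩
              · rintro ⟨_ | i, hi⟩
                · simp [el] at hi
                · exact ⟨i, hi⟩
            · rw [Fintype.sum_option, ← hF.2.2]; simp
            · intro v h1 h2
              rw [key, e3 v h1 h2]; simp [h2]
            · rw [key, e2]
              simp only [tg, hxW, hxo', if_true, if_false, hxo, hne]
            · rw [key]
              simp only [tg, huW, huo', if_false, if_true] at e1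
              simp only [tg, huW, huo, if_false, if_true]; omega
      have hpos : 0 < E.card := by omega
      obtain ⟨e, he⟩ := Finset.card_pos.1 hpos
      induction e using Sym2.ind with
      | _ x u =>
        by_cases h : ¬ Odd (dg E x) ∨ Odd (dg E u)
        · exact cc x u he h
        · exact cc u x (by rwa [Sym2.eq_swap]) (by tauto)


/-- the edge set of a cycle, or a single edge -/
def IsPiece {V : Type*} (G : SimpleGraph V) (S : Set (Sym2 V)) : Prop :=
  (∃ (u : V) (w : G.Walk u u), w.IsCycle ∧ S = {e | e ∈ w.edges}) ∨ (∃ e ∈ G.edgeSet, S = {e})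

lemma exists_walk_of_list {V : Type*} (G : SimpleGraph V) (t : List V) :
    ∀ a x, (∀ e ∈ el (a :: (t ++ [x])), e ∈ G.edgeSet) →
    ∃ w : G.Walk a x, w.support = a :: (t ++ [x]) ∧ w.edges = el (a :: (t ++ [x])) := by
  induction t with
  | nil =>
    intro a x h
    have : G.Adj a x := h s(a, x) (by simp [el])
    exact ⟨.cons this .nil, by simp, by simp [el]⟩
  | cons b t ih =>
    intro a x h
    have : G.Adj a b := h s(a, b) (by simp [el])
    obtain ⟨w, h1, h2⟩ := ih b x (fun e he => h e (by simp [el]; exact Or.inr he))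
    exact ⟨.cons this w, by simp [h1], by simp [h2, el]⟩

lemma closing {V : Type*} (G : SimpleGraph V) (l : List V) (hl : l.Nodup) (hne : l ≠ []) (x : V)
    (hx : x ∉ l) (h : ∀ e ∈ el (x :: (l ++ [x])), e ∈ G.edgeSet) :
    IsPiece G {e | e ∈ el (x :: (l ++ [x]))} := by
  obtain ⟨a, t, rfl⟩ := List.exists_cons_of_ne_nil hne
  have hxa : G.Adj x a := h s(x, a) (by simp [el])
  rcases t with _ | ⟨b, t⟩
  · right
    refine ⟨s(x, a), hxa, ?_⟩
    ext e
    simp [el, Sym2.eq_swap (a := a)]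
  · left
    obtain ⟨w, h1, h2⟩ := exists_walk_of_list G (b :: t) a x
      (fun e he => h e (by
        rw [List.cons_append, el]
        exact List.mem_cons_of_mem _ he))
    refine ⟨x, .cons hxa w, ?_, ?_⟩
    · rw [SimpleGraph.Walk.cons_isCycle_iff]
      constructor
      · rw [SimpleGraph.Walk.isPath_def, h1]
        rw [← List.cons_append, List.nodup_append]
        refine ⟨hl, by simp, ?_⟩
        intro c hc d hd
        simp at hd
        subst hd
        rintro rfl; exact hx hc
      · rw [h2]
        simp only [List.cons_append, el, List.mem_cons]
        rintro (h | h)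
        · simp at h
          simp at hx hl
          grind
        · have := mem_of_mem_el h (v := a) (by simp)
          simp at this hl hx
          grind
    · ext e
      simp only [Set.mem_setOf_eq, SimpleGraph.Walk.edges_cons, h2, List.cons_append, el]

lemma el_const {V α : Type*} (f : V → α) (l : List V) (h : ∀ a b, s(a, b) ∈ el l → f a = f b) :
    ∀ a ∈ l, ∀ b ∈ l, f a = f b := by
  induction l with
  | nil => simp
  | cons a t ih =>
    rcases t with _ | ⟨b, t⟩
    · simp
    · have h1 := ih (fun c d hcd => h c d (by simp [el, hcd]))
      have h2 : f a = f b := h a b (by simp [el])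
      have h3 : ∀ c ∈ b :: t, f a = f c := fun c hc => h2.trans (h1 b (by simp) c hc)
      intro c hc d hd
      rw [List.mem_cons] at hc hd
      rcases hc with rfl | hc <;> rcases hd with rfl | hd
      · rfl
      · exact h3 d hd
      · exact (h3 c hc).symm
      · exact h1 c hc d hd

lemma en_mem {V : Type*} {l : List V} {b : Bool} {v : V} (h : en l b = some v) : v ∈ l := by
  cases b
  · exact List.mem_of_mem_head? (by simpa [en] using h)
  · exact List.mem_of_mem_getLast? (by simpa [en] using h)

/-- a rooted spanning forest with a rank function -/
structure Forest {V : Type*} (G : SimpleGraph V) (ρ : V → ℕ) (Rt : Set V) (rt π : V → V) :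
    Prop where
  inj : Function.Injective ρ
  adj : ∀ v, v ∉ Rt → G.Adj v (π v)
  lt : ∀ v, v ∉ Rt → ρ (π v) < ρ v
  min : ∀ v, v ∉ Rt → ∀ w, G.Adj v w → ρ (π v) ≤ ρ w
  root : ∀ r ∈ Rt, ∀ v, v ∉ Rt → ρ r < ρ v
  rt_adj : ∀ a b, G.Adj a b → rt a = rt b
  rt_root : ∀ r ∈ Rt, rt r = r

/-- hypotheses on the non-forest edges -/
def Good {V : Type*} (G : SimpleGraph V) (Rt : Set V) (π : V → V) (Z : Set V)
    (E : Finset (Sym2 V)) : Prop :=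
  ∀ a b, s(a, b) ∈ E → G.Adj a b ∧ a ∉ Rt ∧ a ∉ Z ∧ π a ≠ b

lemma process {V : Type u} (G : SimpleGraph V) (ρ : V → ℕ) (Rt : Set V) (rt π : V → V)
    (hf : Forest G ρ Rt rt π) (Z : Set V) (E : Finset (Sym2 V)) (hE : Good G Rt π Z E) (m : ℕ) :
    ∀ (ι : Type u) (F : ι → List V), (∀ i, (F i).Nodup ∧ F i ≠ []) →
      (∀ i a b, s(a, b) ∈ el (F i) → s(a, b) ∈ E ∨ (a ∉ Rt ∧ π a = b ∧ m ≤ ρ b) ∨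
        (b ∉ Rt ∧ π b = a ∧ m ≤ ρ a)) →
      (∀ i b v, en (F i) b = some v → v ∉ Rt ∧ ρ (π v) < m) →
      (∀ v, v ∉ Rt → v ∉ Z → ρ (π v) < m → ∃ i b, en (F i) b = some v) →
      ∃ S : ι → Set (Sym2 V), (∀ i, IsPiece G (S i)) ∧
        (∀ i, ∀ e ∈ el (F i), ∃ j, e ∈ S j) ∧
        (∀ v, v ∉ Rt → v ∉ Z → ρ (π v) < m → ∃ i, s(v, π v) ∈ S i) := by
  classical
  induction m with
  | zero =>
    intro ι F h1 h2 h3 h4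
    have hempty : IsEmpty ι := ⟨fun i => by
      obtain ⟨v, hv⟩ := en_isSome (h1 i).2 true
      have := (h3 i true v hv).2
      omega⟩
    exact ⟨fun i => hempty.elim i, fun i => hempty.elim i, fun i => hempty.elim i, by simp⟩
  | succ m ih =>
    intro ι F h1 h5 h4 h3
    by_cases hp : ∃ p, ρ p = m
    swap
    · have hm : ∀ v, ρ v < m + 1 → ρ v < m := by
        intro v hv
        have : ρ v ≠ m := fun h => hp ⟨v, h⟩
        omega
      obtain ⟨S, s1, s2, s3⟩ := ih ι F h1
        (by
          intro i a b h
          rcases h5 i a b h with h | h | h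
          · exact Or.inl h
          · exact Or.inr (Or.inl ⟨h.1, h.2.1, by omega⟩)
          · exact Or.inr (Or.inr ⟨h.1, h.2.1, by omega⟩))
        (fun i b v h => ⟨(h4 i b v h).1, hm _ (h4 i b v h).2⟩)
        (fun v hv hv' h => h3 v hv hv' (by omega))
      exact ⟨S, s1, s2, fun v hv hv' h => s3 v hv hv' (hm _ h)⟩
    obtain ⟨p, hp⟩ := hp
    have hpeq : ∀ v, ρ v = m → v = p := fun v hv => hf.inj (hv.trans hp.symm)
    by_cases hemp : IsEmpty ι
    · refine ⟨fun i => hemp.elim i, fun i => hemp.elim i, fun i => hemp.elim i, ?_⟩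
      intro v hv hv' h
      obtain ⟨i, -⟩ := h3 v hv hv' h
      exact hemp.elim i
    rw [not_isEmpty_iff] at hemp
    obtain ⟨i0⟩ := hemp
    let d : V → ι × Bool := fun y =>
      if h : ∃ s : ι × Bool, en (F s.1) s.2 = some y then h.choose else (i0, true)
    have hpE : ∀ i y, s(p, y) ∈ el (F i) → s(p, y) ∈ E := by
      intro i y h
      rcases h5 i p y h with h | ⟨h, h', h''⟩ | ⟨h, h', h''⟩
      · exact h
      · have := hf.lt p h
        rw [h'] at this; omega
      · omega
    have hpE' : ∀ i y, s(p, y) ∈ el (F i) → G.Adj p y ∧ p ∉ Rt ∧ y ∉ Rt ∧ y ∉ Z ∧ ρ (π y) < m := by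
      intro i y h
      have h6 := hpE i y h
      obtain ⟨a1, a2, a3, a4⟩ := hE p y h6
      obtain ⟨b1, b2, b3, b4⟩ := hE y p (by rwa [Sym2.eq_swap])
      refine ⟨a1, a2, b2, b3, ?_⟩
      have := hf.min y b2 p b1
      have : ρ (π y) ≠ m := fun h => b4 (hpeq _ h)
      omega
    have hd : ∀ i y, s(p, y) ∈ el (F i) → en (F (d y).1) (d y).2 = some y := by
      intro i y h
      obtain ⟨-, -, b2, b3, b4⟩ := hpE' i y h
      obtain ⟨j, b, hj⟩ := h3 y b2 b3 (by omega)
      have h : ∃ s : ι × Bool, en (F s.1) s.2 = some y := ⟨(j, b), hj⟩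
      simp only [d, h, dif_pos]
      exact h.choose_spec
    obtain ⟨R, F', r1, r2, r3, r4, f1, f2, f3, f4, f5, f6, f7, f8, f9, -⟩ :=
      switch_main F h1 p d (fun i b => ∃ c, en (F i) b = some c ∧ π c = p)
      (by
        rintro i b ⟨c, hc, hc'⟩
        refine ⟨c, ?_, hc⟩
        rintro rfl
        have := hf.adj c (h4 i b c hc).1
        rw [hc'] at this
        exact G.irrefl this) hd
    have hadj : ∀ i a b, s(a, b) ∈ el (F i) → G.Adj a b := by
      intro i a b h
      rcases h5 i a b h with h | ⟨h, h', h''⟩ | ⟨h, h', h''⟩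
      · exact (hE a b h).1
      · have := hf.adj a h; rwa [h'] at this
      · have := hf.adj b h; rw [h'] at this; exact this.symm
    have hadj' : ∀ i a b, s(a, b) ∈ el (F' i) → G.Adj a b := by
      intro i a b h
      rcases f7 i _ h with ⟨j, h⟩ | ⟨b', y, ⟨c, hc, hc'⟩, h', h''⟩
      · exact hadj j a b h
      · rw [hc] at h'; cases h'
        have h6 := hf.adj y (h4 i b' y hc).1
        rw [hc'] at h6
        have : s(a, b) ∈ G.edgeSet := by rw [h'']; exact h6.symm
        exact this
    have hfirst : ∀ {i b y}, IsFirst p (F i) b y → s(p, y) ∈ el (F i) :=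
      fun h => (mem_el_iff_first _ _ _).2 ⟨_, h⟩
    let cl : ι → Prop := fun i => p ∉ F i ∧ R i true ∧ R i false
    have hroot : p ∈ Rt → ∀ i b, R i b → p ∉ F i → cl i := by
      intro hpR i b hb hpF
      refine ⟨hpF, ?_⟩
      suffices H : ∀ b', R i b' from ⟨H _, H _⟩
      have hS : ∃ c, en (F i) b = some c ∧ π c = p := by
        rcases r2 i b hb with h | ⟨y, j, c, g1, g2, g3, g4⟩
        · exact h
        · exact ((hpE' j y (hfirst g2)).2.1 hpR).elim
      obtain ⟨c, hc, hc'⟩ := hS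
      have hcR := (h4 i b c hc).1
      have e1 : rt c = p := by
        rw [hf.rt_adj c p (by have := hf.adj c hcR; rwa [hc'] at this), hf.rt_root p hpR]
      intro b'
      obtain ⟨v, hv⟩ := en_isSome (h1 i).2 b'
      obtain ⟨hvR, hvlt⟩ := h4 i b' v hv
      have e2 : rt v = rt c := el_const rt (F i) (fun a b h => hf.rt_adj a b (hadj i a b h))
        v (en_mem hv) c (en_mem hc)
      have e3 : π v ∈ Rt := by
        by_contra h
        have := hf.root p hpR _ h
        omega
      have e4 : π v = p := by
        rw [← hf.rt_root _ e3, ← hf.rt_adj v (π v) (hf.adj v hvR), e2, e1]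
      exact r1 _ _ ⟨v, hv, e4⟩
    obtain ⟨S, s1, s2, s3⟩ := ih {i // ¬ cl i} (fun i => F' i.1)
      (by
        rintro ⟨i, hi⟩
        refine ⟨f2 i ?_, f1 i⟩
        by_contra! hcon
        exact hi hcon)
      (by
        rintro ⟨i, hi⟩ a b h
        rcases f7 i _ h with ⟨j, h⟩ | ⟨b', y, ⟨c, hc, hc'⟩, h', h''⟩
        · rcases h5 j a b h with h | h | h
          · exact Or.inl h
          · exact Or.inr (Or.inl ⟨h.1, h.2.1, by omega⟩)
          · exact Or.inr (Or.inr ⟨h.1, h.2.1, by omega⟩)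
        · rw [hc] at h'; cases h'
          have hcR := (h4 i b' y hc).1
          rw [Sym2.eq_iff] at h''
          rcases h'' with ⟨rfl, rfl⟩ | ⟨rfl, rfl⟩
          · exact Or.inr (Or.inr ⟨hcR, hc', hp.ge⟩)
          · exact Or.inr (Or.inl ⟨hcR, hc', hp.ge⟩))
      (by
        rintro ⟨i, hi⟩ b v h
        simp only at h
        by_cases hR : R i b
        · by_cases hpF : p ∈ F i
          · obtain ⟨y, hy, hy'⟩ := f4 i b hR hpF
            rw [hy'] at h; cases h
            obtain ⟨-, -, b2, b3, b4⟩ := hpE' i v (hfirst hy)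
            exact ⟨b2, b4⟩
          · rw [f5 i b hR hpF] at h; cases h
            have hpR : p ∉ Rt := fun hpR => hi (hroot hpR i b hR hpF)
            exact ⟨hpR, by rw [← hp]; exact hf.lt p hpR⟩
        · rw [f3 i b hR] at h
          obtain ⟨g1, g2⟩ := h4 i b v h
          refine ⟨g1, ?_⟩
          have : ρ (π v) ≠ m := fun h' => hR (r1 _ _ ⟨v, h, hpeq _ h'⟩)
          omega)
      (by
        intro v hvR hvZ hv
        obtain ⟨i, b, hi⟩ := h3 v hvR hvZ (by omega)
        by_cases hR : R i b
        · rcases r2 i b hR with ⟨c, hc, hc'⟩ | ⟨y, j, c, g1, g2, g3, g4⟩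
          · rw [hi] at hc; cases hc
            rw [hc', hp] at hv; omega
          · rw [hi] at g4; cases g4
            have hpF : p ∈ F j := mem_of_mem_el (hfirst g2) (by simp)
            obtain ⟨y, hy, hy'⟩ := f4 j c g1 hpF
            rw [first_unique (h1 j).1 hy g2] at hy'
            exact ⟨⟨j, fun h => h.1 hpF⟩, c, hy'⟩
        · refine ⟨⟨i, ?_⟩, b, by rw [← hi]; exact f3 i b hR⟩
          intro h
          cases b
          · exact hR h.2.2
          · exact hR h.2.1)
    let T : ι → Set (Sym2 V) := fun i => if h : cl i then {e | e ∈ el (F' i)} else S ⟨i, h⟩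
    have hT : ∀ i, ∀ e ∈ el (F' i), ∃ j, e ∈ T j := by
      intro i e he
      by_cases h : cl i
      · exact ⟨i, by simp only [T, h, dif_pos]; exact he⟩
      · obtain ⟨⟨j, hj⟩, hj'⟩ := s2 ⟨i, h⟩ e he
        exact ⟨j, by simp only [T, hj]; exact hj'⟩
    refine ⟨T, ?_, ?_, ?_⟩
    · intro i
      by_cases h : cl i
      · simp only [T, h, dif_pos]
        have := closing G (F i) (h1 i).1 (h1 i).2 p h.1
          (by
            rw [← f9 i h.1 h.2.1 h.2.2]
            intro e he
            induction e using Sym2.ind with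
            | _ a b => exact hadj' i a b he)
        rw [f9 i h.1 h.2.1 h.2.2]
        exact this
      · simp only [T, h]
        exact s1 ⟨i, h⟩
    · intro i e he
      obtain ⟨j, hj⟩ := f6 i e he
      exact hT j e hj
    · intro v hvR hvZ hv
      by_cases h : ρ (π v) = m
      · obtain ⟨i, b, hi⟩ := h3 v hvR hvZ hv
        have := f8 i b v (r1 i b ⟨v, hi, hpeq _ h⟩) hi
        rw [hpeq _ h, Sym2.eq_swap]
        exact hT i _ this
      · obtain ⟨⟨j, hj⟩, hj'⟩ := s3 v hvR hvZ (by omega)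
        exact ⟨j, by simp only [T, hj]; exact hj'⟩


/-- at most `k` pieces cover the edges in `X` -/
def Cov {V : Type u} (G : SimpleGraph V) (k : ℕ) (X : Set (Sym2 V)) : Prop :=
  ∃ (ι : Type u) (_ : Fintype ι) (S : ι → Set (Sym2 V)), Fintype.card ι ≤ k ∧
    (∀ i, IsPiece G (S i)) ∧ ∀ e ∈ X, ∃ i, e ∈ S i

lemma Cov.mono {V : Type u} {G : SimpleGraph V} {k k' : ℕ} {X Y : Set (Sym2 V)} (h : Cov G k X)
    (hk : k ≤ k') (hY : ∀ e ∈ Y, e ∈ X) : Cov G k' Y := by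
  obtain ⟨ι, _, S, h1, h2, h3⟩ := h
  exact ⟨ι, _, S, h1.trans hk, h2, fun e he => h3 e (hY e he)⟩

lemma Cov.add {V : Type u} {G : SimpleGraph V} {k : ℕ} {X P : Set (Sym2 V)} (h : Cov G k X)
    (hP : IsPiece G P) : Cov G (k + 1) (X ∪ P) := by
  obtain ⟨ι, _, S, h1, h2, h3⟩ := h
  refine ⟨Option ι, inferInstance, fun o => o.elim P S, by simpa using h1, ?_, ?_⟩
  · rintro (_ | i)
    · exact hP
    · exact h2 i
  · rintro e (he | he)
    · obtain ⟨i, hi⟩ := h3 e he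
      exact ⟨some i, hi⟩
    · exact ⟨none, he⟩

lemma ml {V : Type u} [Fintype V] (G : SimpleGraph V) (ρ : V → ℕ) (Rt : Set V) (rt π : V → V)
    (hf : Forest G ρ Rt rt π) (Z : Set V) (E : Finset (Sym2 V)) (hE : Good G Rt π Z E)
    (W' O : Finset V) (hW' : ∀ v ∈ W', v ∈ Rt ∨ v ∈ Z) (hO : ∀ v ∈ O, Odd (dg E v)) (k : ℕ)
    (hk : 2 * Fintype.card V < 2 * W'.card + O.card + 2 * k + 2) :
    Cov G k ({e | e ∈ E} ∪ {e | ∃ v, v ∉ Rt ∧ v ∉ Z ∧ e = s(v, π v)}) := by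
  classical
  have hiso : ∀ v ∈ Rt ∪ Z, dg E v = 0 := by
    intro v hv
    by_contra h
    obtain ⟨u, hu⟩ := (dg_pos E v).1 (Nat.pos_of_ne_zero h)
    obtain ⟨-, h1, h2, -⟩ := hE v u hu
    exact hv.elim h1 h2
  obtain ⟨ι, instι, F, hF, hec⟩ := lovasz E.card E (Rt ∪ Z) rfl
    (by
      intro e he
      induction e using Sym2.ind with
      | _ a b =>
        intro h
        simp at h
        subst h
        exact G.irrefl (hE a a he).1)
    (by intro v hv; rw [hiso v hv]; simp)
    (by intro v hv w hw h1 h2; rw [hiso v hv] at h1; omega)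
  have hm : ∀ v, ρ v < Finset.univ.sup ρ + 1 := fun v =>
    Nat.lt_succ_of_le (Finset.le_sup (f := ρ) (Finset.mem_univ v))
  obtain ⟨S, s1, s2, s3⟩ := process G ρ Rt rt π hf Z E hE (Finset.univ.sup ρ + 1) ι F hF.1
    (fun i a b h => Or.inl ((hF.2.1 _).2 ⟨i, h⟩))
    (by
      intro i b v h
      refine ⟨fun hv => ?_, hm _⟩
      have : 1 ≤ ec F v := one_le_ec.2 ⟨i, b, h⟩
      rw [hec, tg, if_pos (Set.mem_union_left _ hv)] at this
      omega)
    (by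
      intro v hv hv' _
      apply one_le_ec.1
      rw [hec, tg, if_neg (by rintro (h | h) <;> tauto)]
      split_ifs <;> simp)
  refine ⟨ι, instι, S, ?_, s1, ?_⟩
  · have h1 := sum_ec F fun i => (hF.1 i).2
    simp only [hec, Fintype.card_prod, Fintype.card_bool] at h1
    have h2 : ∑ v, (tg E (Rt ∪ Z) v + (if v ∈ W' then 2 else 0) + (if v ∈ O then 1 else 0)) ≤
        ∑ _v : V, 2 := by
      refine Finset.sum_le_sum fun v _ => ?_
      unfold tg
      by_cases hv : v ∈ Rt ∪ Z
      · have : v ∉ O := fun h => by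
          have := hO v h
          rw [hiso v hv] at this
          simp at this
        simp only [hv, this, if_true, if_false]
        split_ifs <;> simp
      · have h3 : v ∉ W' := fun h => hv (hW' v h)
        simp only [hv, h3, if_false]
        by_cases h4 : v ∈ O
        · simp [h4, hO v h4]
        · simp only [h4, if_false]
          split_ifs <;> simp
    rw [Finset.sum_add_distrib, Finset.sum_add_distrib, h1] at h2
    simp at h2
    omega
  · rintro e (he | ⟨v, hv, hv', rfl⟩)
    · obtain ⟨i, hi⟩ := (hF.2.1 e).1 he
      exact s2 i e hi
    · exact s3 v hv hv' (hm _)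

lemma exists_forest {V : Type u} [Fintype V] (G : SimpleGraph V) (rt : V → V)
    (h1 : ∀ v, rt (rt v) = rt v) (h2 : ∀ v, G.Reachable (rt v) v)
    (h3 : ∀ a b, G.Adj a b → rt a = rt b) (tie : V → ℕ) (ht : Function.Injective tie) :
    ∃ (ρ : V → ℕ) (π : V → V), Forest G ρ {v | rt v = v} rt π ∧
      ∀ a b, tie a < tie b → G.dist (rt a) a ≤ G.dist (rt b) b → ρ a < ρ b := by
  classical
  let N := Finset.univ.sup tie + 1
  have hN : ∀ v, tie v < N := fun v =>
    Nat.lt_succ_of_le (Finset.le_sup (f := tie) (Finset.mem_univ v))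
  let ρ : V → ℕ := fun v => G.dist (rt v) v * N + tie v
  have lex : ∀ a b, G.dist (rt a) a < G.dist (rt b) b → ρ a < ρ b := by
    intro a b h
    have := hN a
    have h' : (G.dist (rt a) a + 1) * N ≤ G.dist (rt b) b * N := Nat.mul_le_mul_right _ h
    simp only [ρ]
    rw [add_mul] at h'
    omega
  have aux : ∀ v r (p : G.Walk v r), v ≠ r → ∃ w, G.Adj v w ∧ ∃ q : G.Walk w r,
      q.length + 1 = p.length := by
    intro v r p hv
    cases p with
    | nil => exact (hv rfl).elim
    | cons h q => exact ⟨_, h, q, by simp⟩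
  have near : ∀ v, rt v ≠ v → ∃ w, G.Adj v w ∧ G.dist (rt w) w < G.dist (rt v) v := by
    intro v hv
    obtain ⟨p, hp⟩ := (h2 v).symm.exists_walk_length_eq_dist
    obtain ⟨w, h, q, hq⟩ := aux v (rt v) p (Ne.symm hv)
    refine ⟨w, h, ?_⟩
    rw [← h3 v w h, SimpleGraph.dist_comm, SimpleGraph.dist_comm (u := rt v) (v := v), ← hp]
    have := SimpleGraph.dist_le q
    omega
  have ex : ∀ v, ∃ w, rt v ≠ v → G.Adj v w ∧ ∀ w', G.Adj v w' → ρ w ≤ ρ w' := by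
    intro v
    by_cases hv : rt v = v
    · exact ⟨v, fun h => (h hv).elim⟩
    · obtain ⟨w, hw, -⟩ := near v hv
      obtain ⟨w', hw', hmin⟩ := Finset.exists_min_image (Finset.univ.filter (G.Adj v)) ρ
        ⟨w, by simp [hw]⟩
      refine ⟨w', fun _ => ⟨by simpa using hw', fun z hz => hmin z (by simp [hz])⟩⟩
  choose π hπ using ex
  refine ⟨ρ, π, ⟨?_, fun v hv => (hπ v hv).1, ?_, fun v hv => (hπ v hv).2, ?_, h3, fun r hr => hr⟩,
    ?_⟩
  · intro a b h
    rcases lt_trichotomy (G.dist (rt a) a) (G.dist (rt b) b) with h' | h' | h'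
    · have := lex a b h'; omega
    · simp only [ρ, h'] at h
      exact ht (by omega)
    · have := lex b a h'; omega
  · intro v hv
    obtain ⟨w, hw, hd⟩ := near v hv
    exact lt_of_le_of_lt ((hπ v hv).2 w hw) (lex w v hd)
  · intro r hr v hv
    apply lex
    have hr' : rt r = r := hr
    rw [hr', SimpleGraph.dist_self]
    exact (h2 v).pos_dist_of_ne hv
  · intro a b h h'
    simp only [ρ]
    have := Nat.mul_le_mul_right N h'
    omega

open Classical in
/-- all non-forest edges -/
noncomputable def fullK {V : Type*} [Fintype V] (G : SimpleGraph V) (Rt : Set V) (π : V → V) :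
    Finset (Sym2 V) :=
  Finset.univ.filter fun e => ∃ a b, e = s(a, b) ∧ G.Adj a b ∧ a ∉ Rt ∧ b ∉ Rt ∧ π a ≠ b ∧ π b ≠ a

lemma mem_fullK {V : Type*} [Fintype V] (G : SimpleGraph V) (Rt : Set V) (π : V → V) (a b : V) :
    s(a, b) ∈ fullK G Rt π ↔ G.Adj a b ∧ a ∉ Rt ∧ b ∉ Rt ∧ π a ≠ b ∧ π b ≠ a := by
  classical
  simp only [fullK, Finset.mem_filter, Finset.mem_univ, true_and]
  constructor
  · rintro ⟨c, d, h, h'⟩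
    rw [Sym2.eq_iff] at h
    rcases h with ⟨rfl, rfl⟩ | ⟨rfl, rfl⟩
    · exact h'
    · obtain ⟨a1, a2, a3, a4, a5⟩ := h'
      exact ⟨a1.symm, a3, a2, a5, a4⟩
  · intro h
    exact ⟨a, b, rfl, h⟩

lemma Forest.parent_root {V : Type*} {G : SimpleGraph V} {ρ : V → ℕ} {Rt : Set V} {rt π : V → V}
    (hf : Forest G ρ Rt rt π) {a b : V} (hab : G.Adj a b) (ha : a ∈ Rt) : b ∉ Rt ∧ π b = a := by
  have hb : b ∉ Rt := by
    intro hb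
    have := hf.rt_adj a b hab
    rw [hf.rt_root a ha, hf.rt_root b hb] at this
    subst this
    exact G.irrefl hab
  refine ⟨hb, ?_⟩
  have h1 := hf.min b hb a hab.symm
  have h2 : π b ∈ Rt := by
    by_contra h
    have := hf.root a ha _ h
    omega
  rw [← hf.rt_root _ h2, ← hf.rt_adj b _ (hf.adj b hb), ← hf.rt_adj a b hab, hf.rt_root a ha]

lemma Forest.edge {V : Type*} [Fintype V] {G : SimpleGraph V} {ρ : V → ℕ} {Rt : Set V}
    {rt π : V → V} (hf : Forest G ρ Rt rt π) {e : Sym2 V} (he : e ∈ G.edgeSet) :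
    e ∈ fullK G Rt π ∨ ∃ v, v ∉ Rt ∧ e = s(v, π v) := by
  induction e using Sym2.ind with
  | _ a b =>
    have hab : G.Adj a b := he
    rw [mem_fullK]
    by_cases ha : a ∈ Rt
    · obtain ⟨h1, h2⟩ := hf.parent_root hab ha
      exact Or.inr ⟨b, h1, by rw [h2, Sym2.eq_swap]⟩
    by_cases hb : b ∈ Rt
    · obtain ⟨h1, h2⟩ := hf.parent_root hab.symm hb
      exact Or.inr ⟨a, h1, by rw [h2]⟩
    by_cases h1 : π a = b
    · exact Or.inr ⟨a, ha, by rw [h1]⟩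
    by_cases h2 : π b = a
    · exact Or.inr ⟨b, hb, by rw [h2, Sym2.eq_swap]⟩
    exact Or.inl ⟨hab, ha, hb, h1, h2⟩

lemma good_of_subset {V : Type*} [Fintype V] {G : SimpleGraph V} {Rt Z : Set V} {π : V → V}
    {E : Finset (Sym2 V)} (h : ∀ e ∈ E, e ∈ fullK G Rt π) (hZ : ∀ a b, s(a, b) ∈ E → a ∉ Z) :
    Good G Rt π Z E := by
  intro a b hab
  obtain ⟨h1, h2, h3, h4, h5⟩ := (mem_fullK G Rt π a b).1 (h _ hab)
  exact ⟨h1, h2, hZ a b hab, h4⟩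

/-- disconnected case -/
lemma cov_disconnected {V : Type u} [Fintype V] (G : SimpleGraph V) (h : ¬ G.Preconnected) :
    Cov G (Fintype.card V - 2) G.edgeSet := by
  classical
  let rt : V → V := fun v => (G.connectedComponentMk v).out
  have h2 : ∀ v, G.Reachable (rt v) v := fun v =>
    SimpleGraph.ConnectedComponent.exact (G.connectedComponentMk v).out_eq
  have h3 : ∀ a b, G.Reachable a b → rt a = rt b := by
    intro a b h
    simp only [rt]
    rw [SimpleGraph.ConnectedComponent.sound h]
  obtain ⟨ρ, π, hf, -⟩ := exists_forest G rt (fun v => h3 _ _ (h2 v)) h2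
    (fun a b h => h3 a b h.reachable) (fun v => (Fintype.equivFin V v : ℕ))
    (fun a b h => by simpa [Fin.ext_iff.symm] using h)
  unfold SimpleGraph.Preconnected at h
  push Not at h
  obtain ⟨a, b, hab⟩ := h
  have hne : rt a ≠ rt b := fun h => hab ((h2 a).symm.trans (h ▸ h2 b))
  have hcard : 2 ≤ Fintype.card V := by
    have : ({rt a, rt b} : Finset V).card ≤ _ := Finset.card_le_univ _
    rwa [Finset.card_pair hne] at this
  have := ml G ρ _ rt π hf ∅ (fullK G _ π) (good_of_subset (fun _ h => h) (by simp))
    {rt a, rt b} ∅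
    (by
      intro v hv
      simp at hv
      rcases hv with rfl | rfl
      · exact Or.inl (h3 _ _ (h2 a))
      · exact Or.inl (h3 _ _ (h2 b)))
    (by simp) (Fintype.card V - 2) (by rw [Finset.card_pair hne]; simp; omega)
  refine this.mono le_rfl fun e he => ?_
  rcases hf.edge he with h | ⟨v, hv, h⟩
  · exact Or.inl h
  · exact Or.inr ⟨v, hv, by simp, h⟩


lemma conn_forest {V : Type u} [Fintype V] (G : SimpleGraph V) (hc : G.Connected) (r : V)
    (tie : V → ℕ) (ht : Function.Injective tie) :
    ∃ (ρ : V → ℕ) (π : V → V), Forest G ρ {r} (fun _ => r) π ∧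
      ∀ a b, tie a < tie b → G.dist r a ≤ G.dist r b → ρ a < ρ b := by
  have := exists_forest G (fun _ => r) (fun _ => rfl) (fun v => hc.preconnected r v)
    (fun _ _ _ => rfl) tie ht
  have h : {v : V | r = v} = {r} := by ext v; simp [eq_comm]
  rw [h] at this
  exact this

lemma Forest.eq_parent {V : Type*} {G : SimpleGraph V} {ρ : V → ℕ} {Rt : Set V} {rt π : V → V}
    (hf : Forest G ρ Rt rt π) {b u : V} (hb : b ∉ Rt) (hbu : G.Adj b u)
    (h : ∀ w, G.Adj b w → ρ u ≤ ρ w) : π b = u :=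
  hf.inj (le_antisymm (hf.min b hb u hbu) (h _ (hf.adj b hb)))

lemma dg_erase {V : Type*} [DecidableEq V] (E : Finset (Sym2 V)) (a b v : V) (h : s(a, b) ∈ E) :
    dg E v = dg (E.erase s(a, b)) v + if v = a ∨ v = b then 1 else 0 := by
  classical
  conv_lhs => rw [← Finset.insert_erase h]
  convert dg_insert (E.erase s(a, b)) a b v (by simp) using 3
  congr!

lemma cov_odd {V : Type u} [Fintype V] (G : SimpleGraph V) {ρ : V → ℕ} {r : V} {rt π : V → V}
    (hf : Forest G ρ {r} rt π) (h2 : 2 ≤ Fintype.card V)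
    (v : V) (hv : Odd (dg (fullK G {r} π) v)) : Cov G (Fintype.card V - 2) G.edgeSet := by
  have := ml G ρ _ rt π hf ∅ (fullK G _ π) (good_of_subset (fun _ h => h) (by simp))
    {r} {v} (by simp) (by simpa using hv) (Fintype.card V - 2) (by simp; omega)
  refine this.mono le_rfl fun e he => ?_
  rcases hf.edge he with h | ⟨v, hv, h⟩
  · exact Or.inl h
  · exact Or.inr ⟨v, hv, by simp, h⟩

lemma cycle_fullK {V : Type u} [Fintype V] (G : SimpleGraph V) {ρ : V → ℕ} {r : V} {rt π : V → V}
    (hf : Forest G ρ {r} rt π) {x : V} (C : G.Walk x x) (hC : C.IsCycle) :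
    ∃ a b, s(a, b) ∈ C.edges ∧ s(a, b) ∈ fullK G {r} π := by
  classical
  obtain ⟨v, hv, hmax⟩ := Finset.exists_max_image C.support.toFinset ρ ⟨x, by simp⟩
  have hv : v ∈ C.support := by simpa using hv
  have hD := hC.rotate hv
  set D := C.rotate v hv with hDdef
  have hsub : ∀ e, e ∈ D.edges → e ∈ C.edges := fun e he =>
    (C.rotate_edges v hv).perm.mem_iff.1 he
  have hnn : ¬ D.Nil := hD.not_nil
  have e1 : s(v, D.snd) ∈ D.edges := D.mk_start_snd_mem_edges hnn
  have e2 : s(D.penultimate, v) ∈ D.edges := D.mk_penultimate_end_mem_edges hnn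
  have key : ∀ y, s(v, y) ∈ C.edges → s(v, y) ∈ fullK G {r} π ∨ π v = y := by
    intro y hy
    have hadj : G.Adj v y := C.adj_of_mem_edges hy
    have hle : ρ y ≤ ρ v := hmax y (by simpa using C.snd_mem_support_of_mem_edges hy)
    have hlt : ρ y < ρ v := lt_of_le_of_ne hle fun h => hadj.ne (hf.inj h).symm
    by_cases hvr : v ∈ ({r} : Set V)
    · have h3 := (hf.parent_root hadj hvr).1
      have := hf.root v hvr y h3
      omega
    by_cases hpv : π v = y
    · exact Or.inr hpv
    rw [mem_fullK]
    by_cases hyr : y ∈ ({r} : Set V)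
    · exact Or.inr (hf.parent_root hadj.symm hyr).2
    refine Or.inl ⟨hadj, hvr, hyr, hpv, fun h => ?_⟩
    have := hf.lt y hyr
    rw [h] at this
    omega
  rcases key _ (hsub _ e1) with h | h
  · exact ⟨_, _, hsub _ e1, h⟩
  rw [Sym2.eq_swap] at e2
  rcases key _ (hsub _ e2) with h' | h'
  · exact ⟨_, _, hsub _ e2, h'⟩
  exact (hD.snd_ne_penultimate (h.symm.trans h')).elim

lemma list_forest {V : Type u} [Fintype V] (G : SimpleGraph V) (hc : G.Connected) (r : V)
    (l : List V) (hl : l.Nodup) (hadj : ∀ v ∈ l, G.Adj r v) :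
    ∃ (ρ : V → ℕ) (π : V → V), Forest G ρ {r} (fun _ => r) π ∧
      l.Pairwise (fun a b => ρ a < ρ b) ∧ ∀ a ∈ l, ∀ b, b ∉ l → b ≠ r → ρ a < ρ b := by
  classical
  let tie : V → ℕ := fun v => l.idxOf v + if v ∈ l then 0 else (Fintype.equivFin V v : ℕ)
  have t1 : ∀ v ∈ l, tie v = l.idxOf v := fun v hv => by simp [tie, hv]
  have t2 : ∀ v, v ∉ l → tie v = l.length + (Fintype.equivFin V v : ℕ) := fun v hv => by
    simp [tie, hv, List.idxOf_eq_length]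
  have t3 : ∀ v ∈ l, l.idxOf v < l.length := fun v hv => List.idxOf_lt_length_iff.2 hv
  have ht : Function.Injective tie := by
    intro a b hab
    by_cases ha : a ∈ l <;> by_cases hb : b ∈ l
    · rw [t1 a ha, t1 b hb] at hab
      exact (List.idxOf_inj ha).1 hab
    · rw [t1 a ha, t2 b hb] at hab
      have := t3 a ha
      omega
    · rw [t2 a ha, t1 b hb] at hab
      have := t3 b hb
      omega
    · rw [t2 a ha, t2 b hb] at hab
      exact (Fintype.equivFin V).injective (Fin.ext (by omega))
  obtain ⟨ρ, π, hf, h⟩ := conn_forest G hc r tie ht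
  have d1 : ∀ v ∈ l, G.dist r v = 1 := fun v hv => SimpleGraph.dist_eq_one_iff_adj.2 (hadj v hv)
  refine ⟨ρ, π, hf, ?_, ?_⟩
  · rw [List.pairwise_iff_getElem]
    intro i j hi hj hij
    apply h
    · rw [t1 _ (List.getElem_mem _), t1 _ (List.getElem_mem _), hl.idxOf_getElem,
        hl.idxOf_getElem]
      exact hij
    · rw [d1 _ (List.getElem_mem _), d1 _ (List.getElem_mem _)]
  · intro a ha b hb hbr
    apply h
    · rw [t1 a ha, t2 b hb]
      have := t3 a ha
      omega
    · rw [d1 a ha]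
      exact hc.pos_dist_of_ne hbr.symm

lemma case_A {V : Type u} [Fintype V] (G : SimpleGraph V) (hc : G.Connected) (r u : V)
    (hru : G.Adj r u) (hno : ∀ w, G.Adj r w → ¬ G.Adj u w) (C : G.Walk r r) (hC : C.IsCycle)
    (hCu : s(r, u) ∈ C.edges) (h3 : 3 ≤ Fintype.card V) :
    Cov G (Fintype.card V - 2) G.edgeSet := by
  classical
  obtain ⟨ρ, π, hf, -, hρ⟩ := list_forest G hc r [u] (by simp) (by simpa using hru)
  have hρ : ∀ b, b ≠ u → b ≠ r → ρ u < ρ b := fun b h1 h2 => hρ u (by simp) b (by simpa using h1) h2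
  have hur : u ∉ ({r} : Set V) := (hf.parent_root hru rfl).1
  have hav : ∀ b, s(u, b) ∉ fullK G {r} π := by
    intro b hb
    obtain ⟨a1, a2, a3, a4, a5⟩ := (mem_fullK ..).1 hb
    refine a5 (hf.eq_parent a3 a1.symm fun w hw => ?_)
    by_cases hwu : w = u
    · rw [hwu]
    by_cases hwr : w = r
    · subst hwr
      exact (hno b hw.symm a1).elim
    exact (hρ w hwu hwr).le
  have hcard : ({r, u} : Finset V).card = 2 := Finset.card_pair hru.ne
  have main : ∀ E : Finset (Sym2 V), (∀ e ∈ E, e ∈ fullK G {r} π) → ∀ v, Odd (dg E v) →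
      Cov G (Fintype.card V - 3)
        ({e | e ∈ E} ∪ {e | ∃ v, v ∉ ({r} : Set V) ∧ v ∉ ({u} : Set V) ∧ e = s(v, π v)}) := by
    intro E hE v hv
    refine ml G ρ _ _ π hf {u} E (good_of_subset hE ?_) {r, u} {v} (by simp) (by simpa using hv)
      (Fintype.card V - 3) (by rw [hcard]; simp; omega)
    intro a b hab h
    rw [Set.mem_singleton_iff] at h
    subst h
    exact hav b (hE _ hab)
  have pu : π u = r := (hf.parent_root hru rfl).2
  have hn : Fintype.card V - 2 = Fintype.card V - 3 + 1 := by omega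
  rw [hn]
  by_cases hodd : ∃ v, Odd (dg (fullK G {r} π) v)
  · obtain ⟨v, hv⟩ := hodd
    refine ((main _ (fun _ h => h) v hv).add (P := {s(r, u)}) (Or.inr ⟨_, hru, rfl⟩)).mono le_rfl
      fun e he => ?_
    rcases hf.edge he with h | ⟨v, hv, h⟩
    · exact Or.inl (Or.inl h)
    · by_cases hvu : v = u
      · subst hvu
        right
        rw [h, pu, Sym2.eq_swap]
        rfl
      · exact Or.inl (Or.inr ⟨v, hv, hvu, h⟩)
  · push Not at hodd
    obtain ⟨a, b, hab, habK⟩ := cycle_fullK G hf C hC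
    have hdg := dg_erase _ a b a habK
    have hev := hodd a
    rw [hdg] at hev
    have ho : Odd (dg ((fullK G {r} π).erase s(a, b)) a) := by
      simp only [true_or, if_true] at hev
      rw [Nat.odd_add_one, not_not] at hev
      exact hev
    refine ((main _ (fun _ h => Finset.mem_of_mem_erase h) a ho).add (P := {e | e ∈ C.edges})
      (Or.inl ⟨_, C, hC, rfl⟩)).mono le_rfl fun e he => ?_
    rcases hf.edge he with h | ⟨v, hv, h⟩
    · by_cases hea : e = s(a, b)
      · right
        rw [hea]
        exact hab
      · exact Or.inl (Or.inl (Finset.mem_erase.2 ⟨hea, h⟩))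
    · by_cases hvu : v = u
      · subst hvu
        right
        rw [h, pu, Sym2.eq_swap]
        exact hCu
      · exact Or.inl (Or.inr ⟨v, hv, hvu, h⟩)

lemma case_B {V : Type u} [Fintype V] (G : SimpleGraph V) (hc : G.Connected) (r u w : V)
    (hru : G.Adj r u) (hrw : G.Adj r w) (huw : G.Adj u w)
    (hun : ∀ y, G.Adj r y → G.Adj u y → y = w) (h2 : 2 ≤ Fintype.card V) :
    Cov G (Fintype.card V - 2) G.edgeSet := by
  classical
  obtain ⟨ρ, π, hf, -, hρ⟩ := list_forest G hc r [u] (by simp) (by simpa using hru)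
  have hρ : ∀ b, b ≠ u → b ≠ r → ρ u < ρ b := fun b h1 h2 => hρ u (by simp) b (by simpa using h1) h2
  refine cov_odd G hf h2 u ?_
  have : (fullK G {r} π).filter (u ∈ ·) = {s(u, w)} := by
    ext e
    simp only [Finset.mem_filter, Finset.mem_singleton]
    constructor
    · rintro ⟨he, hu⟩
      obtain ⟨b, rfl⟩ := hu
      obtain ⟨a1, a2, a3, a4, a5⟩ := (mem_fullK ..).1 he
      by_cases hrb : G.Adj r b
      · rw [hun b hrb a1]
      refine (a5 (hf.eq_parent a3 a1.symm fun w hw => ?_)).elim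
      by_cases hwu : w = u
      · rw [hwu]
      by_cases hwr : w = r
      · subst hwr
        exact (hrb hw.symm).elim
      exact (hρ w hwu hwr).le
    · rintro rfl
      obtain ⟨b1, b2⟩ := hf.parent_root hru rfl
      obtain ⟨c1, c2⟩ := hf.parent_root hrw rfl
      exact ⟨(mem_fullK ..).2 ⟨huw, b1, c1, by rw [b2]; exact hrw.ne, by rw [c2]; exact hru.ne⟩,
        by simp⟩
  have : dg (fullK G {r} π) u = 1 := by
    unfold dg
    convert congrArg Finset.card this
    simp
  rw [this]
  exact odd_one

lemma case_D {V : Type u} [Fintype V] (G : SimpleGraph V) (hc : G.Connected) (r a b c d : V)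
    (hnd : [a, b, c, d].Nodup) (ha : G.Adj r a) (hb : G.Adj r b) (hc' : G.Adj r c)
    (hd : G.Adj r d) (hab : G.Adj a b) (hbc : G.Adj b c) (hcd : G.Adj c d)
    (h3 : 3 ≤ Fintype.card V) : Cov G (Fintype.card V - 2) G.edgeSet := by
  classical
  obtain ⟨ρ, π, hf, -, -⟩ := list_forest G hc r [] (by simp) (by simp)
  by_cases hodd : ∃ v, Odd (dg (fullK G {r} π) v)
  · obtain ⟨v, hv⟩ := hodd
    exact cov_odd G hf (by omega) v hv
  push Not at hodd
  have mk : ∀ x y, G.Adj r x → G.Adj r y → G.Adj x y → s(x, y) ∈ fullK G {r} π := by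
    intro x y hx hy hxy
    obtain ⟨b1, b2⟩ := hf.parent_root hx rfl
    obtain ⟨c1, c2⟩ := hf.parent_root hy rfl
    exact (mem_fullK ..).2 ⟨hxy, b1, c1, by rw [b2]; exact hy.ne, by rw [c2]; exact hx.ne⟩
  have m1 := mk a b ha hb hab
  have m2 := mk c d hc' hd hcd
  simp only [List.nodup_cons, List.mem_cons, List.not_mem_nil, or_false, not_or] at hnd
  obtain ⟨⟨n1, n2, n3⟩, ⟨n4, n5⟩, n6, -⟩ := hnd
  have m2' : s(c, d) ∈ (fullK G {r} π).erase s(a, b) := by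
    refine Finset.mem_erase.2 ⟨?_, m2⟩
    rw [Ne, Sym2.eq_iff]
    tauto
  set E := ((fullK G {r} π).erase s(a, b)).erase s(c, d) with hE
  have hdg : ∀ v, dg (fullK G {r} π) v = dg E v + (if v = c ∨ v = d then 1 else 0) +
      (if v = a ∨ v = b then 1 else 0) := fun v => by
    rw [dg_erase _ a b v m1, dg_erase _ c d v m2']
  have hO : ∀ v ∈ ({a, b, c, d} : Finset V), Odd (dg E v) := by
    intro v hv
    have h1 := hodd v
    have h2 : dg (fullK G {r} π) v = dg E v + 1 := by
      rw [hdg]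
      simp only [Finset.mem_insert, Finset.mem_singleton] at hv
      rcases hv with rfl | rfl | rfl | rfl <;> simp [*, eq_comm] <;> tauto
    rw [h2, Nat.odd_add_one, not_not] at h1
    exact h1
  have hcard : ({a, b, c, d} : Finset V).card = 4 := by
    simp [Finset.card_insert_of_notMem, *]
  have hsub : ∀ e ∈ E, e ∈ fullK G {r} π := fun e he =>
    Finset.mem_of_mem_erase (Finset.mem_of_mem_erase he)
  have := ml G ρ _ _ π hf ∅ E (good_of_subset hsub (by simp))
    {r} {a, b, c, d} (by simp) hO (Fintype.card V - 3) (by rw [hcard]; simp; omega)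
  have hcl := closing G [a, b, c, d] (by simp [*]) (by simp) r
    (by simp [ha.ne, hb.ne, hc'.ne, hd.ne])
    (by simp [el, ha, hb, hc', hd, hab, hbc, hcd, hd.symm])
  have hn : Fintype.card V - 2 = Fintype.card V - 3 + 1 := by omega
  rw [hn]
  refine (this.add hcl).mono le_rfl fun e he => ?_
  rcases hf.edge he with h | ⟨v, hv, h⟩
  · by_cases e1 : e = s(a, b)
    · exact Or.inr (by simp [el, e1])
    by_cases e2 : e = s(c, d)
    · exact Or.inr (by simp [el, e2])
    exact Or.inl (Or.inl (Finset.mem_erase.2 ⟨e2, Finset.mem_erase.2 ⟨e1, h⟩⟩))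
  · exact Or.inl (Or.inr ⟨v, hv, by simp, h⟩)

lemma case_E {V : Type u} [Fintype V] (G : SimpleGraph V) (hc : G.Connected) (r u w x : V)
    (hru : G.Adj r u) (hrw : G.Adj r w) (hrx : G.Adj r x) (huw : G.Adj u w) (hux : G.Adj u x)
    (hwx : G.Adj w x)
    (k1 : ∀ y, G.Adj r y → G.Adj u y → y = w ∨ y = x)
    (k2 : ∀ y, G.Adj r y → G.Adj w y → y = u ∨ y = x)
    (k3 : ∀ y, G.Adj r y → G.Adj x y → y = u ∨ y = w)
    (k4 : ∀ y, G.Adj u y → G.Adj w y → y = r ∨ y = x)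
    (k5 : ∀ y, G.Adj u y → G.Adj x y → y = r ∨ y = w)
    (k6 : ∀ y, G.Adj w y → G.Adj x y → y = r ∨ y = u) :
    Cov G (Fintype.card V - 2) G.edgeSet := by
  classical
  have hnd : [u, w, x].Nodup := by simp [huw.ne, hux.ne, hwx.ne]
  obtain ⟨ρ, π, hf, hpw, hρ⟩ := list_forest G hc r [u, w, x] hnd (by simp [hru, hrw, hrx])
  simp only [List.pairwise_cons, List.mem_cons, List.not_mem_nil, or_false] at hpw
  have r1 : ρ u < ρ w := hpw.1 w (by simp)
  have r2 : ρ w < ρ x := hpw.2.1 x rfl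
  have hρ : ∀ b, b ≠ u → b ≠ w → b ≠ x → b ≠ r → ρ x < ρ b := fun b h1 h2 h3 h4 =>
    hρ x (by simp) b (by simp [h1, h2, h3]) h4
  have pr : ∀ b, G.Adj r b → π b = r := fun b hb => (hf.parent_root hb rfl).2
  have out : ∀ a b, (a = u ∨ a = w ∨ a = x) → G.Adj a b → b ≠ u → b ≠ w → b ≠ x → b ≠ r →
      π b = a := by
    intro a b ha hab b1 b2 b3 b4
    refine hf.eq_parent b4 hab.symm fun y hy => ?_
    by_cases y4 : y = r
    · subst y4
      have := hy.symm
      rcases ha with rfl | rfl | rfl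
      · have := k1 b hy.symm hab; tauto
      · have := k2 b hy.symm hab; tauto
      · have := k3 b hy.symm hab; tauto
    have hyx : y ≠ u → y ≠ w → y ≠ x → ρ x < ρ y := fun h1 h2 h3 => hρ y h1 h2 h3 y4
    by_cases y1 : y = u
    · subst y1
      rcases ha with rfl | rfl | rfl
      · exact le_rfl
      · have := k4 b hy.symm hab; tauto
      · have := k5 b hy.symm hab; tauto
    by_cases y2 : y = w
    · subst y2
      rcases ha with rfl | rfl | rfl
      · exact r1.le
      · exact le_rfl
      · have := k6 b hy.symm hab; tauto
    have : ρ x ≤ ρ y := by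
      by_cases y3 : y = x
      · rw [y3]
      · exact (hyx y1 y2 y3).le
    rcases ha with rfl | rfl | rfl <;> omega
  set E := (fullK G {r} π).filter fun e => u ∉ e ∧ w ∉ e ∧ x ∉ e with hE
  have hcard : ({r, u, w, x} : Finset V).card = 4 := by
    simp [Finset.card_insert_of_notMem, hru.ne, hrw.ne, hrx.ne, huw.ne, hux.ne, hwx.ne]
  have h4 : 4 ≤ Fintype.card V := hcard ▸ Finset.card_le_univ _
  have := ml G ρ _ _ π hf {u, w, x} E (good_of_subset (fun e he => (Finset.mem_filter.1 he).1) (by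
      intro a b hab
      have := (Finset.mem_filter.1 hab).2
      simp only [Sym2.mem_iff, not_or] at this
      simp only [Set.mem_insert_iff, Set.mem_singleton_iff, not_or]
      obtain ⟨p, q, s⟩ := this
      exact ⟨Ne.symm p.1, Ne.symm q.1, Ne.symm s.1⟩))
    {r, u, w, x} ∅ (by simp) (by simp) (Fintype.card V - 4) (by rw [hcard]; simp; omega)
  have cl1 := closing G [u, w, x] hnd (by simp) r
    (by simp [hru.ne, hrw.ne, hrx.ne])
    (by simp [el, hru, huw, hwx, hrx.symm])
  have cl2 := closing G [w, u, x] (by simp [huw.ne', hux.ne, hwx.ne]) (by simp) r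
    (by simp [hru.ne, hrw.ne, hrx.ne])
    (by simp [el, hrw, huw.symm, hux, hrx.symm])
  have hn : Fintype.card V - 2 = Fintype.card V - 4 + 1 + 1 := by omega
  rw [hn]
  refine ((this.add cl1).add cl2).mono le_rfl fun e he => ?_
  rcases hf.edge he with h | ⟨v, hv, h⟩
  · have inner : ∀ a b, e = s(a, b) → (a = u ∨ a = w ∨ a = x) →
        e ∈ ({e | e ∈ el (r :: ([u, w, x] ++ [r]))} : Set (Sym2 V)) ∨
        e ∈ ({e | e ∈ el (r :: ([w, u, x] ++ [r]))} : Set (Sym2 V)) := by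
      rintro a b rfl ha
      obtain ⟨a1, a2, a3, a4, a5⟩ := (mem_fullK ..).1 h
      have hb : b = u ∨ b = w ∨ b = x := by
        by_contra hb
        push Not at hb
        exact a5 (out a b ha a1 hb.1 hb.2.1 hb.2.2 a3)
      have hne := a1.ne
      clear a1 a2 a3 a4 a5 h he
      simp only [el, List.cons_append, List.nil_append, Set.mem_setOf_eq, List.mem_cons,
        Sym2.eq_iff]
      rcases ha with rfl | rfl | rfl <;> rcases hb with rfl | rfl | rfl <;> simp_all
    by_cases hZ : u ∉ e ∧ w ∉ e ∧ x ∉ e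
    · exact Or.inl (Or.inl (Or.inl (Finset.mem_filter.2 ⟨h, hZ⟩)))
    have : ∃ a, a ∈ e ∧ (a = u ∨ a = w ∨ a = x) := by
      by_contra hcon
      push Not at hcon
      exact hZ ⟨fun h => (hcon u h).1 rfl, fun h => (hcon w h).2.1 rfl, fun h => (hcon x h).2.2 rfl⟩
    obtain ⟨a, ⟨b, hb⟩, ha⟩ := this
    rcases inner a b hb ha with h | h
    · exact Or.inl (Or.inr h)
    · exact Or.inr h
  · by_cases v1 : v = u
    · refine Or.inl (Or.inr ?_)
      rw [h, v1, pr u hru]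
      simp [el]
    by_cases v2 : v = w
    · refine Or.inr ?_
      rw [h, v2, pr w hrw]
      simp [el]
    by_cases v3 : v = x
    · refine Or.inr ?_
      rw [h, v3, pr x hrx]
      simp [el]
    exact Or.inl (Or.inl (Or.inr ⟨v, hv, by simp [v1, v2, v3], h⟩))

lemma cov_connected {V : Type u} [Fintype V] (G : SimpleGraph V) (hc : G.Connected)
    (hnt : ¬ G.IsAcyclic) : Cov G (Fintype.card V - 2) G.edgeSet := by
  classical
  unfold SimpleGraph.IsAcyclic at hnt
  push Not at hnt
  obtain ⟨r, C, hC⟩ := hnt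
  have h3 : 3 ≤ Fintype.card V := by
    have h := hC.three_le_length
    have h' := hC.support_nodup.length_le_card
    simp at h'
    omega
  have hCu : s(r, C.snd) ∈ C.edges := C.mk_start_snd_mem_edges hC.not_nil
  have hru : G.Adj r C.snd := C.adj_of_mem_edges hCu
  by_cases hA : ∀ w, G.Adj r w → ¬ G.Adj C.snd w
  · exact case_A G hc r _ hru hA C hC hCu h3
  by_cases hB : ∃ r u w, G.Adj r u ∧ G.Adj r w ∧ G.Adj u w ∧ ∀ y, G.Adj r y → G.Adj u y → y = w
  · obtain ⟨r, u, w, b1, b2, b3, b4⟩ := hB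
    exact case_B G hc r u w b1 b2 b3 b4 (by omega)
  by_cases hD : ∃ r a b c d, [a, b, c, d].Nodup ∧ G.Adj r a ∧ G.Adj r b ∧ G.Adj r c ∧
      G.Adj r d ∧ G.Adj a b ∧ G.Adj b c ∧ G.Adj c d
  · obtain ⟨r, a, b, c, d, d0, d1, d2, d3, d4, d5, d6, d7⟩ := hD
    exact case_D G hc r a b c d d0 d1 d2 d3 d4 d5 d6 d7 h3
  push Not at hA hB
  have hD' : ∀ r a b c d, G.Adj r a → G.Adj r b → G.Adj r c → G.Adj r d → G.Adj a b →
      G.Adj b c → G.Adj c d → a = c ∨ a = d ∨ b = d := by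
    intro r a b c d d1 d2 d3 d4 d5 d6 d7
    by_contra hcon
    push Not at hcon
    exact hD ⟨r, a, b, c, d, by simp [hcon, d5.ne, d6.ne, d7.ne], d1, d2, d3, d4, d5, d6, d7⟩
  obtain ⟨w, hrw, huw⟩ := hA
  generalize C.snd = u at hru huw
  obtain ⟨x, hrx, hux, hxw⟩ := hB r u w hru hrw huw
  obtain ⟨y, hry, hwy, hyu⟩ := hB r w u hrw hru huw.symm
  have hyx : y = x := by
    have := hD' r y w u x hry hrw hru hrx hwy.symm huw.symm hux
    rcases this with h | h | h
    · exact (hyu h).elim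
    · exact h
    · exact (hxw h.symm).elim
  subst hyx
  have K : ∀ p q s t, G.Adj p q → G.Adj p s → G.Adj p t → G.Adj q s → G.Adj s t → q ≠ t →
      ∀ y, G.Adj p y → G.Adj q y → y = s ∨ y = t := by
    intro p q s t h1 h2 h3 h4 h5 h6 y h7 h8
    rcases hD' p y q s t h7 h1 h2 h3 h8.symm h4 h5 with h | h | h
    · exact Or.inl h
    · exact Or.inr h
    · exact (h6 h).elim
  refine case_E G hc r u w y hru hrw hry huw hux hwy
    (K r u w y hru hrw hry huw hwy hux.ne)
    (K r w u y hrw hru hry huw.symm hux hwy.ne)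
    (K r y u w hry hru hrw hux.symm huw hwy.ne')
    (K u w r y huw hru.symm hux hrw.symm hry hwy.ne)
    (K u y r w hux hru.symm huw hry.symm hrw hwy.ne')
    (K w y r u hwy hrw.symm huw.symm hry.symm hru hux.ne')

lemma cov_main {V : Type u} [Fintype V] (G : SimpleGraph V) (htree : ¬ G.IsTree) :
    Cov G (Fintype.card V - 2) G.edgeSet := by
  by_cases hp : G.Preconnected
  · rcases isEmpty_or_nonempty V with hV | hV
    · refine ⟨PEmpty, inferInstance, fun i => i.elim, by simp, fun i => i.elim, fun e => ?_⟩
      induction e using Sym2.ind with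
      | _ a b => exact hV.elim a
    · have hc : G.Connected := ⟨hp⟩
      exact cov_connected G hc fun h => htree ⟨hc, h⟩
  · exact cov_disconnected G hp

/-- If `G` is a simple graph on `n` vertices that is not a tree, then there
exist at most `n - 2` subsets of `E(G)` whose union is `E(G)`, each of which is either
the edge set of a cycle of `G` or a single edge; in particular `g_ce(G) ≤ n - 2`. -/
theorem cover_by_cycles_and_edges_of_not_tree
    {V : Type*} [Fintype V] [DecidableEq V] (G : SimpleGraph V)
    (htree : ¬ G.IsTree) :
    ∃ (k : ℕ) (f : Fin k → Set (Sym2 V)),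
      k ≤ Fintype.card V - 2 ∧
      (∀ i, (∃ (u : V) (w : G.Walk u u), w.IsCycle ∧ f i = {e | e ∈ w.edges}) ∨
            (∃ e ∈ G.edgeSet, f i = {e})) ∧
      (∀ e, e ∈ G.edgeSet ↔ ∃ i, e ∈ f i) := by
  obtain ⟨ι, _, S, h1, h2, h3⟩ := cov_main G htree
  refine ⟨Fintype.card ι, fun i => S ((Fintype.equivFin ι).symm i), h1, fun i => h2 _, ?_⟩
  intro e
  constructor
  · intro he
    obtain ⟨i, hi⟩ := h3 e he
    exact ⟨Fintype.equivFin ι i, by simpa using hi⟩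
  · rintro ⟨i, hi⟩
    rcases h2 ((Fintype.equivFin ι).symm i) with ⟨u, w, -, hw⟩ | ⟨e', he', hw⟩
    · simp only [hw] at hi
      exact w.edges_subset_edgeSet hi
    · simp only [hw] at hi
      rw [Set.mem_singleton_iff] at hi
      rw [hi]
      exact he'
end

section
/- Let G be a claw-free simple graph with exactly 2k vertices of odd degree, and let P'_1, ..., P'_k be paths in G that are not pairwise vertex-disjoint, such that every vertex of odd degree in G is an endpoint of some path P'_i. Then there exist pairwise vertex-disjoint paths P_1, ..., P_k in G such that every vertex of odd degree in G is an endpoint of some path P_i, and the total number of edges of P_1, ..., P_k is strictly smaller than the total number of edges of P'_1, ..., P'_k. -/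
open SimpleGraph in
lemma cf_key {V : Type*} (G : SimpleGraph V)
    (hclaw : ∀ v a b c : V, G.Adj v a → G.Adj v b → G.Adj v c →
      a ≠ b → a ≠ c → b ≠ c → (G.Adj a b ∨ G.Adj a c ∨ G.Adj b c))
    {x a b c : V} (A : G.Walk x a) (B : G.Walk x b) (C : G.Walk x c)
    (ha : x ≠ a) (hb : x ≠ b) (hc : x ≠ c) :
    (∃ w : G.Walk a b, w.length < A.length + B.length) ∨
    (∃ w : G.Walk a c, w.length < A.length + C.length) ∨
    (∃ w : G.Walk b c, w.length < B.length + C.length) := by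
  cases A with
  | nil => exact absurd rfl ha
  | @cons _ n1 _ h1 A =>
  cases B with
  | nil => exact absurd rfl hb
  | @cons _ n2 _ h2 B =>
  cases C with
  | nil => exact absurd rfl hc
  | @cons _ n3 _ h3 C =>
  have join : ∀ {m n s t : V} (S : G.Walk m s) (T : G.Walk n t), (m = n ∨ G.Adj m n) →
      ∃ w : G.Walk s t, w.length < (S.length + 1) + (T.length + 1) := by
    intro m n s t S T h
    rcases h with rfl | h
    · exact ⟨S.reverse.append T, by rw [Walk.length_append, Walk.length_reverse]; omega⟩
    · exact ⟨S.reverse.append (Walk.cons h T), by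
        rw [Walk.length_append, Walk.length_reverse, Walk.length_cons]; omega⟩
  simp only [Walk.length_cons]
  by_cases e1 : n1 = n2
  · exact Or.inl (join A B (Or.inl e1))
  by_cases e2 : n1 = n3
  · exact Or.inr (Or.inl (join A C (Or.inl e2)))
  by_cases e3 : n2 = n3
  · exact Or.inr (Or.inr (join B C (Or.inl e3)))
  rcases hclaw x n1 n2 n3 h1 h2 h3 e1 e2 e3 with h | h | h
  · exact Or.inl (join A B (Or.inr h))
  · exact Or.inr (Or.inl (join A C (Or.inr h)))
  · exact Or.inr (Or.inr (join B C (Or.inr h)))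

open SimpleGraph in
/-- Two disjoint pairs joined by walks of small total length. -/
def CfPair {V : Type*} (G : SimpleGraph V) (a b c d : V) (n : ℕ) : Prop :=
  ∃ (w : G.Walk a b) (z : G.Walk c d), w.length + z.length < n

open SimpleGraph in
lemma cf_three {V : Type*} (G : SimpleGraph V)
    (hclaw : ∀ v a b c : V, G.Adj v a → G.Adj v b → G.Adj v c →
      a ≠ b → a ≠ c → b ≠ c → (G.Adj a b ∨ G.Adj a c ∨ G.Adj b c))
    {x a b c d : V} (A : G.Walk x a) (B : G.Walk x b) (C : G.Walk x c) (D : G.Walk x d)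
    (ha : x ≠ a) (hb : x ≠ b) (hc : x ≠ c) (n : ℕ)
    (hn : n = A.length + B.length + C.length + D.length) :
    CfPair G a b c d n ∨ CfPair G a c b d n ∨ CfPair G b c a d n := by
  rcases cf_key G hclaw A B C ha hb hc with ⟨w, h⟩ | ⟨w, h⟩ | ⟨w, h⟩
  · exact Or.inl ⟨w, C.reverse.append D, by simp; omega⟩
  · exact Or.inr (Or.inl ⟨w, B.reverse.append D, by simp; omega⟩)
  · exact Or.inr (Or.inr ⟨w, A.reverse.append D, by simp; omega⟩)

open SimpleGraph in
lemma cf_step {V : Type*} [Fintype V] [DecidableEq V] (G : SimpleGraph V)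
    (hclaw : ∀ v a b c : V, G.Adj v a → G.Adj v b → G.Adj v c →
      a ≠ b → a ≠ c → b ≠ c → (G.Adj a b ∨ G.Adj a c ∨ G.Adj b c))
    (k : ℕ) (T : Finset V) (hT : T.card = 2 * k)
    (u v : Fin k → V) (p : ∀ i, G.Walk (u i) (v i))
    (hnd : ∃ i j, i ≠ j ∧ ∃ x, x ∈ (p i).support ∧ x ∈ (p j).support)
    (hcov : ∀ w ∈ T, ∃ i, w = u i ∨ w = v i) :
    ∃ (u2 v2 : Fin k → V), (∀ i, G.Reachable (u2 i) (v2 i)) ∧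
      (∀ w ∈ T, ∃ i, w = u2 i ∨ w = v2 i) ∧
      ∑ i, G.dist (u2 i) (v2 i) < ∑ i, (p i).length := by
  have hinj : Function.Injective (Sum.elim u v) := by
    rw [← Set.injOn_univ, ← Finset.coe_univ]
    apply Finset.injOn_of_card_image_eq
    apply le_antisymm Finset.card_image_le
    have : T ⊆ Finset.univ.image (Sum.elim u v) := by
      intro w hw
      obtain ⟨i, h | h⟩ := hcov w hw
      · exact Finset.mem_image.2 ⟨Sum.inl i, by simp, h.symm⟩
      · exact Finset.mem_image.2 ⟨Sum.inr i, by simp, h.symm⟩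
    have := Finset.card_le_card this
    simp only [Finset.card_univ, Fintype.card_sum, Fintype.card_fin]
    omega
  obtain ⟨i, j, hij, x, hxi, hxj⟩ := hnd
  have n1 : u i ≠ v i := fun h => by simpa using @hinj (Sum.inl i) (Sum.inr i) h
  have n2 : u i ≠ u j := fun h => hij (by simpa using @hinj (Sum.inl i) (Sum.inl j) h)
  have n3 : u i ≠ v j := fun h => by simpa using @hinj (Sum.inl i) (Sum.inr j) h
  have n4 : v i ≠ u j := fun h => by simpa using @hinj (Sum.inr i) (Sum.inl j) h
  have n5 : v i ≠ v j := fun h => hij (by simpa using @hinj (Sum.inr i) (Sum.inr j) h)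
  have n6 : u j ≠ v j := fun h => by simpa using @hinj (Sum.inl j) (Sum.inr j) h
  have helper : ∀ a b c d : V, CfPair G a b c d ((p i).length + (p j).length) →
      (∀ w, (w = u i ∨ w = v i) ∨ (w = u j ∨ w = v j) → (w = a ∨ w = b) ∨ (w = c ∨ w = d)) →
      ∃ (u2 v2 : Fin k → V), (∀ i, G.Reachable (u2 i) (v2 i)) ∧
      (∀ w ∈ T, ∃ i, w = u2 i ∨ w = v2 i) ∧
      ∑ i, G.dist (u2 i) (v2 i) < ∑ i, (p i).length := by
    rintro a b c d ⟨w, z, hwz⟩ hc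
    refine ⟨fun l => if l = i then a else if l = j then c else u l,
      fun l => if l = i then b else if l = j then d else v l, ?_, ?_, ?_⟩
    · intro l
      dsimp only
      by_cases h1 : l = i
      · simpa [h1] using w.reachable
      by_cases h2 : l = j
      · simpa [h1, h2, hij.symm] using z.reachable
      simpa [h1, h2] using (p l).reachable
    · intro y hy
      have key : (y = u i ∨ y = v i) ∨ (y = u j ∨ y = v j) →
          ∃ l, y = (if l = i then a else if l = j then c else u l) ∨
            y = (if l = i then b else if l = j then d else v l) := by
        intro h
        rcases hc y h with h | h
        · exact ⟨i, by simpa using h⟩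
        · exact ⟨j, by simpa [hij.symm] using h⟩
      obtain ⟨l, hl⟩ := hcov y hy
      by_cases h1 : l = i
      · subst h1; exact key (Or.inl hl)
      by_cases h2 : l = j
      · subst h2; exact key (Or.inr hl)
      exact ⟨l, by simpa [h1, h2] using hl⟩
    · have hj : j ∈ Finset.univ.erase i := by simp [hij.symm]
      rw [← Finset.add_sum_erase _ _ (Finset.mem_univ i), ← Finset.add_sum_erase _ _ hj,
        ← Finset.add_sum_erase _ (fun i => (p i).length) (Finset.mem_univ i),
        ← Finset.add_sum_erase _ (fun i => (p i).length) hj]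
      have hr : ∑ l ∈ (Finset.univ.erase i).erase j,
          G.dist (if l = i then a else if l = j then c else u l)
            (if l = i then b else if l = j then d else v l) ≤
          ∑ l ∈ (Finset.univ.erase i).erase j, (p l).length := by
        apply Finset.sum_le_sum
        intro l hl
        simp only [Finset.mem_erase, Finset.mem_univ, and_true] at hl
        simpa [hl.1, hl.2] using dist_le (p l)
      have e1 := dist_le w
      have e2 := dist_le z
      simp only [if_true, if_neg hij.symm]
      omega
  obtain ⟨A, B, hAB⟩ : ∃ (A : G.Walk x (u i)) (B : G.Walk x (v i)),
      A.length + B.length = (p i).length := by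
    refine ⟨((p i).takeUntil x hxi).reverse, (p i).dropUntil x hxi, ?_⟩
    rw [Walk.length_reverse, ← Walk.length_append, (p i).take_spec hxi]
  obtain ⟨C, D, hCD⟩ : ∃ (C : G.Walk x (u j)) (D : G.Walk x (v j)),
      C.length + D.length = (p j).length := by
    refine ⟨((p j).takeUntil x hxj).reverse, (p j).dropUntil x hxj, ?_⟩
    rw [Walk.length_reverse, ← Walk.length_append, (p j).take_spec hxj]
  by_cases ha : x = u i
  · rcases cf_three G hclaw B C D A (by rw [ha]; exact n1) (by rw [ha]; exact n2)
      (by rw [ha]; exact n3) _ rfl with h | h | h <;>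
    exact helper _ _ _ _ (by convert h using 1; omega) (by intro w hw; grind)
  by_cases hb : x = v i
  · rcases cf_three G hclaw A C D B ha (by rw [hb]; exact n4)
      (by rw [hb]; exact n5) _ rfl with h | h | h <;>
    exact helper _ _ _ _ (by convert h using 1; omega) (by intro w hw; grind)
  by_cases hc : x = u j
  · rcases cf_three G hclaw A B D C ha hb
      (by rw [hc]; exact n6) _ rfl with h | h | h <;>
    exact helper _ _ _ _ (by convert h using 1; omega) (by intro w hw; grind)
  · rcases cf_three G hclaw A B C D ha hb hc _ rfl with h | h | h <;>
    exact helper _ _ _ _ (by convert h using 1; omega) (by intro w hw; grind)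

lemma cf_finish {V : Type*} [Fintype V] [DecidableEq V] (G : SimpleGraph V)
    (hclaw : ∀ v a b c : V, G.Adj v a → G.Adj v b → G.Adj v c →
      a ≠ b → a ≠ c → b ≠ c → (G.Adj a b ∨ G.Adj a c ∨ G.Adj b c))
    (k : ℕ) (T : Finset V) (hT : T.card = 2 * k) (n : ℕ) :
    ∀ (u v : Fin k → V), (∀ i, G.Reachable (u i) (v i)) →
      (∀ w ∈ T, ∃ i, w = u i ∨ w = v i) → ∑ i, G.dist (u i) (v i) = n →
    ∃ (u v : Fin k → V) (p : ∀ i, G.Walk (u i) (v i)),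
      (∀ i, (p i).IsPath) ∧
      (∀ i j, i ≠ j → ∀ x, x ∈ (p i).support → x ∉ (p j).support) ∧
      (∀ w ∈ T, ∃ i, w = u i ∨ w = v i) ∧
      (∑ i, (p i).length) ≤ n := by
  induction n using Nat.strong_induction_on with
  | _ n ih =>
  intro u v hr hcov hn
  choose p hp hl using fun i => (hr i).exists_path_of_dist
  have hs : ∑ i, (p i).length = n := by rw [← hn]; exact Finset.sum_congr rfl fun i _ => hl i
  by_cases hd : ∃ i j, i ≠ j ∧ ∃ x, x ∈ (p i).support ∧ x ∈ (p j).support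
  · obtain ⟨u2, v2, h1, h2, h3⟩ := cf_step G hclaw k T hT u v p hd hcov
    obtain ⟨u3, v3, p3, a1, a2, a3, a4⟩ := ih _ (hs ▸ h3) u2 v2 h1 h2 rfl
    exact ⟨u3, v3, p3, a1, a2, a3, by omega⟩
  · push Not at hd
    exact ⟨u, v, p, hp, hd, hcov, hs.le⟩

/-- Let `G` be a claw-free simple graph with exactly `2k` vertices of odd
degree, and let `P'_1, …, P'_k` be paths in `G` that are NOT pairwise vertex-disjoint,
such that every vertex of odd degree in `G` is an endpoint of some `P'_i`.  Then there
exist pairwise vertex-disjoint paths `P_1, …, P_k` in `G` such that every vertex of odd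
degree in `G` is an endpoint of some `P_i`, with strictly smaller total number of edges. -/
theorem shorter_vertex_disjoint_paths_linking_odd_vertices_claw_free
    {V : Type*} [Fintype V] [DecidableEq V] (G : SimpleGraph V) [DecidableRel G.Adj]
    (hclaw : ∀ v a b c : V, G.Adj v a → G.Adj v b → G.Adj v c →
      a ≠ b → a ≠ c → b ≠ c → (G.Adj a b ∨ G.Adj a c ∨ G.Adj b c))
    (k : ℕ)
    (hodd : (Finset.univ.filter fun v => Odd (G.degree v)).card = 2 * k)
    (u' v' : Fin k → V) (p' : ∀ i, G.Walk (u' i) (v' i))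
    (hp' : ∀ i, (p' i).IsPath)
    (hnotdisj : ∃ i j, i ≠ j ∧ ∃ x, x ∈ (p' i).support ∧ x ∈ (p' j).support)
    (hcov' : ∀ w : V, Odd (G.degree w) → ∃ i, w = u' i ∨ w = v' i) :
    ∃ (u v : Fin k → V) (p : ∀ i, G.Walk (u i) (v i)),
      (∀ i, (p i).IsPath) ∧
      (∀ i j, i ≠ j → ∀ x, x ∈ (p i).support → x ∉ (p j).support) ∧
      (∀ w : V, Odd (G.degree w) → ∃ i, w = u i ∨ w = v i) ∧
      (∑ i, (p i).length) < (∑ i, (p' i).length) := by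
  obtain ⟨u2, v2, h1, h2, h3⟩ := cf_step G hclaw k _ hodd u' v' p' hnotdisj
    (fun w hw => hcov' w (by simpa using hw))
  obtain ⟨u, v, p, a1, a2, a3, a4⟩ := cf_finish G hclaw k _ hodd _ u2 v2 h1 h2 rfl
  exact ⟨u, v, p, a1, a2, fun w hw => a3 w (by simpa using hw), lt_of_le_of_lt a4 h3⟩
end

section
/- Let G be a 2-connected simple graph on n vertices whose edge set can be partitioned into the edge set of an even subgraph H and a set F of at most n-3 single edges. Then G can be covered by at most n-2 cycles and edges: g_ce(G) ≤ n-2. -/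
/-- `gce G` is the minimum number of subsets in a cover of `G` by cycles and edges:
the least `k` such that there are `k` subsets of `E(G)`, each either the edge set of a
cycle of `G` or a single edge, whose union is `E(G)`. -/
noncomputable def gce {V : Type*} (G : SimpleGraph V) : ℕ :=
  sInf {k : ℕ | ∃ f : Fin k → Set (Sym2 V),
    (∀ i, (∃ (u : V) (w : G.Walk u u), w.IsCycle ∧ f i = {e | e ∈ w.edges}) ∨
          (∃ e ∈ G.edgeSet, f i = {e})) ∧
    (∀ e, e ∈ G.edgeSet ↔ ∃ i, e ∈ f i)}

set_option linter.unusedSectionVars false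

namespace GceAux
variable {W : Type*}

/-- The list of consecutive (unordered) pairs of a list. -/
def edL : List W → List (Sym2 W)
  | [] => []
  | [_] => []
  | a :: b :: t => s(a, b) :: edL (b :: t)

@[simp] lemma edL_nil : edL ([] : List W) = [] := rfl
@[simp] lemma edL_single (a : W) : edL [a] = [] := rfl
@[simp] lemma edL_cons_cons (a b : W) (t : List W) :
    edL (a :: b :: t) = s(a, b) :: edL (b :: t) := rfl

lemma edL_append (l r : List W) (a : W) (hl : l ≠ []) :
    edL (l ++ a :: r) = edL l ++ s(l.getLast hl, a) :: edL (a :: r) := by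
  induction l with
  | nil => exact absurd rfl hl
  | cons b t ih =>
    cases t with
    | nil => simp
    | cons c t =>
      have := ih (by simp)
      simp only [List.cons_append, edL_cons_cons] at this ⊢
      rw [this]
      simp

lemma edL_reverse (l : List W) : (edL l.reverse).Perm (edL l) := by
  induction l with
  | nil => simp
  | cons b t ih =>
    cases t with
    | nil => simp
    | cons c t =>
      rw [List.reverse_cons, edL_append _ _ _ (by simp)]
      simp only [edL_single, List.getLast_reverse, List.head_cons, edL_cons_cons]
      refine (List.perm_append_singleton _ _).trans ?_
      rw [Sym2.eq_swap]
      exact ih.cons _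

lemma mem_of_mem_edL {l : List W} {e : Sym2 W} {v : W} (h : e ∈ edL l) (hv : v ∈ e) : v ∈ l := by
  induction l with
  | nil => simp at h
  | cons b t ih =>
    cases t with
    | nil => simp at h
    | cons c t =>
      simp only [edL_cons_cons, List.mem_cons] at h
      rcases h with rfl | h
      · simp at hv; aesop
      · exact List.mem_cons_of_mem _ (ih h)

variable [DecidableEq W] {ι : Type*} [Fintype ι]

def T (p : ι → List W) (e : Sym2 W) : ℕ := ∑ i, (edL (p i)).count e

def nE (l : List W) (w : W) : ℕ :=
  (if l.head? = some w then 1 else 0) + (if l.getLast? = some w then 1 else 0)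

def X (p : ι → List W) (w : W) : ℕ := ∑ i, nE (p i) w

def Rv (q l : List W) : Prop := q = l ∨ q = l.reverse

lemma Rv.perm {q l : List W} (h : Rv q l) : q.Perm l := by
  rcases h with rfl | rfl
  · rfl
  · exact List.reverse_perm l

lemma Rv.nE {q l : List W} (h : Rv q l) (w : W) : nE q w = nE l w := by
  rcases h with rfl | rfl
  · rfl
  · simp [GceAux.nE, add_comm]

lemma Rv.count {q l : List W} (h : Rv q l) (e : Sym2 W) :
    (edL q).count e = (edL l).count e := by
  rcases h with rfl | rfl
  · rfl
  · exact (edL_reverse l).count_eq e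

lemma sum_upd [DecidableEq ι] (f : List W → ℕ) (p : ι → List W) (i : ι) (q : List W) :
    (∑ j, f (Function.update p i q j)) + f (p i) = (∑ j, f (p j)) + f q := by
  rw [← Finset.add_sum_erase _ _ (Finset.mem_univ i),
    ← Finset.add_sum_erase (Finset.univ) (fun j => f (p j)) (Finset.mem_univ i)]
  have : ∑ x ∈ Finset.univ.erase i, f (Function.update p i q x)
      = ∑ x ∈ Finset.univ.erase i, f (p x) := by
    apply Finset.sum_congr rfl
    intro x hx
    rw [Function.update_of_ne (Finset.ne_of_mem_erase hx)]
  rw [this]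
  simp
  omega

def Good (p : ι → List W) (a : W) : ℕ → W → Prop
  | 0, u => ∃ i q, Rv q (p i) ∧ q.head? = some u ∧ a ∉ q
  | j + 1, u => ∃ i l r v, Rv (l ++ a :: r) (p i) ∧ l.head? = some u ∧ l.getLast? = some v ∧
      Good p a j v

lemma sink_count (a u : W) (q : List W) (hq : q.head? = some u) (e : Sym2 W) :
    (edL (a :: q)).count e = (edL q).count e + if e = s(a, u) then 1 else 0 := by
  cases q with
  | nil => simp at hq
  | cons b t =>
    simp at hq
    subst hq
    rw [edL_cons_cons, List.count_cons]
    simp only [beq_iff_eq, eq_comm (a := e)]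

lemma sink_nE (a u : W) (q : List W) (hq : q.head? = some u) (w : W) :
    nE (a :: q) w + (if w = u then 1 else 0) = nE q w + if w = a then 1 else 0 := by
  cases q with
  | nil => simp at hq
  | cons b t =>
    simp at hq
    subst hq
    simp only [nE, List.head?_cons, List.getLast?_cons_cons, Option.some.injEq, eq_comm]
    omega

lemma arc_count (a u v : W) (l r : List W) (hu : l.head? = some u) (hv : l.getLast? = some v)
    (e : Sym2 W) :
    (edL (l.reverse ++ a :: r)).count e + (if e = s(a, v) then 1 else 0)
      = (edL (l ++ a :: r)).count e + if e = s(a, u) then 1 else 0 := by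
  have hl : l ≠ [] := by rintro rfl; simp at hu
  have h1 : l.getLast hl = v := by
    rw [List.getLast?_eq_some_getLast hl] at hv; simpa using hv
  have h2 : l.head hl = u := by
    rw [List.head?_eq_some_head hl] at hu; simpa using hu
  rw [edL_append _ _ _ hl, edL_append _ _ _ (by simpa using hl)]
  simp only [List.count_append, List.count_cons, (edL_reverse l).count_eq, List.getLast_reverse,
    h1, h2, beq_iff_eq, Sym2.eq_swap (a := v), Sym2.eq_swap (a := u), eq_comm (a := e)]
  omega

lemma arc_nE (a u v : W) (l r : List W) (hu : l.head? = some u) (hv : l.getLast? = some v)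
    (w : W) :
    nE (l.reverse ++ a :: r) w + (if w = u then 1 else 0)
      = nE (l ++ a :: r) w + if w = v then 1 else 0 := by
  obtain ⟨z, hz⟩ : ∃ z, (a :: r).getLast? = some z := ⟨_, List.getLast?_eq_some_getLast (by simp)⟩
  simp [nE, hu, hv, List.getLast?_append, hz, eq_comm (a := w)]
  omega

end GceAux

namespace GceAux
variable {W : Type*} [DecidableEq W] {ι : Type*} [Fintype ι]

lemma split_unique {a : W} : ∀ {l l' r r' : List W}, a ∉ l → a ∉ l' →
    l ++ a :: r = l' ++ a :: r' → l = l' ∧ r = r'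
  | [], [], r, r', _, _, h => by simpa using h
  | [], b :: t, r, r', _, h2, h => by
      simp at h h2; exact absurd h.1 h2.1
  | b :: t, [], r, r', h1, _, h => by
      simp at h h1; exact absurd h.1.symm h1.1
  | b :: t, b' :: t', r, r', h1, h2, h => by
      simp only [List.cons_append, List.cons.injEq] at h
      obtain ⟨rfl, h⟩ := h
      obtain ⟨rfl, rfl⟩ := split_unique (fun hh => h1 (List.mem_cons_of_mem _ hh))
        (fun hh => h2 (List.mem_cons_of_mem _ hh)) h
      simp

lemma notMem_of_nodup {a : W} {l r : List W} (h : (l ++ a :: r).Nodup) : a ∉ l ∧ a ∉ r := by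
  rw [List.nodup_append] at h
  obtain ⟨_, h2, h3⟩ := h
  exact ⟨fun ha => h3 a ha a (by simp) rfl, (List.nodup_cons.1 h2).1⟩

def PF (p : ι → List W) : Prop := ∀ i, p i ≠ [] ∧ (p i).Nodup

lemma PF.upd [DecidableEq ι] {p : ι → List W} (h : PF p) {i : ι} {q : List W} (hq : q ≠ [])
    (hn : q.Nodup) : PF (Function.update p i q) := by
  intro j
  by_cases hj : j = i
  · subst hj; simpa using ⟨hq, hn⟩
  · rw [Function.update_of_ne hj]; exact h j

lemma good_transfer [DecidableEq ι] {p : ι → List W} (hp : PF p) {a u : W} {i : ι}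
    {l r : List W} (hR : Rv (l ++ a :: r) (p i)) (hu : l.head? = some u) (j : ℕ)
    (hmin : ∀ m ≤ j, ¬ Good p a m u) :
    ∀ m ≤ j, ∀ w, Good p a m w → Good (Function.update p i (l.reverse ++ a :: r)) a m w := by
  have hnd : (l ++ a :: r).Nodup := hR.perm.nodup_iff.2 (hp i).2
  have hal := notMem_of_nodup hnd
  intro m
  induction m with
  | zero =>
    rintro - w ⟨i', q, hq, hw, haq⟩
    have hne : i' ≠ i := by
      rintro rfl
      apply haq
      rw [hq.perm.mem_iff, ← hR.perm.mem_iff]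
      simp
    exact ⟨i', q, by rwa [Function.update_of_ne hne], hw, haq⟩
  | succ m ih =>
    rintro hm w hG
    obtain ⟨i', l', r', v', hR', hw, hv', hg⟩ := hG
    have hG : Good p a (m+1) w := ⟨i', l', r', v', hR', hw, hv', hg⟩
    have hg' := ih (by omega) v' hg
    by_cases hne : i' = i
    · subst hne
      have hal' := notMem_of_nodup (hR'.perm.nodup_iff.2 (hp i').2)
      have key : l' ++ a :: r' = l ++ a :: r ∨ l' ++ a :: r' = r.reverse ++ a :: l.reverse := by
        have e1 : (l ++ a :: r).reverse = r.reverse ++ a :: l.reverse := by simp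
        rw [← e1]
        rcases hR with h | h <;> rcases hR' with h' | h' <;> rw [h, h'] <;> simp
      rcases key with key | key
      · obtain ⟨rfl, rfl⟩ := split_unique hal'.1 hal.1 key
        rw [hu] at hw
        cases hw
        exact absurd hG (hmin _ hm)
      · obtain ⟨rfl, rfl⟩ := split_unique hal'.1 (by simpa using hal.2) key
        refine ⟨i', r.reverse, l, v', ?_, hw, hv', hg'⟩
        right
        simp
    · exact ⟨i', l', r', v', by rwa [Function.update_of_ne hne], hw, hv', hg'⟩

lemma token_of_good [DecidableEq ι] (a : W) : ∀ (j : ℕ) (p : ι → List W) (u : W), PF p →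
    Good p a j u → ∃ p' : ι → List W, PF p' ∧
      (∀ e, T p' e = T p e + if e = s(a, u) then 1 else 0) ∧
      (∀ w, X p' w + (if w = u then 1 else 0) = X p w + if w = a then 1 else 0) := by
  intro j
  induction j using Nat.strong_induction_on with
  | _ j ih =>
  intro p u hp hG
  by_cases hmin : ∃ m < j, Good p a m u
  · obtain ⟨m, hm, hG'⟩ := hmin
    exact ih m hm p u hp hG'
  push Not at hmin
  cases j with
  | zero =>
    obtain ⟨i, q, hq, hu, haq⟩ := hG
    refine ⟨Function.update p i (a :: q), hp.upd (by simp) ?_, ?_, ?_⟩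
    · exact List.nodup_cons.2 ⟨haq, hq.perm.nodup_iff.2 (hp i).2⟩
    · intro e
      have h1 := sum_upd (fun l => (edL l).count e) p i (a :: q)
      have h2 := sink_count a u q hu e
      have h3 := hq.count e
      simp only [T]
      omega
    · intro w
      have h1 := sum_upd (fun l => nE l w) p i (a :: q)
      have h2 := sink_nE a u q hu w
      have h3 := hq.nE w
      simp only [X]
      omega
  | succ j =>
    obtain ⟨i, l, r, v, hR, hu, hv, hg⟩ := hG
    have hnd : (l ++ a :: r).Nodup := hR.perm.nodup_iff.2 (hp i).2
    have hnd' : (l.reverse ++ a :: r).Nodup :=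
      (((List.reverse_perm l).append_right (a :: r)).nodup_iff).2 hnd
    have hp1 : PF (Function.update p i (l.reverse ++ a :: r)) := hp.upd (by simp) hnd'
    have hg1 := good_transfer hp hR hu j (fun m hm => hmin m (by omega)) j le_rfl v hg
    obtain ⟨p', hp', hT, hX⟩ := ih j (by omega) _ v hp1 hg1
    refine ⟨p', hp', ?_, ?_⟩
    · intro e
      have h1 := sum_upd (fun l => (edL l).count e) p i (l.reverse ++ a :: r)
      have h2 := arc_count a u v l r hu hv e
      have h3 := hR.count e
      have h4 := hT e
      simp only [T] at h4 ⊢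
      omega
    · intro w
      have h1 := sum_upd (fun l => nE l w) p i (l.reverse ++ a :: r)
      have h2 := arc_nE a u v l r hu hv w
      have h3 := hR.nE w
      have h4 := hX w
      simp only [X] at h4 ⊢
      omega

lemma count_split (a w : W) (l r : List W) :
    (if l.getLast? = some w then 1 else 0) + (if r.head? = some w then 1 else 0)
      ≤ (edL (l ++ a :: r)).count s(a, w) := by
  have h2 : (if r.head? = some w then 1 else 0) ≤ (edL (a :: r)).count s(a, w) := by
    cases r with
    | nil => simp
    | cons b t =>
      simp only [edL_cons_cons, List.count_cons, List.head?_cons, Option.some.injEq]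
      split_ifs with h h'
      · omega
      · subst h; simp at h'
      · omega
      · omega
  by_cases hl : l = []
  · subst hl; simpa using h2
  · rw [edL_append _ _ _ hl, List.count_append, List.count_cons, List.getLast?_eq_some_getLast hl]
    simp only [Option.some.injEq]
    split_ifs at * with h h' h''
    all_goals first | omega | (exfalso; subst h; simp [Sym2.eq_swap] at *)

lemma exists_good [Fintype W] (a u : W) (hua : u ≠ a) (p : ι → List W) (hp : PF p)
    (h : ∀ w, w ≠ a → T p s(a, w) ≤ X p w) (hu : T p s(a, u) < X p u) :
    ∃ j, Good p a j u := by
  classical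
  by_contra hcon
  push Not at hcon
  set B : Finset W := Finset.univ.filter (fun w => w ≠ a ∧ ∀ j, ¬ Good p a j w) with hB
  have memB : ∀ w, w ∈ B ↔ w ≠ a ∧ ∀ j, ¬ Good p a j w := by simp [hB]
  have hlt : ∑ w ∈ B, T p s(a, w) < ∑ w ∈ B, X p w := by
    apply Finset.sum_lt_sum
    · intro w hw; exact h w ((memB w).1 hw).1
    · exact ⟨u, (memB u).2 ⟨hua, hcon⟩, hu⟩
  have hS : ∀ o : Option W, (∑ w ∈ B, if o = some w then 1 else 0)
      = if (∃ w ∈ B, o = some w) then 1 else 0 := by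
    intro o
    cases o with
    | none => simp
    | some z => simp
  have hle : ∑ w ∈ B, X p w ≤ ∑ w ∈ B, T p s(a, w) := by
    simp only [X, T]
    rw [Finset.sum_comm, Finset.sum_comm (s := B)]
    apply Finset.sum_le_sum
    rintro i -
    by_cases ha : a ∈ p i
    · obtain ⟨l, r, hlr⟩ := List.append_of_mem ha
      have hnd := (hp i).2
      rw [hlr] at hnd
      have hal := notMem_of_nodup hnd
      have hkey : ∀ l r : List W, Rv (l ++ a :: r) (p i) → a ∉ l →
          (∑ w ∈ B, if (l ++ a :: r).head? = some w then 1 else 0) ≤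
          (∑ w ∈ B, if l.getLast? = some w then 1 else 0) := by
        intro l r hR hal
        rw [hS, hS]
        by_cases hl : l = []
        · subst hl
          rw [if_neg]
          · omega
          · rintro ⟨w, hw, hh⟩
            simp at hh
            exact ((memB w).1 hw).1 hh.symm
        · split_ifs with h1 h2
          · omega
          · exfalso
            apply h2
            obtain ⟨w, hw, hh⟩ := h1
            refine ⟨l.getLast hl, (memB _).2 ⟨?_, ?_⟩, List.getLast?_eq_some_getLast hl⟩
            · rintro h; apply hal; rw [← h]; exact List.getLast_mem hl
            · intro j hj
              apply ((memB w).1 hw).2 (j+1)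
              refine ⟨i, l, r, _, hR, ?_, List.getLast?_eq_some_getLast hl, hj⟩
              rwa [List.head?_append_of_ne_nil _ hl] at hh
          · omega
          · omega
      have k1 := hkey l r (Or.inl hlr.symm) hal.1
      have k2 := hkey r.reverse l.reverse (Or.inr (by rw [hlr]; simp)) (by simpa using hal.2)
      have e2 : (r.reverse ++ a :: l.reverse).head? = (l ++ a :: r).getLast? := by
        rw [← List.head?_reverse]; simp
      rw [e2, List.getLast?_reverse] at k2
      calc ∑ w ∈ B, nE (p i) w = (∑ w ∈ B, if (l ++ a :: r).head? = some w then 1 else 0)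
            + (∑ w ∈ B, if (l ++ a :: r).getLast? = some w then 1 else 0) := by
            rw [← Finset.sum_add_distrib, hlr]; rfl
        _ ≤ (∑ w ∈ B, if l.getLast? = some w then 1 else 0)
            + (∑ w ∈ B, if r.head? = some w then 1 else 0) := by omega
        _ = ∑ w ∈ B, ((if l.getLast? = some w then 1 else 0)
            + (if r.head? = some w then 1 else 0)) := by rw [← Finset.sum_add_distrib]
        _ ≤ _ := by
            apply Finset.sum_le_sum
            intro w _
            rw [hlr]
            exact count_split a w l r
    · have : ∑ w ∈ B, nE (p i) w = 0 := by
        apply Finset.sum_eq_zero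
        intro w hw
        have hw' := ((memB w).1 hw).2 0
        have n1 : ¬ (p i).head? = some w := fun hh => hw' ⟨i, p i, Or.inl rfl, hh, ha⟩
        have n2 : ¬ (p i).getLast? = some w := fun hh =>
          hw' ⟨i, (p i).reverse, Or.inr rfl, by simpa using hh, by simpa using ha⟩
        simp [nE, n1, n2]
      omega
  omega

lemma token [Fintype W] (a u : W) (hua : u ≠ a) (p : ι → List W) (hp : PF p)
    (h : ∀ w, w ≠ a → T p s(a, w) ≤ X p w) (hu : T p s(a, u) < X p u) :
    ∃ p' : ι → List W, PF p' ∧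
      (∀ e, T p' e = T p e + if e = s(a, u) then 1 else 0) ∧
      (∀ w, X p' w + (if w = u then 1 else 0) = X p w + if w = a then 1 else 0) := by
  classical
  obtain ⟨j, hj⟩ := exists_good a u hua p hp h hu
  exact token_of_good a j p u hp hj

/-- Bondy-type perfect path double cover. -/
lemma ppdc [Fintype W] (S : Finset (Sym2 W)) (hS : ∀ e ∈ S, ¬ e.IsDiag) :
    ∃ p : W → List W, PF p ∧ (∀ e, T p e = if e ∈ S then 2 else 0) ∧ ∀ w, X p w = 2 := by
  induction S using Finset.induction_on with
  | empty =>
    refine ⟨fun w => [w], ?_, ?_, ?_⟩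
    · intro i; simp
    · intro e; simp [T]
    · intro w; simp [X, nE, Finset.sum_add_distrib]
  | insert e S he ih =>
    obtain ⟨p, hp, hT, hX⟩ := ih (fun e h => hS e (Finset.mem_insert_of_mem h))
    have hd := hS e (Finset.mem_insert_self _ _)
    induction e using Sym2.inductionOn with
    | _ a u =>
    have hau : a ≠ u := by simpa using hd
    obtain ⟨p1, hp1, hT1, hX1⟩ := token a u hau.symm p hp
      (by intro w _; rw [hT, hX]; split_ifs <;> omega) (by rw [hT, hX, if_neg he]; omega)
    have hT1' : ∀ w, T p1 s(u, w) ≤ if w = a then 1 else 2 := by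
      intro w
      rw [hT1, hT]
      by_cases hwa : w = a
      · subst hwa
        rw [Sym2.eq_swap, if_neg he]; simp
      · rw [if_neg hwa, if_neg (c := s(u, w) = s(a, u))]
        · split_ifs <;> omega
        · simp [Sym2.eq_iff]; grind
    obtain ⟨p2, hp2, hT2, hX2⟩ := token u a hau p1 hp1
      (by
        intro w hw
        have h1 := hX1 w
        have h2 := hT1' w
        rw [hX] at h1
        rw [if_neg hw] at h1
        split_ifs at * <;> omega)
      (by
        have h1 := hX1 a
        have h2 := hT1' a
        rw [hX] at h1
        simp [hau] at h1 h2
        omega)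
    refine ⟨p2, hp2, ?_, ?_⟩
    · intro e
      rw [hT2, hT1, hT, Sym2.eq_swap (a := u)]
      by_cases h : e = s(a, u)
      · subst h; simp [he]
      · simp [h]
    · intro w
      have h1 := hX1 w
      have h2 := hX2 w
      rw [hX] at h1
      split_ifs at * <;> omega

end GceAux

namespace GceAux
variable {V : Type*}

def IsEnd (p : List V) (u : V) : Prop := p.head? = some u ∨ p.getLast? = some u

/-- Edges of the closed list through `c` and then `p`. -/
def Cov (c : V) (p : List V) (e : Sym2 V) : Prop := e ∈ edL p ∨ ∃ u, IsEnd p u ∧ e = s(c, u)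

structure CycOK (G : SimpleGraph V) (c : V) (p : List V) : Prop where
  nd : p.Nodup
  nm : c ∉ p
  ne : p ≠ []
  ed : ∀ e ∈ edL p, e ∈ G.edgeSet
  ends : ∀ u, IsEnd p u → G.Adj c u

lemma IsEnd.mem {p : List V} {u : V} (h : IsEnd p u) : u ∈ p := by
  rcases h with h | h
  · exact List.mem_of_mem_head? h
  · exact List.mem_of_getLast? h

lemma isEnd_reverse {p : List V} {u : V} : IsEnd p.reverse u ↔ IsEnd p u := by
  simp [IsEnd, or_comm]

lemma mem_edL_reverse {p : List V} {e : Sym2 V} : e ∈ edL p.reverse ↔ e ∈ edL p :=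
  (edL_reverse p).mem_iff

lemma cov_reverse {c : V} {p : List V} {e : Sym2 V} : Cov c p.reverse e ↔ Cov c p e := by
  simp [Cov, isEnd_reverse, mem_edL_reverse]

lemma mem_edL_cons {a : V} {r : List V} {e : Sym2 V} :
    e ∈ edL (a :: r) ↔ e ∈ edL r ∨ ∃ u, r.head? = some u ∧ e = s(a, u) := by
  cases r with
  | nil => simp
  | cons b t => simp [or_comm]

lemma mem_edL_split {a : V} {l r : List V} {e : Sym2 V} :
    e ∈ edL (l ++ a :: r) ↔ e ∈ edL l ∨ e ∈ edL r ∨ (∃ u, l.getLast? = some u ∧ e = s(a, u)) ∨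
      ∃ u, r.head? = some u ∧ e = s(a, u) := by
  by_cases hl : l = []
  · subst hl; simp [mem_edL_cons]
  · rw [edL_append _ _ _ hl, List.mem_append, List.mem_cons, mem_edL_cons,
      List.getLast?_eq_some_getLast hl]
    simp only [Option.some.injEq, exists_eq_left', Sym2.eq_swap (a := a)]
    tauto

def Off (x c : V) (p : List V) : Prop := c = x ∨ (c ≠ x ∧ x ∉ p)

lemma flag_left (G : SimpleGraph V) {x a : V} (hxa : G.Adj x a) {q : List V} (hq : q ≠ [])
    (hnd : q.Nodup) (hx : x ∉ q) (ha : a ∉ q) (hed : ∀ e ∈ edL q, e ∈ G.edgeSet)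
    (h1 : ∀ u, q.head? = some u → G.Adj a u) (h2 : ∀ u, q.getLast? = some u → G.Adj x u) :
    CycOK G x (a :: q) ∧ (∀ e ∈ edL q, Cov x (a :: q) e) ∧
      (∀ u, q.head? = some u → Cov x (a :: q) s(a, u)) ∧
      (∀ u, q.getLast? = some u → Cov x (a :: q) s(x, u)) ∧ Cov x (a :: q) s(x, a) := by
  have hlast : (a :: q).getLast? = q.getLast? := by
    cases q with
    | nil => exact absurd rfl hq
    | cons b t => simp
  refine ⟨⟨List.nodup_cons.2 ⟨ha, hnd⟩, ?_, by simp, ?_, ?_⟩, ?_, ?_, ?_, ?_⟩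
  · simp [hx, hxa.ne]
  · intro e he
    rcases mem_edL_cons.1 he with h | ⟨u, hu, rfl⟩
    · exact hed e h
    · exact h1 u hu
  · rintro u (hu | hu)
    · simp at hu; exact hu ▸ hxa
    · rw [hlast] at hu; exact h2 u hu
  · intro e he; exact Or.inl (mem_edL_cons.2 (Or.inl he))
  · intro u hu; exact Or.inl (mem_edL_cons.2 (Or.inr ⟨u, hu, rfl⟩))
  · intro u hu; exact Or.inr ⟨u, Or.inr (hlast.trans hu), rfl⟩
  · exact Or.inr ⟨a, Or.inl rfl, rfl⟩

lemma flag_item (G : SimpleGraph V) {x a : V} (hxa : G.Adj x a) {q : List V} (hq : q ≠ [])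
    (hnd : q.Nodup) (hx : x ∉ q) (ha : a ∉ q) (hed : ∀ e ∈ edL q, e ∈ G.edgeSet) (D1 D2 : Prop)
    (h1 : ∀ u, q.head? = some u → (D1 → G.Adj a u) ∧ (¬ D1 → G.Adj x u))
    (h2 : ∀ u, q.getLast? = some u → (D2 → G.Adj a u) ∧ (¬ D2 → G.Adj x u)) :
    ∃ c q', CycOK G c q' ∧ Off x c q' ∧ (∀ e ∈ edL q, Cov c q' e) ∧
      (∀ u, q.head? = some u → (D1 → Cov c q' s(a, u)) ∧ (¬ D1 → Cov c q' s(x, u))) ∧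
      (∀ u, q.getLast? = some u → (D2 → Cov c q' s(a, u)) ∧ (¬ D2 → Cov c q' s(x, u))) ∧
      ((D1 ∧ ¬ D2 ∨ ¬ D1 ∧ D2) → Cov c q' s(x, a)) := by
  by_cases d1 : D1 <;> by_cases d2 : D2 <;> simp only [d1, d2, true_implies, not_true_eq_false,
    false_implies, not_false_eq_true, and_true, true_and, and_false, or_false, or_true,
    and_self, false_and, or_self, implies_true] at h1 h2 ⊢
  · refine ⟨a, q, ⟨hnd, ha, hq, hed, ?_⟩, Or.inr ⟨hxa.ne', hx⟩, ?_, ?_, ?_⟩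
    · rintro u (hu | hu)
      · exact h1 u hu
      · exact h2 u hu
    · intro e he; exact Or.inl he
    · intro u hu; exact Or.inr ⟨u, Or.inl hu, rfl⟩
    · intro u hu; exact Or.inr ⟨u, Or.inr hu, rfl⟩
  · obtain ⟨k1, k2, k3, k4, k5⟩ := flag_left G hxa hq hnd hx ha hed h1 h2
    exact ⟨x, a :: q, k1, Or.inl rfl, k2, k3, k4, k5⟩
  · obtain ⟨k1, k2, k3, k4, k5⟩ := flag_left G hxa (q := q.reverse) (by simpa using hq)
      (by simpa using hnd) (by simpa using hx) (by simpa using ha)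
      (fun e he => hed e (mem_edL_reverse.1 he)) (by simpa using h2) (by simpa using h1)
    exact ⟨x, _, k1, Or.inl rfl, fun e he => k2 e (mem_edL_reverse.2 he), by simpa using k4,
      by simpa using k3, k5⟩
  · refine ⟨x, q, ⟨hnd, hx, hq, hed, ?_⟩, Or.inl rfl, ?_, ?_, ?_⟩
    · rintro u (hu | hu)
      · exact h1 u hu
      · exact h2 u hu
    · intro e he; exact Or.inl he
    · intro u hu; exact Or.inr ⟨u, Or.inl hu, rfl⟩
    · intro u hu; exact Or.inr ⟨u, Or.inr hu, rfl⟩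

def Fam (G : SimpleGraph V) (x : V) (ι : Type*) : Prop :=
  ∃ (c : ι → V) (p : ι → List V), (∀ i, CycOK G (c i) (p i) ∧ Off x (c i) (p i)) ∧
    ∀ e ∈ G.edgeSet, ∃ i, Cov (c i) (p i) e

lemma exists_walk (G : SimpleGraph V) (z : V) : ∀ (l : List V) (b : V),
    (∀ e ∈ edL (b :: (l ++ [z])), e ∈ G.edgeSet) →
    ∃ w : G.Walk b z, w.support = b :: (l ++ [z]) ∧ w.edges = edL (b :: (l ++ [z]))
  | [], b, h => by
      have hA : G.Adj b z := h s(b, z) (by simp)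
      exact ⟨.cons hA .nil, by simp, by simp⟩
  | d :: t, b, h => by
      obtain ⟨w, hw, hw'⟩ := exists_walk G z t d (fun e he => h e (by simp [he]))
      have hA : G.Adj b d := h s(b, d) (by simp)
      exact ⟨.cons hA w, by simp [hw], by simp [hw']⟩

lemma cov_iff {c : V} {p : List V} (hp : p ≠ []) {e : Sym2 V} :
    Cov c p e ↔ e ∈ edL (c :: (p ++ [c])) := by
  rw [mem_edL_cons, mem_edL_split, List.head?_append_of_ne_nil _ hp]
  simp only [Cov, IsEnd, edL_nil, List.not_mem_nil, List.head?_nil, reduceCtorEq, false_and,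
    exists_false, false_or, or_false, or_and_right, exists_or, or_assoc]
  rw [or_comm (a := ∃ x, p.head? = some x ∧ e = s(c, x))]

lemma CycOK.mem_edgeSet {G : SimpleGraph V} {c : V} {p : List V} (h : CycOK G c p) {e : Sym2 V}
    (he : Cov c p e) : e ∈ G.edgeSet := by
  rcases he with he | ⟨u, hu, rfl⟩
  · exact h.ed e he
  · exact h.ends u hu

lemma CycOK.item {G : SimpleGraph V} {c : V} {p : List V} (h : CycOK G c p) :
    (∃ (u : V) (w : G.Walk u u), w.IsCycle ∧ {e | Cov c p e} = {e | e ∈ w.edges}) ∨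
          (∃ e ∈ G.edgeSet, {e | Cov c p e} = {e}) := by
  match p, h with
  | [], h => exact absurd rfl h.ne
  | [b], h =>
    right
    refine ⟨s(c, b), h.ends b (Or.inl rfl), ?_⟩
    ext e
    simp [Cov, IsEnd]
  | b :: d :: t, h =>
    left
    have hE : ∀ e ∈ edL (c :: (b :: d :: t ++ [c])), e ∈ G.edgeSet :=
      fun e he => h.mem_edgeSet ((cov_iff h.ne).2 he)
    obtain ⟨w, hw, hw'⟩ := exists_walk G c (d :: t) b (fun e he => hE e (by
      simp only [List.cons_append, edL_cons_cons, List.mem_cons] at he ⊢; tauto))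
    refine ⟨c, .cons (h.ends b (Or.inl rfl)) w, ?_, ?_⟩
    · rw [SimpleGraph.Walk.cons_isCycle_iff]
      have hnd := h.nd
      have hnm := h.nm
      constructor
      · rw [SimpleGraph.Walk.isPath_def, hw]
        have : (b :: (d :: t ++ [c])).Perm (c :: b :: d :: t) :=
          List.perm_append_singleton c (b :: d :: t)
        rw [this.nodup_iff]
        exact List.nodup_cons.2 ⟨hnm, hnd⟩
      · rw [hw']
        simp only [List.cons_append, edL_cons_cons, List.mem_cons, not_or]
        simp only [List.mem_cons, not_or, List.nodup_cons] at hnd hnm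
        constructor
        · simp only [Sym2.eq_iff]; grind
        · intro he
          have := mem_of_mem_edL he (Sym2.mem_mk_right c b)
          simp at this
          grind
    · ext e
      simp only [Set.mem_ofPred_eq, cov_iff h.ne, SimpleGraph.Walk.edges_cons, hw']
      simp

lemma gce_le_of_fam {G : SimpleGraph V} {x : V} {ι : Type*} [Fintype ι] (h : Fam G x ι) :
    gce G ≤ Fintype.card ι := by
  obtain ⟨c, p, h1, h2⟩ := h
  apply Nat.sInf_le
  let φ := Fintype.equivFin ι
  refine ⟨fun i => {e | Cov (c (φ.symm i)) (p (φ.symm i)) e}, fun i => (h1 _).1.item, ?_⟩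
  intro e
  constructor
  · intro he
    obtain ⟨i, hi⟩ := h2 e he
    exact ⟨φ i, by simpa using hi⟩
  · rintro ⟨i, hi⟩
    exact (h1 _).1.mem_edgeSet hi

end GceAux

namespace GceAux
variable {V : Type*}

/-- Vertices adjacent to `a` but not to `x`. -/
def KY (G : SimpleGraph V) (x a v : V) : Prop := G.Adj a v ∧ v ≠ x ∧ ¬ G.Adj x v

/-- Kelmans shift from `a` to `x`. -/
def kel (G : SimpleGraph V) (x a : V) : SimpleGraph V where
  Adj u v := (G.Adj u v ∧ ¬ (u = a ∧ KY G x a v) ∧ ¬ (v = a ∧ KY G x a u)) ∨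
    (u = x ∧ KY G x a v) ∨ (v = x ∧ KY G x a u)
  symm := ⟨by
    intro u v h
    rcases h with ⟨h1, h2, h3⟩ | h | h
    · exact Or.inl ⟨h1.symm, h3, h2⟩
    · exact Or.inr (Or.inr h)
    · exact Or.inr (Or.inl h)⟩
  loopless := ⟨by
    intro u h
    rcases h with ⟨h1, h2, h3⟩ | ⟨rfl, h⟩ | ⟨rfl, h⟩
    · exact h1.ne rfl
    · exact h.2.1 rfl
    · exact h.2.1 rfl⟩

variable {G : SimpleGraph V} {x a : V}

lemma kel_adj_x (hxa : G.Adj x a) (v : V) : (kel G x a).Adj x v ↔ G.Adj x v ∨ KY G x a v := by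
  have := hxa.ne
  simp only [kel, KY]
  constructor
  · rintro (h | h | h)
    · exact Or.inl h.1
    · exact Or.inr h.2
    · exact absurd rfl h.2.2.1
  · rintro (h | h)
    · exact Or.inl ⟨h, fun hh => this hh.1, fun hh => hh.2.2.1 rfl⟩
    · exact Or.inr (Or.inl ⟨trivial, h⟩)

lemma kel_adj_a (hxa : G.Adj x a) {v : V} (hv : v ≠ x) :
    (kel G x a).Adj a v ↔ G.Adj a v ∧ G.Adj x v := by
  have := hxa.ne'
  simp only [kel, KY]
  constructor
  · rintro (h | h | h)
    · refine ⟨h.1, ?_⟩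
      by_contra hc
      exact h.2.1 ⟨trivial, h.1, hv, hc⟩
    · exact absurd h.1 this
    · exact absurd h.1 hv
  · rintro ⟨h, h'⟩
    exact Or.inl ⟨h, fun hh => hh.2.2.2 h', fun hh => h.ne' hh.1⟩

lemma kel_adj_le {u v : V} (hu : u ≠ x) (hv : v ≠ x) (h : (kel G x a).Adj u v) : G.Adj u v := by
  rcases h with h | h | h
  · exact h.1
  · exact absurd h.1 hu
  · exact absurd h.1 hv

lemma kel_adj_of {u v : V} (hu : u ≠ a) (hv : v ≠ a) (h : G.Adj u v) : (kel G x a).Adj u v :=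
  Or.inl ⟨h, fun hh => hu hh.1, fun hh => hv hh.1⟩

lemma kel_edge_le {e : Sym2 V} (hx : x ∉ e) (h : e ∈ (kel G x a).edgeSet) : e ∈ G.edgeSet := by
  induction e using Sym2.inductionOn with
  | _ u v =>
  simp at hx
  exact kel_adj_le (Ne.symm hx.1) (Ne.symm hx.2) h

lemma flip_arc (x a : V) (D : V → Prop) (l : List V)
    (h1 : ∀ u, l.head? = some u → (D u → G.Adj a u) ∧ (¬ D u → G.Adj x u))
    (h2 : ∀ v, l.getLast? = some v → G.Adj a v ∧ G.Adj x v) :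
    ∃ l' : List V, l'.Perm l ∧ (∀ e, e ∈ edL l' ↔ e ∈ edL l) ∧
      (∀ z, l'.head? = some z → G.Adj x z) ∧ (∀ z, l'.getLast? = some z → G.Adj a z) ∧
      ∀ u v, l.head? = some u → l.getLast? = some v →
        (D u → l'.getLast? = some u ∧ l'.head? = some v) ∧
        (¬ D u → l'.head? = some u ∧ l'.getLast? = some v) := by
  by_cases hd : ∃ u, l.head? = some u ∧ D u
  · obtain ⟨u, hu, hd⟩ := hd
    refine ⟨l.reverse, List.reverse_perm l, fun e => mem_edL_reverse, ?_, ?_, ?_⟩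
    · intro z hz; exact (h2 z (by simpa using hz)).2
    · intro z hz
      have hz : l.head? = some z := by simpa using hz
      rw [hu] at hz; cases hz
      exact (h1 u hu).1 hd
    · intro u' v hu' hv
      have : u' = u := by rw [hu] at hu'; cases hu'; rfl
      subst this
      exact ⟨fun _ => by simp [hu, hv], fun h => absurd hd h⟩
  · refine ⟨l, List.Perm.refl _, fun e => Iff.rfl, ?_, ?_, ?_⟩
    · intro z hz; exact (h1 z hz).2 fun h => hd ⟨z, hz, h⟩
    · intro z hz; exact (h2 z hz).1
    · intro u v hu hv
      exact ⟨fun h => absurd ⟨u, hu, h⟩ hd, fun _ => ⟨hu, hv⟩⟩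

lemma kel_item [DecidableEq V] (hxa : G.Adj x a) (D : V → Prop) (hD : ∀ u, D u → G.Adj a u)
    (hD' : ∀ u, ¬ D u → ¬ KY G x a u) {p : List V} (hp : CycOK (kel G x a) x p) :
    ∃ c q', CycOK G c q' ∧ Off x c q' ∧ (∀ e ∈ edL p, a ∉ e → Cov c q' e) ∧
      (IsEnd p a → Cov c q' s(x, a)) ∧
      (∀ u, IsEnd p u → u ≠ a → (D u → Cov c q' s(a, u)) ∧ (¬ D u → Cov c q' s(x, u))) ∧
      (∀ l r u v, Rv (l ++ a :: r) p → l.head? = some u → l.getLast? = some v →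
        (D u → Cov c q' s(x, v)) ∧ (¬ D u → Cov c q' s(a, v))) := by
  have hends : ∀ u, IsEnd p u → ¬ D u → G.Adj x u := fun u hu hd => by
    rcases (kel_adj_x hxa u).1 (hp.ends u hu) with h | h
    · exact h
    · exact absurd h (hD' u hd)
  have hedG : ∀ e ∈ edL p, e ∈ G.edgeSet := fun e he =>
    kel_edge_le (fun hx => hp.nm (mem_of_mem_edL he hx)) (hp.ed e he)
  by_cases ha : a ∈ p
  · obtain ⟨l, r, hlr⟩ := List.append_of_mem ha
    subst hlr
    have hnd := hp.nd
    have hal := notMem_of_nodup hnd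
    have hxl := hp.nm
    simp only [List.mem_append, List.mem_cons, not_or] at hxl
    have hleft : ∀ v, l.getLast? = some v → G.Adj a v ∧ G.Adj x v := by
      intro v hv
      have hvx : v ≠ x := by rintro rfl; exact hxl.1 (List.mem_of_getLast? hv)
      exact (kel_adj_a hxa hvx).1
        (hp.ed s(a, v) (mem_edL_split.2 (Or.inr (Or.inr (Or.inl ⟨v, hv, rfl⟩)))))
    have hright : ∀ v, r.head? = some v → G.Adj a v ∧ G.Adj x v := by
      intro v hv
      have hvx : v ≠ x := by rintro rfl; exact hxl.2.2 (List.mem_of_mem_head? hv)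
      exact (kel_adj_a hxa hvx).1
        (hp.ed s(a, v) (mem_edL_split.2 (Or.inr (Or.inr (Or.inr ⟨v, hv, rfl⟩)))))
    have hend1 : ∀ u, l.head? = some u → IsEnd (l ++ a :: r) u := by
      intro u hu
      left
      rw [List.head?_append, hu]; rfl
    have hend2 : ∀ u, r.getLast? = some u → IsEnd (l ++ a :: r) u := by
      intro u hu
      right
      rw [List.getLast?_append, List.getLast?_cons, hu]; rfl
    obtain ⟨l', pl, el, hl1, hl2, hl3⟩ := flip_arc x a D l
      (fun u hu => ⟨hD u, hends u (hend1 u hu)⟩) hleft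
    obtain ⟨r', pr, er, hr1, hr2, hr3⟩ := flip_arc x a D r.reverse
      (fun u hu => ⟨hD u, hends u (hend2 u (by simpa using hu))⟩)
      (fun v hv => hright v (by simpa using hv))
    have pr' : r'.reverse.Perm r := ((List.reverse_perm r').trans pr).trans (List.reverse_perm r)
    have hperm : (l' ++ a :: r'.reverse).Perm (l ++ a :: r) := pl.append (pr'.cons a)
    have hend : ∀ u, IsEnd (l' ++ a :: r'.reverse) u ↔
        (l'.head? = some u ∨ (l' = [] ∧ u = a)) ∨ (r'.head? = some u ∨ (r' = [] ∧ u = a)) := by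
      intro u
      simp only [IsEnd, List.head?_append, List.getLast?_append, List.getLast?_cons,
        List.getLast?_reverse]
      cases l' <;> cases r' <;> simp [eq_comm]
    have hcl : ∀ u v, l.head? = some u → l.getLast? = some v →
        (D u → Cov x (l' ++ a :: r'.reverse) s(x, v) ∧ Cov x (l' ++ a :: r'.reverse) s(a, u)) ∧
        (¬ D u → Cov x (l' ++ a :: r'.reverse) s(a, v) ∧
          Cov x (l' ++ a :: r'.reverse) s(x, u)) := by
      intro u v hu hv
      obtain ⟨k1, k2⟩ := hl3 u v hu hv
      constructor
      · intro d
        exact ⟨Or.inr ⟨v, (hend v).2 (Or.inl (Or.inl (k1 d).2)), rfl⟩,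
          Or.inl (mem_edL_split.2 (Or.inr (Or.inr (Or.inl ⟨u, (k1 d).1, rfl⟩))))⟩
      · intro d
        exact ⟨Or.inl (mem_edL_split.2 (Or.inr (Or.inr (Or.inl ⟨v, (k2 d).2, rfl⟩)))),
          Or.inr ⟨u, (hend u).2 (Or.inl (Or.inl (k2 d).1)), rfl⟩⟩
    have hcr : ∀ u v, r.getLast? = some u → r.head? = some v →
        (D u → Cov x (l' ++ a :: r'.reverse) s(x, v) ∧ Cov x (l' ++ a :: r'.reverse) s(a, u)) ∧
        (¬ D u → Cov x (l' ++ a :: r'.reverse) s(a, v) ∧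
          Cov x (l' ++ a :: r'.reverse) s(x, u)) := by
      intro u v hu hv
      obtain ⟨k1, k2⟩ := hr3 u v (by simpa using hu) (by simpa using hv)
      constructor
      · intro d
        exact ⟨Or.inr ⟨v, (hend v).2 (Or.inr (Or.inl (k1 d).2)), rfl⟩,
          Or.inl (mem_edL_split.2 (Or.inr (Or.inr (Or.inr ⟨u, by simpa using (k1 d).1, rfl⟩))))⟩
      · intro d
        exact ⟨Or.inl (mem_edL_split.2
          (Or.inr (Or.inr (Or.inr ⟨v, by simpa using (k2 d).2, rfl⟩)))),
          Or.inr ⟨u, (hend u).2 (Or.inr (Or.inl (k2 d).1)), rfl⟩⟩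
    have getl : ∀ u, l.head? = some u → ∃ v, l.getLast? = some v := by
      intro u hu
      have : l ≠ [] := by rintro rfl; simp at hu
      exact ⟨_, List.getLast?_eq_some_getLast this⟩
    have getr : ∀ u, r.getLast? = some u → ∃ v, r.head? = some v := by
      intro u hu
      have : r ≠ [] := by rintro rfl; simp at hu
      exact ⟨_, List.head?_eq_some_head this⟩
    refine ⟨x, l' ++ a :: r'.reverse, ⟨hperm.nodup_iff.2 hnd, ?_, by simp, ?_, ?_⟩, Or.inl rfl,
      ?_, ?_, ?_, ?_⟩
    · rw [hperm.mem_iff]; exact hp.nm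
    · intro e he
      rcases mem_edL_split.1 he with h | h | ⟨u, h, rfl⟩ | ⟨u, h, rfl⟩
      · exact hedG e (mem_edL_split.2 (Or.inl ((el e).1 h)))
      · exact hedG e (mem_edL_split.2 (Or.inr (Or.inl
          (mem_edL_reverse.1 ((er e).1 (mem_edL_reverse.1 h))))))
      · exact hl2 u h
      · exact hr2 u (by simpa using h)
    · intro u hu
      rcases (hend u).1 hu with (h | h) | (h | h)
      · exact hl1 u h
      · exact h.2 ▸ hxa
      · exact hr1 u h
      · exact h.2 ▸ hxa
    · intro e he hae
      left
      rcases mem_edL_split.1 he with h | h | ⟨u, h, rfl⟩ | ⟨u, h, rfl⟩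
      · exact mem_edL_split.2 (Or.inl ((el e).2 h))
      · exact mem_edL_split.2 (Or.inr (Or.inl
          (mem_edL_reverse.2 ((er e).2 (mem_edL_reverse.2 h)))))
      · simp at hae
      · simp at hae
    · intro hE
      refine Or.inr ⟨a, (hend a).2 ?_, rfl⟩
      rcases hE with h | h
      · left; right
        have : l = [] := by
          cases l with
          | nil => rfl
          | cons b t => simp at h; simp [h] at hal
        subst this
        exact ⟨pl.eq_nil, rfl⟩
      · right; right
        have : r = [] := by
          rcases List.eq_nil_or_concat r with h' | ⟨t, b, rfl⟩
          · exact h'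
          · simp [List.getLast?_append, List.getLast?_cons] at h; simp [h] at hal
        subst this
        exact ⟨by simpa using pr, rfl⟩
    · intro u hu hua
      have hu' : l.head? = some u ∨ r.getLast? = some u := by
        rcases hu with h | h
        · left
          cases l with
          | nil => simp at h; exact absurd h.symm hua
          | cons b t => simpa using h
        · right
          rcases List.eq_nil_or_concat r with rfl | ⟨t, b, rfl⟩
          · simp [List.getLast?_append] at h; exact absurd h.symm hua
          · simpa [List.getLast?_append, List.getLast?_cons] using h
      rcases hu' with h | h
      · obtain ⟨v, hv⟩ := getl u h
        exact ⟨fun d => ((hcl u v h hv).1 d).2, fun d => ((hcl u v h hv).2 d).2⟩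
      · obtain ⟨v, hv⟩ := getr u h
        exact ⟨fun d => ((hcr u v h hv).1 d).2, fun d => ((hcr u v h hv).2 d).2⟩
    · intro l2 r2 u v hR hu hv
      have hal2 := notMem_of_nodup (hR.perm.nodup_iff.2 hnd)
      rcases hR with h | h
      · obtain ⟨rfl, rfl⟩ := split_unique hal2.1 hal.1 h
        exact ⟨fun d => ((hcl u v hu hv).1 d).1, fun d => ((hcl u v hu hv).2 d).1⟩
      · have e1 : (l ++ a :: r).reverse = r.reverse ++ a :: l.reverse := by simp
        rw [e1] at h
        obtain ⟨rfl, rfl⟩ := split_unique hal2.1 (by simpa using hal.2) h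
        have hu' : r.getLast? = some u := by simpa using hu
        have hv' : r.head? = some v := by simpa using hv
        exact ⟨fun d => ((hcr u v hu' hv').1 d).1, fun d => ((hcr u v hu' hv').2 d).1⟩
  · obtain ⟨c, q', k1, k2, k3, k4, k5, -⟩ := flag_item G hxa hp.ne hp.nd hp.nm ha hedG
      (∃ u, p.head? = some u ∧ D u) (∃ u, p.getLast? = some u ∧ D u)
      (fun u hu => ⟨fun ⟨u', hu', d⟩ => by rw [hu] at hu'; cases hu'; exact hD u d,
        fun hn => hends u (Or.inl hu) fun d => hn ⟨u, hu, d⟩⟩)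
      (fun u hu => ⟨fun ⟨u', hu', d⟩ => by rw [hu] at hu'; cases hu'; exact hD u d,
        fun hn => hends u (Or.inr hu) fun d => hn ⟨u, hu, d⟩⟩)
    refine ⟨c, q', k1, k2, fun e he _ => k3 e he, fun h => absurd h.mem ha, ?_, ?_⟩
    · rintro u (hu | hu) -
      · refine ⟨fun d => (k4 u hu).1 ⟨u, hu, d⟩, fun d => (k4 u hu).2 ?_⟩
        rintro ⟨u', hu', d'⟩
        rw [hu] at hu'; cases hu'; exact d d'
      · refine ⟨fun d => (k5 u hu).1 ⟨u, hu, d⟩, fun d => (k5 u hu).2 ?_⟩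
        rintro ⟨u', hu', d'⟩
        rw [hu] at hu'; cases hu'; exact d d'
    · intro l r u v hR
      exact absurd (hR.perm.mem_iff.1 (by simp)) ha

inductive Act {ι : Type*} (Y : V → Prop) (Arc : ι → V → V → Prop) (σ : V → ι) : V → Prop
  | base {i u v} : Arc i u v → Y u → Act Y Arc σ v
  | step {u v} : Arc (σ u) u v → Act Y Arc σ u → Act Y Arc σ v

lemma kel_fam [DecidableEq V] {ι : Type*} (hxa : G.Adj x a) (h : Fam (kel G x a) x ι) :
    Fam G x ι := by
  classical
  obtain ⟨c, p, hcp, hcov⟩ := h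
  have hofx : ∀ v, (kel G x a).Adj x v → ∃ i, c i = x ∧ IsEnd (p i) v := by
    intro v hv
    obtain ⟨i, hi⟩ := hcov s(x, v) hv
    obtain ⟨ok, off⟩ := hcp i
    have hxp : x ∉ p i := by
      rcases off with h | h
      · rw [← h]; exact ok.nm
      · exact h.2
    rcases hi with hi | ⟨u, hu, he⟩
    · exact absurd (mem_of_mem_edL hi (Sym2.mem_mk_left x v)) hxp
    · rcases Sym2.eq_iff.1 he with ⟨h1, h2⟩ | ⟨h1, h2⟩
      · exact ⟨i, h1.symm, h2 ▸ hu⟩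
      · exact absurd (h1 ▸ hu.mem) hxp
  have hxa' : (kel G x a).Adj x a := (kel_adj_x hxa a).2 (Or.inl hxa)
  obtain ⟨i0, -⟩ := hofx a hxa'
  have : Nonempty ι := ⟨i0⟩
  choose! σ hσ1 hσ2 using hofx
  let Arc : ι → V → V → Prop := fun i u v => c i = x ∧ ∃ l r, Rv (l ++ a :: r) (p i) ∧
    l.head? = some u ∧ l.getLast? = some v
  let A := Act (KY G x a) Arc σ
  have hArc : ∀ i u v, Arc i u v → G.Adj a v ∧ G.Adj x v := by
    rintro i u v ⟨hci, l, r, hR, hu, hv⟩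
    obtain ⟨ok, off⟩ := hcp i
    have hvx : v ≠ x := by
      rintro rfl
      apply ok.nm
      rw [hci, ← hR.perm.mem_iff]
      simp [List.mem_of_getLast? hv]
    apply (kel_adj_a hxa hvx).1
    apply ok.ed s(a, v)
    have : s(a, v) ∈ edL (l ++ a :: r) :=
      mem_edL_split.2 (Or.inr (Or.inr (Or.inl ⟨v, hv, rfl⟩)))
    rcases hR with h | h
    · rwa [← h]
    · rw [h] at this; exact mem_edL_reverse.1 this
  have hA : ∀ v, A v → G.Adj a v ∧ G.Adj x v := by
    intro v hv
    cases hv with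
    | base h _ => exact hArc _ _ _ h
    | step h _ => exact hArc _ _ _ h
  let D : ι → V → Prop := fun i u => KY G x a u ∨ (A u ∧ σ u = i)
  have hstep : ∀ i u v, Arc i u v → D i u → A v := by
    rintro i u v h (hd | ⟨hd, rfl⟩)
    · exact .base h hd
    · exact .step h hd
  have hnew : ∀ i, ∃ c' q', CycOK G c' q' ∧ Off x c' q' ∧ (c i ≠ x → c' = c i ∧ q' = p i) ∧
      (c i = x → (∀ e ∈ edL (p i), a ∉ e → Cov c' q' e) ∧
      (IsEnd (p i) a → Cov c' q' s(x, a)) ∧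
      (∀ u, IsEnd (p i) u → u ≠ a →
        (D i u → Cov c' q' s(a, u)) ∧ (¬ D i u → Cov c' q' s(x, u))) ∧
      (∀ l r u v, Rv (l ++ a :: r) (p i) → l.head? = some u → l.getLast? = some v →
        (D i u → Cov c' q' s(x, v)) ∧ (¬ D i u → Cov c' q' s(a, v)))) := by
    intro i
    obtain ⟨ok, off⟩ := hcp i
    by_cases hci : c i = x
    · rw [hci] at ok
      obtain ⟨c', q', k1, k2, k3⟩ := kel_item hxa (D i)
        (by
          rintro u (h | h)
          · exact h.1
          · exact (hA u h.1).1)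
        (fun u hu hY => hu (Or.inl hY)) ok
      exact ⟨c', q', k1, k2, fun h => absurd hci h, fun _ => k3⟩
    · have hxp : x ∉ p i := by
        rcases off with h | h
        · exact absurd h hci
        · exact h.2
      refine ⟨c i, p i, ⟨ok.nd, ok.nm, ok.ne, ?_, ?_⟩, off, fun _ => ⟨rfl, rfl⟩,
        fun h => absurd h hci⟩
      · intro e he
        exact kel_edge_le (fun hx => hxp (mem_of_mem_edL he hx)) (ok.ed e he)
      · intro u hu
        exact kel_adj_le hci (fun h => hxp (h ▸ hu.mem)) (ok.ends u hu)
  choose c' q' n1 n2 n3 n4 using hnew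
  refine ⟨c', q', fun i => ⟨n1 i, n2 i⟩, ?_⟩
  -- edges at `x`
  have covx : ∀ v, G.Adj x v → ∃ i, Cov (c' i) (q' i) s(x, v) := by
    intro v hv
    have hv' := (kel_adj_x hxa v).2 (Or.inl hv)
    by_cases hva : v = a
    · subst hva
      exact ⟨σ v, (n4 _ (hσ1 v hv')).2.1 (hσ2 v hv')⟩
    · by_cases hAv : A v
      · have : ∃ i u, Arc i u v ∧ D i u := by
          cases hAv with
          | base h h' => exact ⟨_, _, h, Or.inl h'⟩
          | step h h' => exact ⟨_, _, h, Or.inr ⟨h', rfl⟩⟩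
        obtain ⟨i, u, ⟨hci, l, r, hR, hu, hl⟩, hd⟩ := this
        exact ⟨i, ((n4 i hci).2.2.2 l r u v hR hu hl).1 hd⟩
      · refine ⟨σ v, ((n4 _ (hσ1 v hv')).2.2.1 v (hσ2 v hv') hva).2 ?_⟩
        rintro (h | h)
        · exact h.2.2 hv
        · exact hAv h.1
  -- edges at `a`
  have cova : ∀ v, G.Adj a v → v ≠ x → ∃ i, Cov (c' i) (q' i) s(a, v) := by
    intro v hv hvx
    by_cases hY : KY G x a v
    · have hv' := (kel_adj_x hxa v).2 (Or.inr hY)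
      exact ⟨σ v, ((n4 _ (hσ1 v hv')).2.2.1 v (hσ2 v hv') hv.ne').1 (Or.inl hY)⟩
    · have hxv : G.Adj x v := by
        by_contra hc; exact hY ⟨hv, hvx, hc⟩
      have hv' := (kel_adj_x hxa v).2 (Or.inl hxv)
      obtain ⟨i, hi⟩ := hcov s(a, v) ((kel_adj_a hxa hvx).2 ⟨hv, hxv⟩)
      by_cases hci : c i = x
      · have hmem : s(a, v) ∈ edL (p i) := by
          rcases hi with hi | ⟨u, hu, he⟩
          · exact hi
          · rw [hci] at he
            rcases Sym2.eq_iff.1 he with ⟨h1, h2⟩ | ⟨h1, h2⟩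
            · exact absurd h1 hxa.ne'
            · exact absurd h2 hvx
        have hap := mem_of_mem_edL hmem (Sym2.mem_mk_left a v)
        obtain ⟨l, r, hlr⟩ := List.append_of_mem hap
        have hnd := (hcp i).1.nd
        rw [hlr] at hnd
        have hal := notMem_of_nodup hnd
        have : ∃ l r, Rv (l ++ a :: r) (p i) ∧ l.getLast? = some v := by
          rw [hlr] at hmem
          rcases mem_edL_split.1 hmem with h | h | ⟨u, h, he⟩ | ⟨u, h, he⟩
          · exact absurd (mem_of_mem_edL h (Sym2.mem_mk_left a v)) hal.1
          · exact absurd (mem_of_mem_edL h (Sym2.mem_mk_left a v)) hal.2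
          · have : v = u := Sym2.congr_right.1 he
            subst this
            exact ⟨l, r, Or.inl hlr.symm, h⟩
          · have : v = u := Sym2.congr_right.1 he
            subst this
            exact ⟨r.reverse, l.reverse, Or.inr (by rw [hlr]; simp), by simpa using h⟩
        obtain ⟨l, r, hR, hl⟩ := this
        have hne : l ≠ [] := by rintro rfl; simp at hl
        have hu := List.head?_eq_some_head hne
        have key := (n4 i hci).2.2.2 l r _ v hR hu hl
        by_cases hd : D i (l.head hne)
        · have hAv : A v := hstep i _ v ⟨hci, l, r, hR, hu, hl⟩ hd
          exact ⟨σ v, ((n4 _ (hσ1 v hv')).2.2.1 v (hσ2 v hv') hv.ne').1 (Or.inr ⟨hAv, rfl⟩)⟩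
        · exact ⟨i, key.2 hd⟩
      · refine ⟨i, ?_⟩
        rw [(n3 i hci).1, (n3 i hci).2]
        exact hi
  intro e he
  by_cases hxe : x ∈ e
  · obtain ⟨v, rfl⟩ := hxe
    exact covx v he
  by_cases hae : a ∈ e
  · obtain ⟨v, rfl⟩ := hae
    exact cova v he (by rintro rfl; simp at hxe)
  have he' : e ∈ (kel G x a).edgeSet := by
    induction e using Sym2.inductionOn with
    | _ u v =>
    simp at hae
    exact kel_adj_of (Ne.symm hae.1) (Ne.symm hae.2) he
  obtain ⟨i, hi⟩ := hcov e he'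
  refine ⟨i, ?_⟩
  by_cases hci : c i = x
  · rcases hi with hi | ⟨u, hu, he⟩
    · exact (n4 i hci).1 e hi hae
    · rw [hci] at he
      exact absurd (he ▸ Sym2.mem_mk_left x u) hxe
  · rw [(n3 i hci).1, (n3 i hci).2]
    exact hi

end GceAux

namespace GceAux

lemma edL_map {W V : Type*} (f : W → V) : ∀ l : List W,
    edL (l.map f) = (edL l).map (Sym2.map f)
  | [] => rfl
  | [_] => rfl
  | a :: b :: t => by
      have := edL_map f (b :: t)
      simp only [List.map_cons] at this
      simp [this]

/-- The end of a list on the given side. -/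
def endAt {W : Type*} (l : List W) : Bool → Option W
  | true => l.head?
  | false => l.getLast?

lemma X_eq_card {W : Type*} [DecidableEq W] {ι : Type*} [Fintype ι] (p : ι → List W) (w : W) :
    X p w = (Finset.univ.filter (fun z : ι × Bool => endAt (p z.1) z.2 = some w)).card := by
  rw [Finset.card_filter, Fintype.sum_prod_type]
  simp only [X, nE, Fintype.sum_bool]
  refine Finset.sum_congr rfl fun i _ => ?_
  congr!

lemma T_ne_zero {W : Type*} [DecidableEq W] {ι : Type*} [Fintype ι] (p : ι → List W)
    (e : Sym2 W) : T p e ≠ 0 ↔ ∃ i, e ∈ edL (p i) := by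
  simp only [T, ne_eq, Finset.sum_eq_zero_iff, Finset.mem_univ, true_implies, not_forall,
    ← List.count_pos_iff, Nat.pos_iff_ne_zero]

variable {V : Type*} [Fintype V] [DecidableEq V]

lemma exists_flags {W : Type*} [DecidableEq W] [Fintype W] (p : W → List W)
    (hX : ∀ w, X p w = 2) (U : W → Prop) (w : W) (hw : U w) :
    ∃ σ τ : W → W × Bool, (∀ u, endAt (p (σ u).1) (σ u).2 = some u) ∧
      (∀ u, endAt (p (τ u).1) (τ u).2 = some u) ∧ (∀ u, σ u ≠ τ u) ∧
      ∃ i s, ((∃ u, U u ∧ σ u = (i, s)) ∧ ¬ ∃ u, U u ∧ σ u = (i, !s)) := by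
  have h2 : ∀ u, ∃ z z' : W × Bool, endAt (p z.1) z.2 = some u ∧
      endAt (p z'.1) z'.2 = some u ∧ z ≠ z' := by
    intro u
    have h := hX u
    rw [X_eq_card, Finset.card_eq_two] at h
    obtain ⟨z, z', hne, h⟩ := h
    have hz : z ∈ Finset.univ.filter (fun z : W × Bool => endAt (p z.1) z.2 = some u) := by
      rw [h]; simp
    have hz' : z' ∈ Finset.univ.filter (fun z : W × Bool => endAt (p z.1) z.2 = some u) := by
      rw [h]; simp
    simp only [Finset.mem_filter_univ] at hz hz'
    exact ⟨z, z', hz, hz', hne⟩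
  choose e1 e2 h1 h2 hne using h2
  by_cases hc : ∃ u, U u ∧ e1 u = ((e1 w).1, !(e1 w).2)
  · obtain ⟨u, hu, hu'⟩ := hc
    have huw : u ≠ w := by
      rintro rfl
      have := congrArg Prod.snd hu'
      simp at this
    refine ⟨Function.update e1 w (e2 w), Function.update e2 w (e1 w), ?_, ?_, ?_,
      (e1 w).1, !(e1 w).2, ⟨u, hu, ?_⟩, ?_⟩
    · intro v
      by_cases hv : v = w
      · subst hv; simpa using h2 v
      · simpa [Function.update_of_ne hv] using h1 v
    · intro v
      by_cases hv : v = w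
      · subst hv; simpa using h1 v
      · simpa [Function.update_of_ne hv] using h2 v
    · intro v
      by_cases hv : v = w
      · subst hv; simpa using (hne v).symm
      · simpa [Function.update_of_ne hv] using hne v
    · rw [Function.update_of_ne huw]; exact hu'
    · rintro ⟨v, hv, hv'⟩
      rw [Bool.not_not] at hv'
      by_cases hvw : v = w
      · subst hvw
        rw [Function.update_self] at hv'
        exact hne v hv'.symm
      · rw [Function.update_of_ne hvw] at hv'
        have k1 := h1 v
        have k2 := h1 w
        rw [hv'] at k1
        simp only at k1
        rw [k1] at k2
        exact hvw (Option.some.inj k2)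
  · exact ⟨e1, e2, h1, h2, hne, (e1 w).1, (e1 w).2, ⟨w, hw, rfl⟩, hc⟩

lemma cone (G : SimpleGraph V) (x v0 w : V) (hx : ∀ v, v ≠ x → G.Adj x v) (hv0 : v0 ≠ x)
    (hwx : w ≠ x) (hw : G.Adj v0 w) : Fam G x {v : V // v ≠ x ∧ v ≠ v0} := by
  classical
  let W0 := {v : V // v ≠ x ∧ v ≠ v0}
  let val : W0 → V := Subtype.val
  obtain ⟨p, hp, hT, hX⟩ := ppdc (W := W0)
    (Finset.univ.filter (fun e => Sym2.map val e ∈ G.edgeSet)) (by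
      intro e he hd
      simp only [Finset.mem_filter_univ] at he
      induction e using Sym2.inductionOn with
      | _ u v =>
      have : u = v := by simpa using hd
      subst this
      exact G.loopless.irrefl _ he)
  have hTe : ∀ e : Sym2 W0, (∃ i, e ∈ edL (p i)) ↔ Sym2.map val e ∈ G.edgeSet := by
    intro e
    rw [← T_ne_zero, hT]
    simp
  let U : W0 → Prop := fun u => G.Adj v0 u.1
  obtain ⟨σ, τ, hσ, hτ, hστ, i0, s0, hflag⟩ := exists_flags p hX U ⟨w, hwx, hw.ne'⟩ hw
  let F : W0 → Bool → Prop := fun i s => ∃ u, U u ∧ σ u = (i, s)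
  have hF : ∀ i s u, endAt (p i) s = some u → F i s → U u := by
    rintro i s u hu ⟨u', hU, he⟩
    have := hσ u'
    rw [he] at this
    simp only at this
    rw [hu] at this
    rwa [Option.some.inj this]
  have hmem : ∀ i v, v ∈ (p i).map val → v ≠ x ∧ v ≠ v0 := by
    intro i v hv
    obtain ⟨u, -, rfl⟩ := List.mem_map.1 hv
    exact u.2
  have hnew : ∀ i, ∃ c q', CycOK G c q' ∧ Off x c q' ∧ (∀ e ∈ edL ((p i).map val), Cov c q' e) ∧
      (∀ s u, endAt (p i) s = some u →
        (F i s → Cov c q' s(v0, u.1)) ∧ (¬ F i s → Cov c q' s(x, u.1))) ∧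
      ((F i true ∧ ¬ F i false ∨ ¬ F i true ∧ F i false) → Cov c q' s(x, v0)) := by
    intro i
    obtain ⟨c, q', k1, k2, k3, k4, k5, k6⟩ := flag_item G (hx v0 hv0) (q := (p i).map val)
      (by simpa using (hp i).1) ((hp i).2.map Subtype.val_injective)
      (fun h => (hmem i x h).1 rfl) (fun h => (hmem i v0 h).2 rfl)
      (by
        intro e he
        rw [edL_map] at he
        obtain ⟨e', he', rfl⟩ := List.mem_map.1 he
        exact (hTe e').1 ⟨i, he'⟩)
      (F i true) (F i false)
      (by
        intro u hu
        rw [List.head?_map, Option.map_eq_some_iff] at hu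
        obtain ⟨u', hu', rfl⟩ := hu
        exact ⟨fun h => hF i true u' hu' h, fun _ => hx _ u'.2.1⟩)
      (by
        intro u hu
        rw [List.getLast?_map, Option.map_eq_some_iff] at hu
        obtain ⟨u', hu', rfl⟩ := hu
        exact ⟨fun h => hF i false u' hu' h, fun _ => hx _ u'.2.1⟩)
    refine ⟨c, q', k1, k2, k3, ?_, k6⟩
    intro s u hu
    cases s with
    | true => exact k4 u.1 (by rw [List.head?_map]; simp only [endAt] at hu; rw [hu]; rfl)
    | false => exact k5 u.1 (by rw [List.getLast?_map]; simp only [endAt] at hu; rw [hu]; rfl)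
  choose c q' n1 n2 n3 n4 n5 using hnew
  have hxv0 : ∃ i, Cov (c i) (q' i) s(x, v0) := by
    refine ⟨i0, n5 i0 ?_⟩
    cases s0 with
    | true => exact Or.inl hflag
    | false => exact Or.inr ⟨hflag.2, hflag.1⟩
  refine ⟨c, q', fun i => ⟨n1 i, n2 i⟩, ?_⟩
  intro e he
  by_cases hxe : x ∈ e
  · obtain ⟨v, rfl⟩ := hxe
    have hvx : v ≠ x := by rintro rfl; exact G.loopless.irrefl _ he
    by_cases hv : v = v0
    · subst hv; exact hxv0
    · refine ⟨_, (n4 _ _ ⟨v, hvx, hv⟩ (hτ ⟨v, hvx, hv⟩)).2 ?_⟩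
      rintro ⟨u', hU, he'⟩
      have h1 := hσ u'
      have h2 := hτ ⟨v, hvx, hv⟩
      rw [he'] at h1
      rw [h1] at h2
      have : u' = ⟨v, hvx, hv⟩ := Option.some.inj h2
      subst this
      exact hστ _ he'
  by_cases hve : v0 ∈ e
  · obtain ⟨v, rfl⟩ := hve
    have hvx : v ≠ x := by rintro rfl; simp at hxe
    have hv : v ≠ v0 := by rintro rfl; exact G.loopless.irrefl _ he
    exact ⟨_, (n4 _ _ ⟨v, hvx, hv⟩ (hσ ⟨v, hvx, hv⟩)).1 ⟨⟨v, hvx, hv⟩, he, rfl⟩⟩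
  induction e using Sym2.inductionOn with
  | _ u v =>
  simp only [Sym2.mem_iff, not_or] at hxe hve
  obtain ⟨i, hi⟩ := (hTe s(⟨u, Ne.symm hxe.1, Ne.symm hve.1⟩, ⟨v, Ne.symm hxe.2, Ne.symm hve.2⟩)).2 he
  refine ⟨i, n3 i _ ?_⟩
  rw [edL_map]
  exact List.mem_map.2 ⟨_, hi, rfl⟩

lemma Fam.congr {G : SimpleGraph V} {x : V} {ι κ : Type*} (f : κ ≃ ι) (h : Fam G x ι) :
    Fam G x κ := by
  obtain ⟨c, p, h1, h2⟩ := h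
  refine ⟨c ∘ f, p ∘ f, fun i => h1 _, fun e he => ?_⟩
  obtain ⟨i, hi⟩ := h2 e he
  exact ⟨f.symm i, by simpa using hi⟩

lemma kel_connected {G : SimpleGraph V} {x a : V} (hxa : G.Adj x a) (h : G.Connected) :
    (kel G x a).Connected := by
  have hA : (kel G x a).Adj x a := (kel_adj_x hxa a).2 (Or.inl hxa)
  have hY : ∀ v, KY G x a v → (kel G x a).Reachable a v := fun v hv =>
    hA.symm.reachable.trans ((kel_adj_x hxa v).2 (Or.inr hv)).reachable
  have key : ∀ u v, G.Adj u v → (kel G x a).Reachable u v := by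
    intro u v huv
    by_cases h1 : u = a ∧ KY G x a v
    · rw [h1.1]; exact hY v h1.2
    by_cases h2 : v = a ∧ KY G x a u
    · rw [h2.1]; exact (hY u h2.2).symm
    exact SimpleGraph.Adj.reachable (Or.inl ⟨huv, h1, h2⟩)
  have hw : ∀ u v, G.Walk u v → (kel G x a).Reachable u v := by
    intro u v w
    induction w with
    | nil => exact SimpleGraph.Reachable.refl _
    | cons h _ ih => exact (key _ _ h).trans ih
  have := h.nonempty
  exact ⟨fun u v => (h.preconnected u v).elim (hw u v)⟩

lemma kel_card {G : SimpleGraph V} {x a : V} (hxa : G.Adj x a) :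
    G.edgeSet.ncard ≤ (kel G x a).edgeSet.ncard := by
  let Y : Set V := {v | KY G x a v}
  let A : Set (Sym2 V) := (fun v => s(a, v)) '' Y
  let B : Set (Sym2 V) := (fun v => s(x, v)) '' Y
  have hAB : A.ncard = B.ncard := by
    rw [Set.ncard_image_of_injective _ (fun u v h => Sym2.congr_right.1 h),
      Set.ncard_image_of_injective _ (fun u v h => Sym2.congr_right.1 h)]
  have hdis : Disjoint (G.edgeSet \ A) B := by
    rw [Set.disjoint_left]
    rintro e ⟨he, -⟩ ⟨v, hv, rfl⟩
    exact hv.2.2 he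
  have hsub : (G.edgeSet \ A) ∪ B ⊆ (kel G x a).edgeSet := by
    rintro e (⟨he, hA⟩ | ⟨v, hv, rfl⟩)
    · induction e using Sym2.inductionOn with
      | _ u v =>
      refine Or.inl ⟨he, ?_, ?_⟩
      · rintro ⟨rfl, h⟩; exact hA ⟨v, h, rfl⟩
      · rintro ⟨rfl, h⟩; exact hA ⟨u, h, Sym2.eq_swap⟩
    · exact (kel_adj_x hxa v).2 (Or.inr hv)
  calc G.edgeSet.ncard ≤ (G.edgeSet \ A).ncard + A.ncard :=
        Set.ncard_le_ncard_sdiff_add_ncard _ _ (Set.toFinite _)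
    _ = ((G.edgeSet \ A) ∪ B).ncard := by
        rw [hAB, Set.ncard_union_eq hdis (Set.toFinite _) (Set.toFinite _)]
    _ ≤ _ := Set.ncard_le_ncard hsub (Set.toFinite _)

lemma fam_main (x : V) : ∀ (k : ℕ) (G : SimpleGraph V), G.Connected →
    Fintype.card V ≤ G.edgeSet.ncard → {v | v ≠ x ∧ ¬ G.Adj x v}.ncard ≤ k →
    Fam G x (Fin (Fintype.card V - 2)) := by
  intro k
  induction k with
  | zero =>
    intro G hG hE hk
    have hemp : {v | v ≠ x ∧ ¬ G.Adj x v} = ∅ :=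
      (Set.ncard_eq_zero (Set.toFinite _)).1 (by omega)
    have hdom : ∀ v, v ≠ x → G.Adj x v := by
      intro v hv
      by_contra hc
      have : v ∈ {v | v ≠ x ∧ ¬ G.Adj x v} := ⟨hv, hc⟩
      rw [hemp] at this
      exact this
    have hex : ∃ v0 w, v0 ≠ x ∧ w ≠ x ∧ G.Adj v0 w := by
      by_contra hc
      push Not at hc
      have hsub : G.edgeSet ⊆ (fun v => s(x, v)) '' {v | v ≠ x} := by
        intro e he
        induction e using Sym2.inductionOn with
        | _ u v =>
        have he : G.Adj u v := he
        by_cases hu : u = x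
        · subst hu; exact ⟨v, he.ne', rfl⟩
        · by_cases hv : v = x
          · subst hv; exact ⟨u, hu, Sym2.eq_swap⟩
          · exact absurd he (hc u v hu hv)
      have h1 := Set.ncard_le_ncard hsub (Set.toFinite _)
      have h2 : ((fun v => s(x, v)) '' {v | v ≠ x}).ncard ≤ ({v | v ≠ x} : Set V).ncard :=
        Set.ncard_image_le (Set.toFinite _)
      have h3 : ({v | v ≠ x} : Set V).ncard < Fintype.card V := by
        rw [← Nat.card_eq_fintype_card, ← Set.ncard_univ]
        apply Set.ncard_lt_ncard _ (Set.toFinite _)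
        refine Set.ssubset_univ_iff.2 fun h => ?_
        have : x ∈ ({v | v ≠ x} : Set V) := h ▸ Set.mem_univ x
        exact this rfl
      omega
    obtain ⟨v0, w, hv0, hw, hadj⟩ := hex
    have hF := cone G x v0 w hdom hv0 hw hadj
    have hc : Fintype.card {v : V // v ≠ x ∧ v ≠ v0} = Fintype.card V - 2 := by
      rw [Fintype.card_subtype]
      have : (Finset.univ.filter fun v => v ≠ x ∧ v ≠ v0) = ({x, v0} : Finset V)ᶜ := by
        ext v; simp
      rw [this, Finset.card_compl, Finset.card_pair hv0.symm]
    exact hF.congr (Fintype.equivFinOfCardEq hc).symm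
  | succ k ih =>
    intro G hG hE hk
    by_cases hall : ∀ v, v ≠ x → G.Adj x v
    · apply ih G hG hE
      have : {v | v ≠ x ∧ ¬ G.Adj x v} = ∅ := by
        ext v
        simp only [Set.mem_ofPred_eq, Set.mem_empty_iff_false, iff_false]
        rintro ⟨h1, h2⟩
        exact h2 (hall v h1)
      rw [this]
      simp
    · have hex : ∃ a y, G.Adj x a ∧ KY G x a y := by
        by_contra hc
        push Not at hc
        have hw : ∀ u v, G.Walk u v → (u = x ∨ G.Adj x u) → (v = x ∨ G.Adj x v) := by
          intro u v w
          induction w with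
          | nil => exact id
          | cons h _ ih =>
            intro hu
            apply ih
            rcases hu with rfl | hu
            · exact Or.inr h
            · by_contra hn
              push Not at hn
              exact hc _ _ hu ⟨h, hn.1, hn.2⟩
        apply hall
        intro v hv
        obtain ⟨w⟩ := hG.preconnected x v
        exact (hw x v w (Or.inl rfl)).resolve_left hv
      obtain ⟨a, y, hxa, hy⟩ := hex
      apply kel_fam hxa
      apply ih _ (kel_connected hxa hG) (hE.trans (kel_card hxa))
      have : {v | v ≠ x ∧ ¬ (kel G x a).Adj x v}.ncard < {v | v ≠ x ∧ ¬ G.Adj x v}.ncard := by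
        apply Set.ncard_lt_ncard _ (Set.toFinite _)
        refine ⟨fun v hv => ⟨hv.1, fun h => hv.2 ((kel_adj_x hxa v).2 (Or.inl h))⟩, fun h => ?_⟩
        have : y ∈ {v | v ≠ x ∧ ¬ (kel G x a).Adj x v} := h ⟨hy.2.1, hy.2.2⟩
        exact this.2 ((kel_adj_x hxa y).2 (Or.inr hy))
      omega

lemma exists_adj {U : Type*} {G : SimpleGraph U} (h : G.Connected) {u v : U} (huv : u ≠ v) :
    ∃ z, G.Adj u z := by
  obtain ⟨w⟩ := h.preconnected u v
  cases w with
  | nil => exact absurd rfl huv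
  | cons h _ => exact ⟨_, h⟩

lemma card_le (G : SimpleGraph V) (hcard : 3 ≤ Fintype.card V) (hconn : G.Connected)
    (hnocut : ∀ v : V, (G.induce ({v}ᶜ : Set V)).Connected) :
    Fintype.card V ≤ G.edgeSet.ncard := by
  classical
  have hdeg : ∀ v, 2 ≤ G.degree v := by
    intro v
    have : Nontrivial V := Fintype.one_lt_card_iff_nontrivial.1 (by omega)
    obtain ⟨z, hz⟩ := exists_ne v
    obtain ⟨u, hu⟩ := exists_adj hconn hz.symm
    obtain ⟨w, hw⟩ : ∃ w, w ∉ ({v, u} : Finset V) := by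
      by_contra hc
      push Not at hc
      have h1 : (Finset.univ : Finset V).card ≤ ({v, u} : Finset V).card :=
        Finset.card_le_card fun z _ => hc z
      have h2 := Finset.card_le_two (a := v) (b := u)
      rw [Finset.card_univ] at h1
      omega
    simp only [Finset.mem_insert, Finset.mem_singleton, not_or] at hw
    obtain ⟨⟨z', hz'⟩, hadj⟩ := exists_adj (hnocut u) (u := ⟨v, hu.ne⟩) (v := ⟨w, hw.2⟩)
      (fun h => hw.1 (congrArg Subtype.val h).symm)
    have hadj : G.Adj v z' := hadj
    have hzu : z' ≠ u := hz'
    rw [← G.card_neighborFinset_eq_degree, ← Finset.card_pair hzu]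
    apply Finset.card_le_card
    intro t ht
    simp only [Finset.mem_insert, Finset.mem_singleton] at ht
    rcases ht with rfl | rfl
    · simpa using hadj
    · simpa using hu
  have hsum := G.sum_degrees_eq_twice_card_edges
  have hle : ∑ _v : V, 2 ≤ ∑ v, G.degree v := Finset.sum_le_sum fun v _ => hdeg v
  rw [← SimpleGraph.coe_edgeFinset, Set.ncard_coe_finset]
  simp at hle
  omega

end GceAux

/-- Let `G` be a `2`-connected simple graph on `n` vertices (connected, at
least `3` vertices, no cut vertex) whose edge set can be partitioned into the edge set of
an even subgraph `H` and a set of at most `n - 3` single edges.  Then `G` can be covered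
by at most `n - 2` cycles and edges: `g_ce(G) ≤ n - 2`. -/
theorem gce_le_of_two_connected_even_decomposition
    {V : Type*} [Fintype V] [DecidableEq V] (G : SimpleGraph V)
    (hcard : 3 ≤ Fintype.card V)
    (hconn : G.Connected)
    (hnocut : ∀ v : V, (G.induce ({v}ᶜ : Set V)).Connected)
    (H : SimpleGraph V) (hle : H ≤ G)
    (heven : ∀ w : V, Even ((H.neighborSet w).ncard))
    (hrest : (G.edgeSet \ H.edgeSet).ncard ≤ Fintype.card V - 3) :
    gce G ≤ Fintype.card V - 2 := by
  obtain ⟨x⟩ := hconn.nonempty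
  have h := GceAux.fam_main x _ G hconn (GceAux.card_le G hcard hconn hnocut) le_rfl
  simpa using GceAux.gce_le_of_fam h
end
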